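/- arXiv:2003.04282 — 12 statements merged into one kernel-verified Lean document; each statement's English description precedes it below -/
import Mathlib

section
/- For every finite poset P with |P| = k ≥ 2 and every integer n ≥ k, the non-induced saturation number satisfies sat(n,P) ≤ 2^(k-2). In particular, sat(n,P) is bounded above by a constant independent of n. -/
/-- The family `F ⊆ 2^[n]` contains a non-induced (weak) copy of the poset `P`:
there is an injection `f : P → 2^[n]` with image in `F` such that `p ≤ q`
implies `f p ⊆ f q`. -/
def ContainsWeakCopy (P : Type*) [PartialOrder P] {n : ℕ}
    (F : Finset (Finset (Fin n))) : Prop :=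
  ∃ f : P → Finset (Fin n), Function.Injective f ∧ (∀ p, f p ∈ F) ∧
    ∀ p q : P, p ≤ q → f p ⊆ f q

/-- `F` is non-induced `P`-saturating: it is non-induced `P`-free and adding any
set outside of `F` creates a non-induced copy of `P`. -/
def WeakSaturating (P : Type*) [PartialOrder P] {n : ℕ}
    (F : Finset (Finset (Fin n))) : Prop :=
  ¬ ContainsWeakCopy P F ∧
    ∀ G : Finset (Fin n), G ∉ F → ContainsWeakCopy P (insert G F)

/-- `sat(n,P)`: the minimum size of a non-induced `P`-saturating family in `2^[n]`. -/
noncomputable def satN (n : ℕ) (P : Type*) [PartialOrder P] : ℕ :=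
  sInf {m | ∃ F : Finset (Finset (Fin n)), WeakSaturating P F ∧ F.card = m}

theorem cwc_mono {P : Type*} [PartialOrder P] {n : ℕ} {F F' : Finset (Finset (Fin n))}
    (h : F ⊆ F') (hF : ContainsWeakCopy P F) : ContainsWeakCopy P F' := by
  obtain ⟨f, h1, h2, h3⟩ := hF
  exact ⟨f, h1, fun p => h (h2 p), h3⟩

theorem cwc_greedy (P : Type*) [PartialOrder P] [Nonempty P] {n : ℕ} (r : Finset (Fin n) → ℕ)
    (L : Finset (Finset (Fin n))) :
    ∃ F ⊆ L, ¬ ContainsWeakCopy P F ∧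
      ∀ H ∈ L, H ∉ F → ContainsWeakCopy P (insert H (F.filter (fun X => r X ≤ r H))) := by
  classical
  induction L using Finset.induction_on_max_value r with
  | empty =>
    refine ⟨∅, by simp, ?_, by simp⟩
    rintro ⟨f, -, h, -⟩
    simpa using h (Classical.arbitrary P)
  | insert a s ha hmax ih =>
    obtain ⟨F, hFs, hF, hG⟩ := ih
    by_cases hc : ContainsWeakCopy P (insert a F)
    · refine ⟨F, hFs.trans (Finset.subset_insert _ _), hF, ?_⟩
      intro H hH hHF
      rcases Finset.mem_insert.1 hH with rfl | hH
      · rwa [Finset.filter_true_of_mem (fun x hx => hmax x (hFs hx))]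
      · exact hG H hH hHF
    · refine ⟨insert a F, Finset.insert_subset_insert _ hFs, hc, ?_⟩
      intro H hH hHF
      rw [Finset.mem_insert, not_or] at hHF
      have hH := (Finset.mem_insert.1 hH).resolve_left hHF.1
      refine cwc_mono ?_ (hG H hH hHF.2)
      exact Finset.insert_subset_insert _ (Finset.filter_subset_filter _ (Finset.subset_insert _ _))

theorem cwc_replace {P : Type*} [PartialOrder P] {n : ℕ} {F₀ F : Finset (Finset (Fin n))}
    {G H : Finset (Fin n)} (hsub : F₀ ⊆ F) (hG : G ∉ F)
    (h1 : ∀ X ∈ F₀, X ⊆ H → X ⊆ G) (h2 : ∀ X ∈ F₀, H ⊆ X → G ⊆ X)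
    (hc : ContainsWeakCopy P (insert H F₀)) : ContainsWeakCopy P (insert G F) := by
  classical
  obtain ⟨f, hi, hm, ho⟩ := hc
  have hm' : ∀ p, f p ≠ H → f p ∈ F₀ := fun p hp => (Finset.mem_insert.1 (hm p)).resolve_left hp
  refine ⟨fun p => if f p = H then G else f p, ?_, ?_, ?_⟩
  · intro p q hpq
    dsimp only at hpq
    split_ifs at hpq with a b b
    · exact hi (a.trans b.symm)
    · exact absurd (hpq ▸ hsub (hm' q b)) hG
    · exact absurd (hpq ▸ hsub (hm' p a)) hG
    · exact hi hpq
  · intro p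
    dsimp only
    split_ifs with a
    · simp
    · exact Finset.mem_insert_of_mem (hsub (hm' p a))
  · intro p q hpq
    have := ho p q hpq
    dsimp only
    split_ifs with a b b
    · exact subset_rfl
    · exact h2 _ (hm' q b) (a ▸ this)
    · exact h1 _ (hm' p a) (b ▸ this)
    · exact this

theorem cwc_chain {P : Type*} [PartialOrder P] [Fintype P] {n : ℕ}
    {S : Finset (Finset (Fin n))}
    (hch : ∀ X ∈ S, ∀ Y ∈ S, X ⊆ Y ∨ Y ⊆ X) (hcard : Fintype.card P = S.card) :
    ContainsWeakCopy P S := by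
  classical
  have hinj : Set.InjOn Finset.card (S : Set (Finset (Fin n))) := by
    intro X hX Y hY hXY
    rcases hch X hX Y hY with h | h
    · exact Finset.eq_of_subset_of_card_le h hXY.ge
    · exact (Finset.eq_of_subset_of_card_le h hXY.le).symm
  have hT : (S.image Finset.card).card = Fintype.card P := by
    rw [Finset.card_image_of_injOn hinj, hcard]
  letI : Fintype (LinearExtension P) := inferInstanceAs (Fintype P)
  let e : Fin (Fintype.card P) ≃o LinearExtension P := Fintype.orderIsoFinOfCardEq _ rfl
  let g : P → ℕ := fun p => (S.image Finset.card).orderEmbOfFin hT (e.symm (toLinearExtension p))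
  have hg : ∀ p, ∃ X ∈ S, X.card = g p := fun p => by
    have := (S.image Finset.card).orderEmbOfFin_mem hT (e.symm (toLinearExtension p))
    exact Finset.mem_image.1 this
  choose f hfS hfc using hg
  refine ⟨f, ?_, hfS, ?_⟩
  · intro p q hpq
    have : g p = g q := by rw [← hfc, ← hfc, hpq]
    have h2 := e.symm.injective (((S.image Finset.card).orderEmbOfFin hT).injective this)
    exact h2
  · intro p q hpq
    have h1 : g p ≤ g q := by
      apply ((S.image Finset.card).orderEmbOfFin hT).monotone
      exact e.symm.monotone (toLinearExtension.monotone hpq)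
    rw [← hfc, ← hfc] at h1
    rcases hch _ (hfS p) _ (hfS q) with h | h
    · exact h
    · rw [Finset.eq_of_subset_of_card_le h h1]

/-- low part -/
def cwcY {n : ℕ} (l : Fin n) (X : Finset (Fin n)) : Finset (Fin n) := if l ∈ X then Xᶜ else X

/-- rank -/
def cwcR {n : ℕ} (l : Fin n) (X : Finset (Fin n)) : ℕ := ∑ x ∈ cwcY l X, 2 ^ (x : ℕ)

theorem cwcR_lt {n : ℕ} {l : Fin n} {X : Finset (Fin n)} {j : ℕ}
    (h : ∀ x ∈ cwcY l X, (x : ℕ) < j) : cwcR l X < 2 ^ j := by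
  have := Nat.geomSum_lt (m := 2) (n := j) (s := (cwcY l X).map Fin.valEmbedding) le_rfl
    (by intro k hk; simp only [Finset.mem_map] at hk; obtain ⟨a, ha, rfl⟩ := hk; exact h a ha)
  simpa [cwcR] using this

theorem cwcR_bound {n : ℕ} {l : Fin n} {X : Finset (Fin n)} {j : ℕ} (h : cwcR l X < 2 ^ j) :
    ∀ x ∈ cwcY l X, (x : ℕ) < j := by
  intro x hx
  have h1 : 2 ^ (x : ℕ) ≤ cwcR l X :=
    Finset.single_le_sum (f := fun x : Fin n => 2 ^ (x : ℕ)) (fun _ _ => Nat.zero_le _) hx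
  exact (Nat.pow_lt_pow_iff_right (by norm_num)).1 (h1.trans_lt h)

theorem cwcR_eq {n : ℕ} {l : Fin n} {X H : Finset (Fin n)} (hr : cwcR l X ≤ cwcR l H)
    (h : cwcY l H ⊆ cwcY l X) : cwcY l H = cwcY l X := by
  by_contra hne
  obtain ⟨x, hx, hxH⟩ := Finset.exists_of_ssubset (lt_of_le_of_ne h hne)
  have : cwcR l H < cwcR l X :=
    Finset.sum_lt_sum_of_subset h hx hxH (by positivity) (fun _ _ _ => Nat.zero_le _)
  omega

/-- If `H` agrees with `G` below `j`, and is constant from `j` on, then things before `H`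
do not distinguish `G` and `H`. -/
theorem cwc_key {n : ℕ} {l : Fin n} (hl : ∀ x, x ≤ l) {G H X : Finset (Fin n)} {j : ℕ}
    (hjl : j ≤ (l : ℕ))
    (hagree : ∀ x : Fin n, (x : ℕ) < j → (x ∈ H ↔ x ∈ G))
    (hconst : ∀ x : Fin n, j ≤ (x : ℕ) → (x ∈ H ↔ l ∈ H))
    (hin : ∃ x : Fin n, j ≤ (x : ℕ) ∧ x ∈ G) (hout : ∃ x : Fin n, j ≤ (x : ℕ) ∧ x ∉ G)
    (hr : cwcR l X ≤ cwcR l H) (hXH : X ≠ H) :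
    (X ⊆ H → X ⊆ G) ∧ (H ⊆ X → G ⊆ X) := by
  have hH : cwcR l H < 2 ^ j := by
    apply cwcR_lt
    intro x hx
    by_contra hj
    have := hconst x (by omega)
    unfold cwcY at hx
    split_ifs at hx with h
    · simp at hx; tauto
    · tauto
  have hX := cwcR_bound (hr.trans_lt hH)
  have heq := cwcR_eq (l := l) (X := X) (H := H) hr
  obtain ⟨a, haj, ha⟩ := hin
  obtain ⟨b, hbj, hb⟩ := hout
  unfold cwcY at hX heq
  by_cases hlX : l ∈ X <;> by_cases hlH : l ∈ H <;> simp only [hlX, hlH, if_true, if_false] at hX heq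
  · constructor
    · intro h
      exact absurd (compl_injective (heq (Finset.compl_subset_compl.2 h))).symm hXH
    · intro h x hx
      by_contra hxX
      have := hX x (by simpa using hxX)
      exact hxX (h ((hagree x this).2 hx))
  · constructor
    · intro h; exact absurd (h hlX) hlH
    · intro h x hx
      by_contra hxX
      have := hX x (by simpa using hxX)
      exact hxX (h ((hagree x this).2 hx))
  · constructor
    · intro h x hx
      exact (hagree x (hX x hx)).1 (h hx)
    · intro h; exact absurd (h hlH) hlX
  · constructor
    · intro h x hx
      exact (hagree x (hX x hx)).1 (h hx)
    · intro h
      exact absurd (heq h).symm hXH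

/-- stage sets -/
def cwcC {n : ℕ} (G : Finset (Fin n)) (j : Fin n) : Finset (Fin n) :=
  Finset.univ.filter (fun x => (x ≤ j ∧ x ∈ G) ∨ (j < x ∧ j ∉ G))

theorem mem_cwcC {n : ℕ} {G : Finset (Fin n)} {j x : Fin n} :
    x ∈ cwcC G j ↔ (x ≤ j ∧ x ∈ G) ∨ (j < x ∧ j ∉ G) := by simp [cwcC]

theorem cwcC_comp {n : ℕ} (G : Finset (Fin n)) {i j : Fin n} (h : i < j) :
    cwcC G i ⊆ cwcC G j ∨ cwcC G j ⊆ cwcC G i := by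
  by_cases hi : i ∈ G
  · left; intro x hx
    rw [mem_cwcC] at *
    rcases hx with hx | hx
    · exact Or.inl ⟨hx.1.trans h.le, hx.2⟩
    · exact absurd hi hx.2
  · right; intro x hx
    rw [mem_cwcC] at *
    rcases le_or_gt x i with h' | h'
    · rcases hx with hx | hx
      · exact Or.inl ⟨h', hx.2⟩
      · exact absurd (hx.1.trans_le h') (not_lt.2 h.le)
    · exact Or.inr ⟨h', hi⟩

theorem cwcC_compG {n : ℕ} (G : Finset (Fin n)) (i : Fin n) :
    cwcC G i ⊆ G ∨ G ⊆ cwcC G i := by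
  by_cases hi : i ∈ G
  · left; intro x hx
    rw [mem_cwcC] at hx
    tauto
  · right; intro x hx
    rw [mem_cwcC]
    rcases le_or_gt x i with h' | h' <;> tauto

/-- For every finite poset `P` on `k ≥ 2` elements and every `n ≥ k`,
`sat(n,P) ≤ 2^(k-2)`. -/
theorem sat_le_two_pow (P : Type*) [PartialOrder P] [Fintype P] (k n : ℕ)
    (hk : Fintype.card P = k) (hk2 : 2 ≤ k) (hn : k ≤ n) :
    satN n P ≤ 2 ^ (k - 2) := by
  classical
  suffices h : ∃ F : Finset (Finset (Fin n)), WeakSaturating P F ∧ F.card ≤ 2 ^ (k - 2) by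
    obtain ⟨F, hF, hc⟩ := h
    have h1 : satN n P ≤ F.card := Nat.sInf_le ⟨F, hF, rfl⟩
    exact h1.trans hc
  rcases Nat.lt_or_ge k 3 with hk3 | hk3
  · obtain rfl : k = 2 := by omega
    refine ⟨{∅}, ⟨?_, ?_⟩, by simp⟩
    · rintro ⟨f, hi, hm, -⟩
      have : Fintype.card P ≤ 1 := Fintype.card_le_one_iff.2 fun a b => hi (by
        have ha := hm a
        have hb := hm b
        simp at ha hb
        rw [ha, hb])
      omega
    · intro G hG
      apply cwc_chain
      · intro X hX Y hY
        simp only [Finset.mem_insert, Finset.mem_singleton] at hX hY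
        rcases hX with rfl | rfl <;> rcases hY with rfl | rfl <;> simp
      · rw [Finset.card_insert_of_notMem hG]; simpa using hk
  obtain ⟨m, rfl⟩ : ∃ m, k = m + 3 := ⟨k - 3, by omega⟩
  haveI : Nonempty P := Fintype.card_pos_iff.1 (by omega)
  let l : Fin n := ⟨n - 1, by omega⟩
  have hl : ∀ x : Fin n, x ≤ l := fun x => by
    rw [Fin.le_def]; have := x.2; simp only [l]; omega
  have hlv : (l : ℕ) = n - 1 := rfl
  let L : Finset (Finset (Fin n)) :=
    Finset.univ.filter (fun X => ∀ x : Fin n, m ≤ (x : ℕ) → (x ∈ X ↔ l ∈ X))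
  have hL : ∀ X, X ∈ L ↔ ∀ x : Fin n, m ≤ (x : ℕ) → (x ∈ X ↔ l ∈ X) := fun X => by simp [L]
  have hLcard : L.card ≤ 2 ^ (m + 1) := by
    let U : Finset (Fin n) := Finset.univ.filter (fun x => (x : ℕ) < m + 1)
    have hU : U.card ≤ m + 1 := by
      have : (U.map Fin.valEmbedding) ⊆ Finset.range (m + 1) := by
        intro x hx
        simp [U] at hx ⊢
        obtain ⟨a, ha, rfl⟩ := hx
        omega
      simpa using Finset.card_le_card this
    have h1 : L.card ≤ U.powerset.card := by
      apply Finset.card_le_card_of_injOn (fun X => X ∩ U)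
      · intro X _
        simp
      · intro X hX Y hY hXY
        have hX := (hL X).1 hX
        have hY := (hL Y).1 hY
        have hXY' : ∀ x : Fin n, (x : ℕ) < m + 1 → (x ∈ X ↔ x ∈ Y) := fun x hx => by
          have := Finset.ext_iff.1 hXY x
          have hxU : x ∈ U := by simp only [U, Finset.mem_filter, Finset.mem_univ, true_and]; exact hx
          simpa only [Finset.mem_inter, hxU, and_true] using this
        ext x
        rcases Nat.lt_or_ge (x : ℕ) m with h | h
        · exact hXY' x (by omega)
        · have hm : m < n := by omega
          rw [hX x h, hY x h, ← hX ⟨m, hm⟩ le_rfl, ← hY ⟨m, hm⟩ le_rfl]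
          exact hXY' _ (by simp)
    rw [Finset.card_powerset] at h1
    exact h1.trans (Nat.pow_le_pow_right (by norm_num) hU)
  obtain ⟨F, hFL, hF, hgr⟩ := cwc_greedy P (cwcR l) L
  refine ⟨F, ⟨hF, ?_⟩, (Finset.card_le_card hFL).trans hLcard⟩
  intro G hGF
  by_cases hGL : G ∈ L
  · exact cwc_mono (Finset.insert_subset_insert _ (Finset.filter_subset _ _)) (hgr G hGL hGF)
  by_contra hbad
  have hio : (∃ x : Fin n, m ≤ (x : ℕ) ∧ x ∈ G) ∧ (∃ x : Fin n, m ≤ (x : ℕ) ∧ x ∉ G) := by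
    rw [hL] at hGL
    push Not at hGL
    obtain ⟨x, hx, hxG⟩ := hGL
    have hml : m ≤ (l : ℕ) := by omega
    by_cases h : x ∈ G
    · exact ⟨⟨x, hx, h⟩, l, hml, by tauto⟩
    · exact ⟨⟨l, hml, by tauto⟩, x, hx, h⟩
  obtain ⟨⟨a, ham, ha⟩, b, hbm, hb⟩ := hio
  have key : ∀ (H : Finset (Fin n)) (j : ℕ), j ≤ m →
      (∀ x : Fin n, (x : ℕ) < j → (x ∈ H ↔ x ∈ G)) →
      (∀ x : Fin n, j ≤ (x : ℕ) → (x ∈ H ↔ l ∈ H)) → H ∈ F := by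
    intro H j hj h1 h2
    by_contra hHF
    have hHL : H ∈ L := (hL H).2 fun x hx => h2 x (hj.trans hx)
    have hcp : ∀ X ∈ F.filter (fun X => cwcR l X ≤ cwcR l H),
        (X ⊆ H → X ⊆ G) ∧ (H ⊆ X → G ⊆ X) := by
      intro X hX
      rw [Finset.mem_filter] at hX
      exact cwc_key hl (j := j) (by omega) h1 h2 ⟨a, hj.trans ham, ha⟩ ⟨b, hj.trans hbm, hb⟩ hX.2
        (fun h => hHF (h ▸ hX.1))
    exact hbad (cwc_replace (Finset.filter_subset _ _) hGF (fun X hX => (hcp X hX).1)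
      (fun X hX => (hcp X hX).2) (hgr H hHL hHF))
  have hE : ∅ ∈ F := key ∅ 0 (by omega) (by simp) (by simp)
  have hUn : Finset.univ ∈ F := key Finset.univ 0 (by omega) (by simp) (by simp)
  let J : Finset (Fin n) := Finset.univ.filter (fun x => (x : ℕ) < m)
  have hJ : J.card = m := by
    have : (J.map Fin.valEmbedding) = Finset.range m := by
      ext x
      simp [J]
      constructor
      · rintro ⟨a, ha, rfl⟩; exact ha
      · intro h; exact ⟨⟨x, by omega⟩, h, rfl⟩
    simpa using congrArg Finset.card this
  have hcl : ∀ j ∈ J, j < l := fun j hj => by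
    simp [J] at hj
    rw [Fin.lt_def]; omega
  have hC : ∀ j ∈ J, cwcC G j ∈ F := by
    intro j hj
    have hjl := hcl j hj
    simp [J] at hj
    apply key _ (j + 1) (by omega)
    · intro x hx
      have : x ≤ j := by rw [Fin.le_def]; omega
      have h2 := not_lt.2 this
      rw [mem_cwcC]; tauto
    · intro x hx
      have : j < x := by rw [Fin.lt_def]; omega
      have h2 := not_le.2 this
      have h3 := not_le.2 hjl
      rw [mem_cwcC, mem_cwcC]; tauto
  -- nonconstancy
  have hjj : ∀ j ∈ J, ¬ (j ∈ cwcC G j ↔ l ∈ cwcC G j) := by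
    intro j hj
    have hjl := hcl j hj
    have h3 := not_le.2 hjl
    have h4 := lt_irrefl j
    have h5 := le_refl j
    rw [mem_cwcC, mem_cwcC]; tauto
  have hlt : ∀ i ∈ J, ∀ j ∈ J, i < j → cwcC G i ≠ cwcC G j := by
    intro i hi j hj hij he
    apply hjj j hj
    rw [← he, mem_cwcC, mem_cwcC]
    have h1 := not_le.2 hij
    have h2 := hcl i hi
    have h3 := not_le.2 h2
    tauto
  have hinj : Set.InjOn (cwcC G) (J : Set (Fin n)) := by
    intro i hi j hj he
    rcases lt_trichotomy i j with h | h | h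
    · exact absurd he (hlt i hi j hj h)
    · exact h
    · exact absurd he.symm (hlt j hj i hi h)
  let T := J.image (cwcC G)
  have hT : T.card = m := by rw [Finset.card_image_of_injOn hinj, hJ]
  have hUT : Finset.univ ∉ T := by
    intro h
    obtain ⟨j, hj, he⟩ := Finset.mem_image.1 h
    apply hjj j hj
    simp [he]
  have hET : ∅ ∉ insert Finset.univ T := by
    intro h
    rcases Finset.mem_insert.1 h with h | h
    · have := Finset.ext_iff.1 h l
      simp at this
    · obtain ⟨j, hj, he⟩ := Finset.mem_image.1 h
      apply hjj j hj
      simp [he]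
  have hSF : insert ∅ (insert Finset.univ T) ⊆ F := by
    intro X hX
    simp only [Finset.mem_insert, T, Finset.mem_image] at hX
    rcases hX with rfl | rfl | ⟨j, hj, rfl⟩
    exacts [hE, hUn, hC j hj]
  apply hbad
  apply cwc_mono (Finset.insert_subset_insert G hSF)
  apply cwc_chain
  · intro X hX Y hY
    simp only [Finset.mem_insert, T, Finset.mem_image] at hX hY
    rcases hX with rfl | rfl | rfl | ⟨i, hi, rfl⟩ <;>
      rcases hY with rfl | rfl | rfl | ⟨j, hj, rfl⟩ <;>
      first
      | exact Or.inl subset_rfl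
      | exact Or.inl (Finset.empty_subset _)
      | exact Or.inr (Finset.empty_subset _)
      | exact Or.inl (Finset.subset_univ _)
      | exact Or.inr (Finset.subset_univ _)
      | exact cwcC_compG _ _
      | exact (cwcC_compG _ _).symm
      | skip
    rcases lt_trichotomy i j with h | h | h
    · exact cwcC_comp G h
    · exact Or.inl (h ▸ subset_rfl)
    · exact (cwcC_comp G h).symm
  · rw [Finset.card_insert_of_notMem (fun h => hGF (hSF h)), Finset.card_insert_of_notMem hET,
      Finset.card_insert_of_notMem hUT, hT, hk]
end

section
/- For every finite nonempty poset P, exactly one of the following alternatives holds: either there exists a constant K (depending only on P) such that sat*(n,P) ≤ K for all n ≥ 1, or sat*(n,P) ≥ log₂ n for all n ≥ 1. -/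
/-- The family `F ⊆ 2^[n]` contains an induced (strong) copy of the poset `P`:
there is an injection `f : P → 2^[n]` with image in `F` such that `p ≤ q`
holds if and only if `f p ⊆ f q`. -/
def ContainsIndCopy (P : Type*) [PartialOrder P] {n : ℕ}
    (F : Finset (Finset (Fin n))) : Prop :=
  ∃ f : P → Finset (Fin n), Function.Injective f ∧ (∀ p, f p ∈ F) ∧
    ∀ p q : P, p ≤ q ↔ f p ⊆ f q

/-- `F` is induced `P`-saturating: it is induced `P`-free and adding any set
outside of `F` creates an induced copy of `P`. -/
def IndSaturating (P : Type*) [PartialOrder P] {n : ℕ}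
    (F : Finset (Finset (Fin n))) : Prop :=
  ¬ ContainsIndCopy P F ∧
    ∀ G : Finset (Fin n), G ∉ F → ContainsIndCopy P (insert G F)

/-- `sat*(n,P)`: the minimum size of an induced `P`-saturating family in `2^[n]`. -/
noncomputable def satStar (n : ℕ) (P : Type*) [PartialOrder P] : ℕ :=
  sInf {m | ∃ F : Finset (Finset (Fin n)), IndSaturating P F ∧ F.card = m}

theorem containsIndCopy_of_le {P : Type*} [PartialOrder P] {n : ℕ}
    {F : Finset (Finset (Fin n))} (f : P → Finset (Fin n)) (h1 : ∀ p, f p ∈ F)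
    (h2 : ∀ p q : P, p ≤ q ↔ f p ⊆ f q) : ContainsIndCopy P F := by
  refine ⟨f, ?_, h1, h2⟩
  intro p q h
  exact le_antisymm ((h2 p q).2 h.subset) ((h2 q p).2 h.symm.subset)

theorem exists_indSaturating (P : Type*) [PartialOrder P] [Nonempty P] (n : ℕ) :
    ∃ F : Finset (Finset (Fin n)), IndSaturating P F := by
  have hne : ({F | ¬ ContainsIndCopy P F} : Set (Finset (Finset (Fin n)))).Nonempty := by
    refine ⟨∅, ?_⟩
    rintro ⟨f, -, h, -⟩
    have := h (Classical.arbitrary P)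
    simp at this
  obtain ⟨F, hF⟩ := (Set.toFinite
    ({F | ¬ ContainsIndCopy P F} : Set (Finset (Finset (Fin n))))).exists_maximal hne
  refine ⟨F, hF.1, ?_⟩
  intro G hG
  by_contra hc
  have := hF.2 (show insert G F ∈ {F | ¬ ContainsIndCopy P F} from hc) (Finset.subset_insert G F)
  exact hG (this (Finset.mem_insert_self G F))

theorem exists_proxy {n m : ℕ} (F : Finset (Finset (Fin n))) (x y : Fin n) (hxy : x ≠ y)
    (hF : ∀ A ∈ F, x ∈ A ↔ y ∈ A) (φ : Fin m → Fin n) (e : Fin n → Fin m)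
    (h1 : ∀ i, φ (e i) = i) (h2 : ∀ j, φ j = x ∨ e (φ j) = j)
    (G : Finset (Fin m))
    (hG : G ∉ F.image (fun A => Finset.univ.filter (fun j => φ j ∈ A))) :
    ∃ G0 ∉ F, ∀ A ∈ F, (A ⊆ G0 ↔ Finset.univ.filter (fun j => φ j ∈ A) ⊆ G) ∧
      (G0 ⊆ A ↔ G ⊆ Finset.univ.filter (fun j => φ j ∈ A)) := by
  by_cases hc : ∃ B : Finset (Fin n), G = Finset.univ.filter (fun j => φ j ∈ B)
  · obtain ⟨B, rfl⟩ := hc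
    refine ⟨B, fun hB => hG (Finset.mem_image_of_mem _ hB), fun A hA => ⟨?_, ?_⟩⟩
    · simp only [Finset.subset_iff, Finset.mem_filter, Finset.mem_univ, true_and]
      exact ⟨fun h j hj => h hj, fun h i hi => by simpa [h1] using @h (e i) (by simpa [h1])⟩
    · simp only [Finset.subset_iff, Finset.mem_filter, Finset.mem_univ, true_and]
      exact ⟨fun h j hj => h hj, fun h i hi => by simpa [h1] using @h (e i) (by simpa [h1])⟩
  have key : ∃ a b, (φ a = x ∨ φ a = y) ∧ (φ b = x ∨ φ b = y) ∧ a ∈ G ∧ b ∉ G := by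
    by_contra hk
    push Not at hk
    apply hc
    refine ⟨Finset.univ.filter (fun i => e i ∈ G), ?_⟩
    ext j
    simp only [Finset.mem_filter, Finset.mem_univ, true_and]
    rcases h2 j with h | h
    · exact ⟨fun hj => hk j _ (Or.inl h) (Or.inl (by rw [h1, h])) hj,
        fun hj => hk _ j (Or.inl (by rw [h1, h])) (Or.inl h) hj⟩
    · rw [h]
  obtain ⟨a, b, ha, hb, haG, hbG⟩ := key
  refine ⟨Finset.univ.filter (fun i => i = x ∨ (i ≠ y ∧ e i ∈ G)), ?_, fun A hA => ⟨?_, ?_⟩⟩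
  · intro h
    have := hF _ h
    simp [hxy.symm] at this
  · have hA' := hF A hA
    simp only [Finset.subset_iff, Finset.mem_filter, Finset.mem_univ, true_and]
    constructor
    · intro h j hj
      have hy : y ∉ A := fun hy => by
        have := h hy
        simp [hxy.symm] at this
      rcases h hj with h' | h'
      · rw [h', hA'] at hj; exact absurd hj hy
      · rcases h2 j with h3 | h3
        · rw [h3, hA'] at hj; exact absurd hj hy
        · rw [← h3]; exact h'.2
    · intro h i hi
      have hb' : φ b ∉ A := fun hbA => hbG (h hbA)
      have hy : y ∉ A := by
        rcases hb with hb | hb <;> rw [hb] at hb'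
        · rwa [← hA']
        · exact hb'
      right
      refine ⟨fun hiy => hy (hiy ▸ hi), h (by rwa [h1])⟩
  · have hA' := hF A hA
    simp only [Finset.subset_iff, Finset.mem_filter, Finset.mem_univ, true_and]
    constructor
    · intro h j hj
      have hx : x ∈ A := h (Or.inl rfl)
      rcases h2 j with h3 | h3
      · rwa [h3]
      · by_cases hy : φ j = y
        · rw [hy]; exact hA'.1 hx
        · exact h (Or.inr ⟨hy, by rwa [h3]⟩)
    · intro h i hi
      rcases hi with rfl | hi
      · have := h haG
        rcases ha with ha | ha <;> rw [ha] at this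
        · exact this
        · exact hA'.2 this
      · have := h hi.2
        rwa [h1] at this

theorem indSaturating_blowup {P : Type*} [PartialOrder P] {n m : ℕ}
    (F : Finset (Finset (Fin n))) (hs : IndSaturating P F) (x y : Fin n) (hxy : x ≠ y)
    (hF : ∀ A ∈ F, x ∈ A ↔ y ∈ A) (φ : Fin m → Fin n) (e : Fin n → Fin m)
    (h1 : ∀ i, φ (e i) = i) (h2 : ∀ j, φ j = x ∨ e (φ j) = j) :
    IndSaturating P (F.image (fun A => Finset.univ.filter (fun j => φ j ∈ A))) := by
  have hsub : ∀ A B : Finset (Fin n), Finset.univ.filter (fun j => φ j ∈ A) ⊆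
      Finset.univ.filter (fun j => φ j ∈ B) ↔ A ⊆ B := by
    intro A B
    simp only [Finset.subset_iff, Finset.mem_filter, Finset.mem_univ, true_and]
    exact ⟨fun h i hi => by simpa [h1] using @h (e i) (by simpa [h1]), fun h j hj => h hj⟩
  constructor
  · rintro ⟨f, -, hf, hle⟩
    apply hs.1
    simp only [Finset.mem_image] at hf
    choose g hg hgf using hf
    refine containsIndCopy_of_le g hg fun p q => ?_
    rw [hle, ← hgf p, ← hgf q, hsub]
  · intro G hG
    obtain ⟨G0, hG0, hcmp⟩ := exists_proxy F x y hxy hF φ e h1 h2 G hG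
    obtain ⟨f, -, hf, hle⟩ := hs.2 G0 hG0
    refine containsIndCopy_of_le
      (fun p => if f p = G0 then G else Finset.univ.filter (fun j => φ j ∈ f p)) ?_ ?_
    · intro p
      by_cases h : f p = G0
      · simp [h]
      · have := Finset.mem_of_mem_insert_of_ne (hf p) h
        simp only [h, if_false]
        exact Finset.mem_insert_of_mem (Finset.mem_image_of_mem _ this)
    · intro p q
      rw [hle]
      by_cases hp : f p = G0 <;> by_cases hq : f q = G0
      · simp [hp, hq]
      · simp only [hp, hq, if_true, if_false]
        exact (hcmp _ (Finset.mem_of_mem_insert_of_ne (hf q) hq)).2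
      · simp only [hp, hq, if_true, if_false]
        exact (hcmp _ (Finset.mem_of_mem_insert_of_ne (hf p) hp)).1
      · simp only [hp, hq, if_false]
        exact (hsub _ _).symm

/-- Dichotomy: for any finite nonempty poset `P`, either `sat*(n,P)` is bounded by a
constant `K` depending only on `P`, or `sat*(n,P) ≥ log₂ n` for all `n ≥ 1`. -/
theorem satStar_dichotomy (P : Type*) [PartialOrder P] [Fintype P] [Nonempty P] :
    (∃ K : ℕ, ∀ n : ℕ, 1 ≤ n → satStar n P ≤ K) ∨
    (∀ n : ℕ, 1 ≤ n → Real.logb 2 n ≤ (satStar n P : ℝ)) := by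
  rw [or_iff_not_imp_right]
  intro h
  push Not at h
  obtain ⟨n, hn, hlt⟩ := h
  have hmem : satStar n P ∈
      {m | ∃ F : Finset (Finset (Fin n)), IndSaturating P F ∧ F.card = m} := by
    obtain ⟨F, hF⟩ := exists_indSaturating P n
    exact Nat.sInf_mem ⟨F.card, F, hF, rfl⟩
  obtain ⟨F, hs, hcard⟩ := hmem
  rw [Real.lt_logb_iff_rpow_lt (by norm_num) (by exact_mod_cast hn), Real.rpow_natCast,
    ← hcard] at hlt
  have hlt' : 2 ^ F.card < n := by exact_mod_cast hlt
  obtain ⟨x, -, y, -, hxy, hEq⟩ := Finset.exists_ne_map_eq_of_card_lt_of_maps_to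
    (s := (Finset.univ : Finset (Fin n))) (t := F.powerset)
    (f := fun i => F.filter (fun A => i ∈ A)) (by simpa using hlt')
    (fun i _ => Finset.mem_coe.2 (Finset.mem_powerset.2 (Finset.filter_subset _ _)))
  have hF : ∀ A ∈ F, x ∈ A ↔ y ∈ A := by
    intro A hA
    have := congrArg (fun S => A ∈ S) hEq
    simpa [hA] using this
  refine ⟨F.card + ∑ i ∈ Finset.range n, satStar i P, fun m _ => ?_⟩
  by_cases hmn : m < n
  · have := Finset.single_le_sum (f := fun i => satStar i P) (fun i _ => Nat.zero_le _)
      (Finset.mem_range.2 hmn)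
    omega
  · have hnm : n ≤ m := by omega
    have hb := indSaturating_blowup F hs x y hxy hF
      (fun j : Fin m => if h : j.1 < n then ⟨j.1, h⟩ else x) (Fin.castLE hnm)
      (by intro i; simp) (by
        intro j
        by_cases h : j.1 < n
        · right; ext; simp [h]
        · left; simp [h])
    have h3 : satStar m P ≤ _ := Nat.sInf_le ⟨_, hb, rfl⟩
    exact h3.trans (Finset.card_image_le.trans (Nat.le_add_right _ _))
end

section
/- Let P be a finite poset on k elements, and suppose there exists an element p ∈ P such that |{q ∈ P : q <_P p}| ≤ 1 and |{q ∈ P : p <_P q}| ≤ 1 (i.e., p has at most one element strictly below it and at most one element strictly above it in P). Then for every n ≥ k, sat(n,P) = k − 1. -/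
theorem exists_rank (P : Type*) [PartialOrder P] [Fintype P] :
    ∃ e : P → ℕ, Function.Injective e ∧ Monotone e ∧ ∀ q, e q < Fintype.card P := by
  classical
  have : Fintype (LinearExtension P) := inferInstanceAs (Fintype P)
  have hc : Fintype.card (LinearExtension P) = Fintype.card P :=
    Fintype.card_congr (Equiv.refl P)
  let o := Fintype.orderIsoFinOfCardEq (LinearExtension P) hc
  refine ⟨fun q => (o.symm (toLinearExtension q)).val, ?_, ?_, fun q => Fin.is_lt _⟩
  · intro a b h
    exact o.symm.injective (Fin.ext h)
  · intro a b h
    exact o.symm.monotone (toLinearExtension.monotone h)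

theorem copy_card (P : Type*) [PartialOrder P] [Fintype P] {n : ℕ}
    (F : Finset (Finset (Fin n))) (h : ContainsWeakCopy P F) : Fintype.card P ≤ F.card := by
  obtain ⟨f, hf, hF, -⟩ := h
  exact Finset.card_le_card_of_injOn f (fun p _ => hF p) hf.injOn

theorem sat_lower (P : Type*) [PartialOrder P] [Fintype P] {n : ℕ}
    (hn : Fintype.card P ≤ n)
    (F : Finset (Finset (Fin n))) (h : WeakSaturating P F) : Fintype.card P - 1 ≤ F.card := by
  by_cases hG : ∃ G, G ∉ F
  · obtain ⟨G, hG⟩ := hG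
    have := copy_card P _ (h.2 G hG)
    rw [Finset.card_insert_of_notMem hG] at this
    omega
  · push Not at hG
    have : F = Finset.univ := Finset.eq_univ_iff_forall.2 hG
    have h2 : n < 2 ^ n := Nat.lt_two_pow_self
    rw [this, Finset.card_univ, Fintype.card_finset, Fintype.card_fin]
    omega

def initSeg (n m : ℕ) : Finset (Fin n) := Finset.univ.filter (fun i => i.val < m)

theorem initSeg_mono (n : ℕ) {a b : ℕ} (h : a ≤ b) : initSeg n a ⊆ initSeg n b := by
  intro i
  simp only [initSeg, Finset.mem_filter, Finset.mem_univ, true_and]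
  omega

theorem initSeg_inj (n : ℕ) {a b : ℕ} (ha : a ≤ n) (hb : b ≤ n)
    (h : initSeg n a = initSeg n b) : a = b := by
  have key : ∀ c : ℕ, ∀ x (hx : x < n), ((⟨x, hx⟩ : Fin n) ∈ initSeg n c ↔ x < c) := by
    intro c x hx
    simp [initSeg]
  by_contra hne
  rcases Nat.lt_or_gt_of_ne hne with hl | hl
  · have h1 := key a a (by omega)
    have h2 := key b a (by omega)
    rw [h] at h1
    have := h1.1 (h2.2 hl)
    omega
  · have h1 := key a b (by omega)
    have h2 := key b b (by omega)
    rw [h] at h1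
    have := h2.1 (h1.2 hl)
    omega

theorem sat_eq_card_sub_one (P : Type*) [PartialOrder P] [Fintype P] (k n : ℕ)
    (hk : Fintype.card P = k) (p : P)
    (hbelow : Set.ncard {q : P | q < p} ≤ 1)
    (habove : Set.ncard {q : P | p < q} ≤ 1)
    (hn : k ≤ n) :
    satN n P = k - 1 := by
  classical
  subst hk
  rw [Set.ncard_le_one (Set.toFinite _)] at hbelow habove
  obtain ⟨e, einj, emono, elt⟩ := exists_rank P
  have hp := elt p
  let s : P → ℕ := fun q =>
    if q < p then 0 else if p < q then n else if e q < e p then e q + 1 else e q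
  have hs : ∀ q, s q = if q < p then 0 else if p < q then n else
    if e q < e p then e q + 1 else e q := fun _ => rfl
  have ene : ∀ q, q ≠ p → e q ≠ e p := fun q hq h => hq (einj h)
  have sle : ∀ q, s q ≤ n := by
    intro q
    have := elt q
    rw [hs]
    split_ifs <;> omega
  have smono : ∀ q r, q ≠ p → r ≠ p → q ≤ r → s q ≤ s r := by
    intro q r hq hr hqr
    by_cases h1 : q < p
    · rw [hs q, if_pos h1]; exact Nat.zero_le _
    have h2 : ¬ r < p := fun h => h1 (lt_of_le_of_lt hqr h)
    by_cases h3 : p < r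
    · rw [hs r, if_neg h2, if_pos h3]; exact sle q
    have h4 : ¬ p < q := fun h => h3 (lt_of_lt_of_le h hqr)
    have := emono hqr
    have := ene q hq
    have := ene r hr
    rw [hs, hs, if_neg h1, if_neg h2, if_neg h3, if_neg h4]
    split_ifs <;> omega
  have sinj : ∀ q r, q ≠ p → r ≠ p → s q = s r → q = r := by
    intro q r hq hr h
    have := ene q hq
    have := ene r hr
    have := elt q
    have := elt r
    rw [hs, hs] at h
    split_ifs at h with h1 h2 h3 h4 h5 h6 h7 h8 h9 h10 h11 h12 <;>
      first
      | omega
      | exact hbelow _ ‹_› _ ‹_›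
      | exact habove _ ‹_› _ ‹_›
      | (apply einj; omega)
  let F : Finset (Finset (Fin n)) := (Finset.univ.erase p).image (fun q => initSeg n (s q))
  have hFle : F.card ≤ Fintype.card P - 1 := by
    refine Finset.card_image_le.trans ?_
    rw [Finset.card_erase_of_mem (Finset.mem_univ p), Finset.card_univ]
  have hmem : ∀ q, q ≠ p → initSeg n (s q) ∈ F := fun q hq =>
    Finset.mem_image.2 ⟨q, Finset.mem_erase.2 ⟨hq, Finset.mem_univ _⟩, rfl⟩
  have hsat : WeakSaturating P F := by
    refine ⟨fun h => ?_, fun G hG => ?_⟩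
    · have := copy_card P F h
      omega
    · refine ⟨fun q => if q = p then G else initSeg n (s q), ?_, ?_, ?_⟩
      · intro q r h
        dsimp only at h
        split_ifs at h with h1 h2 h2
        · rw [h1, h2]
        · exact absurd (h ▸ hmem r h2) hG
        · exact absurd (h ▸ hmem q h1) hG
        · exact sinj q r h1 h2 (initSeg_inj n (sle q) (sle r) h)
      · intro q
        dsimp only
        split_ifs with h1
        · exact Finset.mem_insert_self _ _
        · exact Finset.mem_insert_of_mem (hmem q h1)
      · intro q r hqr
        dsimp only
        split_ifs with h1 h2 h2
        · exact subset_rfl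
        · have hlt : p < r := lt_of_le_of_ne (h1 ▸ hqr) (Ne.symm h2)
          rw [hs r, if_neg hlt.asymm, if_pos hlt]
          intro i _
          simp [initSeg]
        · have hlt : q < p := lt_of_le_of_ne (h2 ▸ hqr) h1
          rw [hs q, if_pos hlt]
          intro i hi
          simp [initSeg] at hi
        · exact initSeg_mono n (smono q r h1 h2 hqr)
  have hFc : F.card = Fintype.card P - 1 := le_antisymm hFle (sat_lower P hn F hsat)
  refine le_antisymm (Nat.sInf_le ⟨F, hsat, hFc⟩) ?_
  refine le_csInf ⟨_, F, hsat, hFc⟩ ?_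
  rintro m ⟨F', hF', rfl⟩
  exact sat_lower P hn F' hF'
end

section
/- Let s, t ≥ 2 be integers and let K_{s,t} be the complete bipartite poset on s + t elements a_1,…,a_s, b_1,…,b_t, where a_i <_P b_j for all 1 ≤ i ≤ s and 1 ≤ j ≤ t, the a_i's form an antichain, and the b_j's form an antichain. Then for every n ≥ s + t, we have s + t − 1 ≤ sat(n, K_{s,t}) ≤ 2(s + t) − 4. -/
/-- The underlying type of the complete bipartite poset `K_{s,t}`:
`s` bottom elements and `t` top elements. -/
def Kst (s t : ℕ) := Fin s ⊕ Fin t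

/-- The order of `K_{s,t}`: the bottoms form an antichain, the tops form an
antichain, and every bottom is below every top. -/
def kstLE {s t : ℕ} : Kst s t → Kst s t → Prop
  | Sum.inl a, Sum.inl b => a = b
  | Sum.inl _, Sum.inr _ => True
  | Sum.inr _, Sum.inl _ => False
  | Sum.inr a, Sum.inr b => a = b

instance {s t : ℕ} : PartialOrder (Kst s t) where
  le := kstLE
  le_refl x := by cases x <;> simp [kstLE]
  le_trans x y z hxy hyz := by
    cases x <;> cases y <;> cases z <;> simp_all [kstLE]
  le_antisymm x y hxy hyx := by
    rcases x with a | a <;> rcases y with b | b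
    · exact congrArg Sum.inl (show a = b from hxy)
    · exact False.elim hyx
    · exact False.elim hxy
    · exact congrArg Sum.inr (show a = b from hxy)

theorem copy_of_sets {s t n : ℕ} {F : Finset (Finset (Fin n))} (L U : Finset (Finset (Fin n)))
    (hL : L.card = s) (hU : U.card = t) (hLF : L ⊆ F) (hUF : U ⊆ F) (hd : Disjoint L U)
    (h : ∀ a ∈ L, ∀ b ∈ U, a ⊆ b) : ContainsWeakCopy (Kst s t) F := by
  let e := (L.equivFinOfCardEq hL).symm
  let e' := (U.equivFinOfCardEq hU).symm
  have hne : ∀ i j, (e i).1 ≠ (e' j).1 := fun i j hh =>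
    Finset.disjoint_left.1 hd (e i).2 (hh ▸ (e' j).2)
  refine ⟨fun p => Sum.elim (fun i => (e i).1) (fun j => (e' j).1) p, ?_, ?_, ?_⟩
  · rintro (a | a) (b | b) hab
    · exact congrArg Sum.inl (e.injective (Subtype.ext hab))
    · exact (hne _ _ hab).elim
    · exact (hne _ _ hab.symm).elim
    · exact congrArg Sum.inr (e'.injective (Subtype.ext hab))
  · rintro (a | a)
    · exact hLF (e a).2
    · exact hUF (e' a).2
  · rintro (a | a) (b | b) hab
    · have : a = b := hab
      subst this; exact subset_rfl
    · exact h _ (e a).2 _ (e' b).2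
    · exact False.elim hab
    · have : a = b := hab
      subst this; exact subset_rfl

theorem sets_of_copy {s t n : ℕ} {F : Finset (Finset (Fin n))}
    (h : ContainsWeakCopy (Kst s t) F) : ∃ L U : Finset (Finset (Fin n)),
    L.card = s ∧ U.card = t ∧ L ⊆ F ∧ U ⊆ F ∧ Disjoint L U ∧ ∀ a ∈ L, ∀ b ∈ U, a ⊆ b := by
  obtain ⟨f, hf, hF, hle⟩ := h
  refine ⟨Finset.univ.image (fun i : Fin s => f (Sum.inl i)),
    Finset.univ.image (fun i : Fin t => f (Sum.inr i)), ?_, ?_, ?_, ?_, ?_, ?_⟩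
  · rw [Finset.card_image_of_injective _ (fun a b hab => Sum.inl.inj (hf hab))]; simp
  · rw [Finset.card_image_of_injective _ (fun a b hab => Sum.inr.inj (hf hab))]; simp
  · intro x hx
    obtain ⟨i, -, rfl⟩ := Finset.mem_image.1 hx
    exact hF _
  · intro x hx
    obtain ⟨i, -, rfl⟩ := Finset.mem_image.1 hx
    exact hF _
  · rw [Finset.disjoint_left]
    intro x hx hy
    obtain ⟨i, -, rfl⟩ := Finset.mem_image.1 hx
    obtain ⟨j, -, hj⟩ := Finset.mem_image.1 hy
    exact Sum.inr_ne_inl (hf hj)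
  · intro x hx y hy
    obtain ⟨i, -, rfl⟩ := Finset.mem_image.1 hx
    obtain ⟨j, -, rfl⟩ := Finset.mem_image.1 hy
    exact hle _ _ trivial

/-- Empty set and singletons from `K`. -/
def lowF {n : ℕ} (K : Finset (Fin n)) : Finset (Finset (Fin n)) :=
  insert ∅ (K.image (fun i => {i}))

/-- Full set and complements of singletons from `K`. -/
def upF {n : ℕ} (K : Finset (Fin n)) : Finset (Finset (Fin n)) :=
  insert Finset.univ (K.image (fun i => {i}ᶜ))

theorem mem_lowF {n : ℕ} {K x : Finset (Fin n)} :
    x ∈ lowF K ↔ x = ∅ ∨ ∃ i ∈ K, x = {i} := by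
  simp [lowF, eq_comm]

theorem mem_upF {n : ℕ} {K x : Finset (Fin n)} :
    x ∈ upF K ↔ x = Finset.univ ∨ ∃ i ∈ K, x = {i}ᶜ := by
  simp [upF, eq_comm]

theorem card_lowF {n : ℕ} (K : Finset (Fin n)) : (lowF K).card = K.card + 1 := by
  rw [lowF, Finset.card_insert_of_notMem (by simp),
    Finset.card_image_of_injective _ Finset.singleton_injective]

theorem card_upF {n : ℕ} (K : Finset (Fin n)) : (upF K).card = K.card + 1 := by
  rw [upF, Finset.card_insert_of_notMem, Finset.card_image_of_injective]
  · intro a b hab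
    exact Finset.singleton_injective (compl_injective hab)
  · intro h
    obtain ⟨i, -, hi⟩ := Finset.mem_image.1 h
    have : i ∈ ({i} : Finset (Fin n))ᶜ := hi ▸ Finset.mem_univ i
    simp at this

theorem lowF_mono {n : ℕ} {K K' : Finset (Fin n)} (h : K ⊆ K') : lowF K ⊆ lowF K' :=
  Finset.insert_subset_insert _ (Finset.image_subset_image h)

theorem upF_mono {n : ℕ} {K K' : Finset (Fin n)} (h : K ⊆ K') : upF K ⊆ upF K' :=
  Finset.insert_subset_insert _ (Finset.image_subset_image h)

theorem card_le_low {n : ℕ} {K a : Finset (Fin n)} (h : a ∈ lowF K) : a.card ≤ 1 := by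
  rcases mem_lowF.1 h with rfl | ⟨i, -, rfl⟩ <;> simp

theorem card_le_up {n : ℕ} {K a : Finset (Fin n)} (h : a ∈ upF K) : n ≤ a.card + 1 := by
  rcases mem_upF.1 h with rfl | ⟨i, -, rfl⟩
  · simp
  · simp [Finset.card_compl]; omega

theorem low_up_disj {n : ℕ} (hn : 3 ≤ n) (K K' : Finset (Fin n)) :
    Disjoint (lowF K) (upF K') := by
  rw [Finset.disjoint_left]
  intro a h h'
  have := card_le_low h
  have := card_le_up h'
  omega

theorem low_sub_up {n : ℕ} {K K' : Finset (Fin n)} (h : Disjoint K K') :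
    ∀ a ∈ lowF K, ∀ b ∈ upF K', a ⊆ b := by
  intro a ha b hb
  rcases mem_lowF.1 ha with rfl | ⟨i, hi, rfl⟩
  · simp
  · rcases mem_upF.1 hb with rfl | ⟨j, hj, rfl⟩
    · simp
    · have : i ≠ j := fun e => Finset.disjoint_left.1 h hi (e ▸ hj)
      simpa using this.symm

theorem construct {s t n : ℕ} (hs : 2 ≤ s) (ht : 2 ≤ t) (hn : s + t ≤ n) (K : Finset (Fin n))
    (hK : K.card = s + t - 3) : WeakSaturating (Kst s t) (lowF K ∪ upF K) := by
  constructor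
  · intro h
    obtain ⟨L, U, hL, hU, hLF, hUF, hd, hle⟩ := sets_of_copy h
    have hL' : L ⊆ lowF K := by
      intro a ha
      rcases Finset.mem_union.1 (hLF ha) with h1 | h1
      · exact h1
      exfalso
      have hc := card_le_up h1
      have : U ⊆ {Finset.univ} := by
        intro b hb
        have hss : a ⊂ b := (hle a ha b hb).ssubset_of_ne
          (fun e => Finset.disjoint_left.1 hd ha (e ▸ hb))
        have := Finset.card_lt_card hss
        have h2 : b.card = n := le_antisymm (by simpa using b.card_le_univ) (by omega)
        rw [Finset.mem_singleton, ← Finset.card_eq_iff_eq_univ, h2, Fintype.card_fin]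
      have := Finset.card_le_card this
      simp at this
      omega
    have hU' : U ⊆ upF K := by
      intro b hb
      rcases Finset.mem_union.1 (hUF hb) with h1 | h1
      swap
      · exact h1
      exfalso
      have hc := card_le_low h1
      have : L ⊆ {∅} := by
        intro a ha
        have hss : a ⊂ b := (hle a ha b hb).ssubset_of_ne
          (fun e => Finset.disjoint_left.1 hd ha (e ▸ hb))
        have := Finset.card_lt_card hss
        rw [Finset.mem_singleton, ← Finset.card_eq_zero]
        omega
      have := Finset.card_le_card this
      simp at this
      omega
    let A := K.filter (fun i => {i} ∈ L)
    let B := K.filter (fun i => {i}ᶜ ∈ U)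
    have hA : L ⊆ lowF A := by
      intro a ha
      rcases mem_lowF.1 (hL' ha) with rfl | ⟨i, hi, rfl⟩
      · exact mem_lowF.2 (Or.inl rfl)
      · exact mem_lowF.2 (Or.inr ⟨i, Finset.mem_filter.2 ⟨hi, ha⟩, rfl⟩)
    have hB : U ⊆ upF B := by
      intro a ha
      rcases mem_upF.1 (hU' ha) with rfl | ⟨i, hi, rfl⟩
      · exact mem_upF.2 (Or.inl rfl)
      · exact mem_upF.2 (Or.inr ⟨i, Finset.mem_filter.2 ⟨hi, ha⟩, rfl⟩)
    have hAB : Disjoint A B := by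
      rw [Finset.disjoint_left]
      intro i hi hj
      have := hle _ (Finset.mem_filter.1 hi).2 _ (Finset.mem_filter.1 hj).2
      simp at this
    have h1 := Finset.card_le_card hA
    have h2 := Finset.card_le_card hB
    rw [card_lowF] at h1
    rw [card_upF] at h2
    have h3 : (A ∪ B).card ≤ K.card := Finset.card_le_card
      (Finset.union_subset (Finset.filter_subset _ _) (Finset.filter_subset _ _))
    rw [Finset.card_union_of_disjoint hAB] at h3
    omega
  · intro G hG
    have hGl : G ∉ lowF K := fun h => hG (Finset.mem_union_left _ h)
    have hGu : G ∉ upF K := fun h => hG (Finset.mem_union_right _ h)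
    by_cases hc : s - 1 ≤ (K ∩ G).card
    · obtain ⟨S, hS, hSc⟩ := Finset.exists_subset_card_eq hc
      have hSK : S ⊆ K := hS.trans Finset.inter_subset_left
      have hSG : S ⊆ G := hS.trans Finset.inter_subset_right
      have hm : upF (K \ S) ⊆ upF K := upF_mono Finset.sdiff_subset
      refine copy_of_sets (lowF S) (insert G (upF (K \ S))) ?_ ?_ ?_ ?_ ?_ ?_
      · rw [card_lowF]; omega
      · rw [Finset.card_insert_of_notMem (fun h => hGu (hm h)), card_upF,
          Finset.card_sdiff_of_subset hSK]; omega
      · exact (lowF_mono hSK).trans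
          (Finset.subset_union_left.trans (Finset.subset_insert _ _))
      · exact Finset.insert_subset_insert _ (hm.trans Finset.subset_union_right)
      · rw [Finset.disjoint_insert_right]
        exact ⟨fun h => hGl (lowF_mono hSK h), low_up_disj (by omega) _ _⟩
      · intro a ha b hb
        rcases Finset.mem_insert.1 hb with rfl | hb
        · rcases mem_lowF.1 ha with rfl | ⟨i, hi, rfl⟩
          · simp
          · simpa using hSG hi
        · exact low_sub_up Finset.disjoint_sdiff a ha b hb
    · have hc' : t - 1 ≤ (K \ G).card := by
        have := Finset.card_sdiff_add_card_inter K G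
        omega
      obtain ⟨S, hS, hSc⟩ := Finset.exists_subset_card_eq hc'
      have hSK : S ⊆ K := hS.trans Finset.sdiff_subset
      have hm : lowF (K \ S) ⊆ lowF K := lowF_mono Finset.sdiff_subset
      refine copy_of_sets (insert G (lowF (K \ S))) (upF S) ?_ ?_ ?_ ?_ ?_ ?_
      · rw [Finset.card_insert_of_notMem (fun h => hGl (hm h)), card_lowF,
          Finset.card_sdiff_of_subset hSK]; omega
      · rw [card_upF]; omega
      · exact Finset.insert_subset_insert _ (hm.trans Finset.subset_union_left)
      · exact (upF_mono hSK).trans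
          (Finset.subset_union_right.trans (Finset.subset_insert _ _))
      · rw [Finset.disjoint_insert_left]
        exact ⟨fun h => hGu (upF_mono hSK h), low_up_disj (by omega) _ _⟩
      · intro a ha b hb
        rcases Finset.mem_insert.1 ha with rfl | ha
        · rcases mem_upF.1 hb with rfl | ⟨i, hi, rfl⟩
          · simp
          · have := (Finset.mem_sdiff.1 (hS hi)).2
            intro x hx
            simp only [Finset.mem_compl, Finset.mem_singleton]
            rintro rfl
            exact this hx
        · exact low_sub_up Finset.sdiff_disjoint a ha b hb

/-- For `s,t ≥ 2` and `n ≥ s+t`: `s+t-1 ≤ sat(n, K_{s,t}) ≤ 2(s+t)-4`. -/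
theorem sat_Kst (s t : ℕ) (hs : 2 ≤ s) (ht : 2 ≤ t) (n : ℕ) (hn : s + t ≤ n) :
    s + t - 1 ≤ satN n (Kst s t) ∧ satN n (Kst s t) ≤ 2 * (s + t) - 4 := by
  obtain ⟨K, -, hK⟩ := Finset.exists_subset_card_eq
    (s := (Finset.univ : Finset (Fin n))) (n := s + t - 3) (by simp; omega)
  have hsat := construct hs ht hn K hK
  constructor
  · refine le_csInf ⟨_, _, hsat, rfl⟩ ?_
    rintro m ⟨F, ⟨-, hF⟩, rfl⟩
    by_cases hu : F = Finset.univ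
    · have : n < 2 ^ n := Nat.lt_two_pow_self
      rw [hu, Finset.card_univ, Fintype.card_finset, Fintype.card_fin]
      omega
    · obtain ⟨G, hG⟩ : ∃ G, G ∉ F := by
        by_contra hcon
        push Not at hcon
        exact hu (Finset.eq_univ_iff_forall.2 hcon)
      obtain ⟨L, U, hL, hU, hLF, hUF, hd, -⟩ := sets_of_copy (hF G hG)
      have h1 := Finset.card_le_card (Finset.union_subset hLF hUF)
      rw [Finset.card_union_of_disjoint hd, Finset.card_insert_of_notMem hG] at h1
      omega
  · have hle : satN n (Kst s t) ≤ (lowF K ∪ upF K).card := Nat.sInf_le ⟨_, hsat, rfl⟩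
    refine hle.trans ?_
    refine (Finset.card_union_le _ _).trans ?_
    rw [card_lowF, card_upF]
    omega
end

section
/- Let G = (V,E) be a finite simple graph (no loops, no multiple edges) with v = |V| vertices and e = |E| edges, and let P(G) be the incidence poset on the ground set V ∪ E in which x < y holds exactly when x ∈ V, y ∈ E, and x is an endpoint of the edge y (so V and E each form antichains in P(G)). Then for every n ≥ e + v, we have e + v − 1 ≤ sat(n, P(G)) ≤ e + v. -/
/-- The underlying type of the incidence poset `P(G)` of a graph `G`:
vertices together with edges. -/
def IncElem {V : Type*} (G : SimpleGraph V) := V ⊕ G.edgeSet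

/-- The order of the incidence poset: `x < y` exactly when `x` is a vertex, `y`
is an edge, and `x` is an endpoint of `y`; vertices and edges form antichains. -/
def incLE {V : Type*} (G : SimpleGraph V) : IncElem G → IncElem G → Prop :=
  fun x y => x = y ∨
    ∃ (v : V) (e : G.edgeSet), x = Sum.inl v ∧ y = Sum.inr e ∧ v ∈ (e : Sym2 V)

instance {V : Type*} (G : SimpleGraph V) : PartialOrder (IncElem G) where
  le := incLE G
  le_refl x := Or.inl rfl
  le_trans x y z hxy hyz := by
    rcases hxy with rfl | ⟨v, e, rfl, rfl, hv⟩
    · exact hyz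
    · rcases hyz with rfl | ⟨v', e', h1, h2, hv'⟩
      · exact Or.inr ⟨v, e, rfl, rfl, hv⟩
      · exact absurd h1 (by simp)
  le_antisymm x y hxy hyx := by
    rcases hxy with rfl | ⟨v, e, rfl, rfl, hv⟩
    · rfl
    · rcases hyx with h | ⟨v', e', h1, h2, hv'⟩
      · exact h.symm
      · exact absurd h1 (by simp)

section helpers

lemma numbering_aux {α : Type*} [Fintype α] [DecidableEq α] (m : ℕ) (hm : Fintype.card α = m)
    (s : Finset ℕ) (x : ℕ → α) (y : ℕ → ℕ) (hx : Set.InjOn x s) (hy : Set.InjOn y s)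
    (hlt : ∀ i ∈ s, y i < m) :
    ∃ N : α → ℕ, Function.Injective N ∧ (∀ a, N a < m) ∧ ∀ i ∈ s, N (x i) = y i := by
  classical
  have key : ∀ i ∈ s, Function.invFunOn x s (x i) = i := fun i hi => by
    have h1 : ∃ a ∈ (s : Set ℕ), x a = x i := ⟨i, hi, rfl⟩
    exact hx (Function.invFunOn_mem h1) hi (Function.invFunOn_eq h1)
  obtain ⟨g, hg⟩ := Finset.exists_equiv_extend_of_card_eq (α := α) (β := ℕ)
    (t := Finset.range m) (by simpa using hm) (s := s.image x)
    (f := fun a => y (Function.invFunOn x s a))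
    (by
      intro b hb
      simp only [Finset.mem_image] at hb
      obtain ⟨a, ⟨i, hi, rfl⟩, rfl⟩ := hb
      rw [key i hi]
      exact Finset.mem_range.2 (hlt i hi))
    (by
      intro a ha b hb hab
      simp only [Finset.coe_image, Set.mem_image, Finset.mem_coe] at ha hb
      obtain ⟨i, hi, rfl⟩ := ha
      obtain ⟨j, hj, rfl⟩ := hb
      simp only [key i hi, key j hj] at hab
      rw [hy hi hj hab])
  refine ⟨fun a => (g a : ℕ), ?_, ?_, ?_⟩
  · intro a b hab
    exact g.injective (Subtype.ext hab)
  · intro a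
    exact Finset.mem_range.1 (g a).2
  · intro i hi
    have := hg (x i) (Finset.mem_image_of_mem _ hi)
    simp only [this, key i hi]

lemma copy_card_s5 {V : Type*} [Fintype V] [DecidableEq V] (G : SimpleGraph V) [DecidableRel G.Adj]
    {n : ℕ} (F : Finset (Finset (Fin n))) (f : IncElem G → Finset (Fin n))
    (hf : Function.Injective f) (hF : ∀ p, f p ∈ F) :
    G.edgeFinset.card + Fintype.card V ≤ F.card := by
  classical
  let _ : Fintype (IncElem G) := inferInstanceAs (Fintype (V ⊕ G.edgeSet))
  have h1 : Fintype.card (IncElem G) = Fintype.card V + Fintype.card G.edgeSet :=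
    Fintype.card_sum (α := V) (β := G.edgeSet)
  have h2 : Fintype.card (IncElem G) ≤ F.card := by
    rw [← Finset.card_univ]
    exact Finset.card_le_card_of_injOn f (fun p _ => hF p) (fun a _ b _ h => hf h)
  rw [SimpleGraph.edgeFinset_card]
  omega

lemma assemble {V : Type*} (G : SimpleGraph V) {n v e : ℕ} (F : Finset (Finset (Fin n)))
    (a b : ℕ → Finset (Fin n))
    (ha : ∀ i j, i < j → j < v → a i ≠ a j) (hb : ∀ i j, i < j → j < e → b i ≠ b j)
    (hab : ∀ i j, i < v → j < e → a i ≠ b j)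
    (haF : ∀ i < v, a i ∈ F) (hbF : ∀ i < e, b i ∈ F)
    (N : V → ℕ) (N' : G.edgeSet → ℕ) (hN : Function.Injective N) (hN' : Function.Injective N')
    (hNv : ∀ x, N x < v) (hNe : ∀ x, N' x < e)
    (hinc : ∀ (f : G.edgeSet) (x : V), x ∈ (f : Sym2 V) → a (N x) ⊆ b (N' f)) :
    ContainsWeakCopy (IncElem G) F := by
  refine ⟨fun p => Sum.elim (fun x => a (N x)) (fun f => b (N' f)) p, ?_, ?_, ?_⟩
  · rintro (x | f) (y | g) h
    · simp only [Sum.elim_inl] at h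
      have : N x = N y := by
        rcases lt_trichotomy (N x) (N y) with h' | h' | h'
        · exact absurd h (ha _ _ h' (hNv _))
        · exact h'
        · exact absurd h.symm (ha _ _ h' (hNv _))
      rw [hN this]
    · exact absurd h (hab _ _ (hNv _) (hNe _))
    · exact absurd h.symm (hab _ _ (hNv _) (hNe _))
    · simp only [Sum.elim_inr] at h
      have : N' f = N' g := by
        rcases lt_trichotomy (N' f) (N' g) with h' | h' | h'
        · exact absurd h (hb _ _ h' (hNe _))
        · exact h'
        · exact absurd h.symm (hb _ _ h' (hNe _))
      rw [hN' this]
  · rintro (x | f)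
    · exact haF _ (hNv _)
    · exact hbF _ (hNe _)
  · rintro p q (rfl | ⟨x, f, rfl, rfl, hx⟩)
    · exact Finset.Subset.refl _
    · exact hinc f x hx

/-- freeness criterion -/
lemma free_aux {V : Type*} [Fintype V] [DecidableEq V] (G : SimpleGraph V) [DecidableRel G.Adj]
    {n : ℕ} (F : Finset (Finset (Fin n))) (B : Finset (Fin n))
    (hcard : F.card ≤ G.edgeFinset.card + Fintype.card V) (hBF : B ∈ F)
    (hB : B.card ≤ 1)
    (S : Finset (Finset (Fin n))) (hS : ∀ A ∈ F, B ⊆ A → A ≠ B → A ∈ S)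
    (hdeg : ∀ x, S.card < G.degree x) : ¬ ContainsWeakCopy (IncElem G) F := by
  rintro ⟨f, hf, hfF, hle⟩
  have hex : ∃ p, f p = B := by
    by_contra hne
    push Not at hne
    have := copy_card_s5 G (F.erase B) f hf (fun p => Finset.mem_erase.2 ⟨hne p, hfF p⟩)
    have := Finset.card_erase_lt_of_mem hBF
    omega
  obtain ⟨p, hp⟩ := hex
  rcases p with x | g
  · have hE : ∀ y ∈ G.neighborFinset x, s(x, y) ∈ G.edgeSet := fun y hy => by
      simpa using hy
    have hle2 : (G.neighborFinset x).card ≤ S.card := by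
      rw [← Finset.card_attach]
      refine Finset.card_le_card_of_injOn (fun y => f (Sum.inr ⟨s(x, y.1), hE y.1 y.2⟩)) ?_ ?_
      · intro y _
        refine hS _ (hfF _) ?_ ?_
        · rw [← hp]
          refine hle _ _ (Or.inr ⟨x, _, rfl, rfl, ?_⟩)
          simp
        · rw [← hp]
          intro h
          have := hf h
          cases this
      · intro y _ y' _ h
        have h1 := Sum.inr_injective (hf h)
        have h2 : s(x, y.1) = s(x, y'.1) := congrArg Subtype.val h1
        rw [Sym2.congr_right] at h2
        exact Subtype.ext h2
    have := hdeg x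
    rw [SimpleGraph.card_neighborFinset_eq_degree] at hle2
    omega
  · obtain ⟨g, hg⟩ := g
    induction g using Sym2.ind with
    | _ x y =>
      have hxy : x ≠ y := G.ne_of_adj hg
      have h1 : ∀ z : V, z ∈ s(x, y) → f (Sum.inl z) = ∅ := by
        intro z hz
        have hs : f (Sum.inl z) ⊆ B := by
          rw [← hp]
          exact hle _ _ (Or.inr ⟨z, _, rfl, rfl, hz⟩)
        have hn : f (Sum.inl z) ≠ B := by
          rw [← hp]
          intro h
          have := hf h
          cases this
        have := Finset.card_lt_card (Finset.ssubset_iff_subset_ne.2 ⟨hs, hn⟩)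
        exact Finset.card_eq_zero.1 (by omega)
      have := hf ((h1 x (by simp)).trans (h1 y (by simp)).symm)
      exact hxy (Sum.inl_injective this)

lemma copyAB {V : Type*} [Fintype V] [DecidableEq V] (G : SimpleGraph V) [DecidableRel G.Adj]
    {n v e k : ℕ} (hv : Fintype.card V = v) (he : Fintype.card G.edgeSet = e)
    (hvk : k + 3 ≤ v) (hek : k + 3 ≤ e)
    (w q : V) (z : ℕ → V) (hz : ∀ j, G.Adj w (z j))
    (hzi : ∀ i j, i < k + 2 → j < k + 2 → z i = z j → i = j)
    (hzs : ∀ x, G.Adj w x → ∃ j < k + 2, z j = x)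
    (hq : G.Adj (z 0) q) (hqw : q ≠ w) (hqz : ∀ j ≤ k, z j ≠ q)
    (F : Finset (Finset (Fin n)))
    (a b : ℕ → Finset (Fin n))
    (ha : ∀ i j, i < j → j < v → a i ≠ a j) (hb : ∀ i j, i < j → j < e → b i ≠ b j)
    (hab : ∀ i j, i < v → j < e → a i ≠ b j)
    (haF : ∀ i < v, a i ∈ F) (hbF : ∀ i < e, b i ∈ F)
    (h0 : ∀ m, a 0 ⊆ b m) (h1 : ∀ m ≤ k + 1, a (v - 1) ⊆ b m)
    (h2 : a (k + 1) ⊆ b (e - 1))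
    (h3 : ∀ i m, i < v - 1 → 1 ≤ m → m < e - 1 → ¬ (i = m ∧ m ≤ k) → a i ⊆ b m) :
    ContainsWeakCopy (IncElem G) F := by
  classical
  have hzw : ∀ j, z j ≠ w := fun j h => G.ne_of_adj (hz j) h.symm
  obtain ⟨N, hN, hNv, hNx⟩ := numbering_aux v hv (Finset.range (k + 3))
    (fun j => if j ≤ k then z j else if j = k + 1 then q else w)
    (fun j => if j ≤ k + 1 then j else v - 1)
    (by
      intro i hi j hj hij
      simp only [Finset.coe_range, Set.mem_Iio] at hi hj
      try simp only at hij
      split_ifs at hij with c1 c2 c3 c4 c5 c6 c7 c8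
      · exact hzi i j (by omega) (by omega) hij
      · exact absurd hij (hqz _ c1)
      · exact absurd hij (hzw _)
      · exact absurd hij.symm (hqz _ (by assumption))
      · omega
      · exact absurd hij hqw
      · exact absurd hij.symm (hzw _)
      · exact absurd hij.symm hqw
      · omega)
    (by
      intro i hi j hj hij
      simp only [Finset.coe_range, Set.mem_Iio] at hi hj
      try simp only at hij
      split_ifs at hij <;> omega)
    (by
      intro i hi
      simp only [Finset.mem_range] at hi
      try simp only
      split_ifs <;> omega)
  have hNz : ∀ j ≤ k, N (z j) = j := by
    intro j hj
    have := hNx j (by simp; omega)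
    simpa [hj, show j ≤ k + 1 by omega] using this
  have hNq : N q = k + 1 := by
    have := hNx (k + 1) (by simp)
    simpa using this
  have hNw : N w = v - 1 := by
    have := hNx (k + 2) (by simp)
    simpa using this
  let en : ℕ → G.edgeSet := fun j => ⟨s(w, z j), hz j⟩
  have heni : ∀ i j, i < k + 2 → j < k + 2 → en i = en j → i = j := by
    intro i j hi hj h
    have h2 : s(w, z i) = s(w, z j) := congrArg Subtype.val h
    rw [Sym2.congr_right] at h2
    exact hzi i j hi hj h2
  let eq : G.edgeSet := ⟨s(z 0, q), hq⟩
  have henq : ∀ j, en j ≠ eq := by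
    intro j h
    have h2 : s(w, z j) = s(z 0, q) := congrArg Subtype.val h
    have h3 : w ∈ s(z 0, q) := by rw [← h2]; simp
    rw [Sym2.mem_iff] at h3
    rcases h3 with h3 | h3
    · exact hzw _ h3.symm
    · exact hqw h3.symm
  obtain ⟨N', hN', hNe, hNx'⟩ := numbering_aux e he (Finset.range (k + 3))
    (fun j => if j < k + 2 then en j else eq)
    (fun j => if j = 0 then 0 else if j ≤ k then j + 1 else if j = k + 1 then 1 else e - 1)
    (by
      intro i hi j hj hij
      simp only [Finset.coe_range, Set.mem_Iio] at hi hj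
      try simp only at hij
      split_ifs at hij with c1 c2 c3
      · exact heni i j c1 c2 hij
      · exact absurd hij (henq _)
      · exact absurd hij.symm (henq _)
      · omega)
    (by
      intro i hi j hj hij
      simp only [Finset.coe_range, Set.mem_Iio] at hi hj
      try simp only at hij
      split_ifs at hij <;> omega)
    (by
      intro i hi
      simp only [Finset.mem_range] at hi
      try simp only
      split_ifs <;> omega)
  have hE0 : N' (en 0) = 0 := by
    have := hNx' 0 (by simp)
    simpa using this
  have hEj : ∀ j, 1 ≤ j → j ≤ k → N' (en j) = j + 1 := by
    intro j hj hj'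
    have := hNx' j (by simp; omega)
    simpa [hj', show j < k + 2 by omega, show j ≠ 0 by omega] using this
  have hEl : N' (en (k + 1)) = 1 := by
    have := hNx' (k + 1) (by simp)
    simpa using this
  have hEq : N' eq = e - 1 := by
    have := hNx' (k + 2) (by simp)
    simpa using this
  refine assemble G F a b ha hb hab haF hbF N N' hN hN' hNv hNe ?_
  intro f x hx
  by_cases hfq : f = eq
  · subst hfq
    rw [hEq]
    have hx' : x ∈ s(z 0, q) := hx
    rw [Sym2.mem_iff] at hx'
    rcases hx' with rfl | rfl
    · rw [hNz 0 (by omega)]; exact h0 _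
    · rw [hNq]; exact h2
  by_cases hfw : w ∈ (f : Sym2 V)
  · obtain ⟨j, hj, rfl⟩ : ∃ j < k + 2, f = en j := by
      obtain ⟨f, hf⟩ := f
      obtain ⟨y, rfl⟩ := Sym2.mem_iff_exists.1 hfw
      obtain ⟨j, hj, rfl⟩ := hzs y hf
      exact ⟨j, hj, rfl⟩
    have hx' : x ∈ s(w, z j) := hx
    rw [Sym2.mem_iff] at hx'
    have hbd : N' (en j) ≤ k + 1 := by
      by_cases c0 : j = 0
      · subst c0; omega
      by_cases c1 : j ≤ k
      · have := hEj j (by omega) c1; omega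
      · have : j = k + 1 := by omega
        subst this; omega
    rcases hx' with rfl | rfl
    · rw [hNw]; exact h1 _ hbd
    · by_cases c0 : j = 0
      · subst c0
        rw [hNz 0 (by omega)]; exact h0 _
      by_cases c1 : j ≤ k
      · rw [hNz j c1, hEj j (by omega) c1]
        exact h3 _ _ (by omega) (by omega) (by omega) (by omega)
      · have : j = k + 1 := by omega
        subst this
        rw [hEl]
        refine h3 _ _ ?_ (by omega) (by omega) ?_
        · have hne : N (z (k + 1)) ≠ v - 1 := by
            rw [← hNw]
            exact fun h => hzw _ (hN h)
          have := hNv (z (k + 1))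
          omega
        · rintro ⟨h, hk⟩
          have := hzi (k + 1) 1 (by omega) (by omega) (hN (h.trans (hNz 1 hk).symm))
          omega
  · have hxw : x ≠ w := fun h => hfw (h ▸ hx)
    have hfe : ∀ j, f ≠ en j := by
      rintro j rfl
      exact hfw (by simp [en])
    refine h3 _ _ ?_ ?_ ?_ ?_
    · have hne : N x ≠ v - 1 := by
        rw [← hNw]
        exact fun h => hxw (hN h)
      have := hNv x
      omega
    · have : N' f ≠ N' (en 0) := fun h => hfe _ (hN' h)
      omega
    · have : N' f ≠ N' eq := fun h => hfq (hN' h)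
      have := hNe f
      omega
    · rintro ⟨_, hk⟩
      have c0 : N' f ≠ N' (en 0) := fun h => hfe _ (hN' h)
      have c1 : N' f ≠ N' (en (k+1)) := fun h => hfe _ (hN' h)
      have c2 : N' f ≠ N' (en (N' f - 1)) := fun h => hfe _ (hN' h)
      rw [hEj _ (by omega) (by omega)] at c2
      omega

lemma copyC {V : Type*} [Fintype V] [DecidableEq V] (G : SimpleGraph V) [DecidableRel G.Adj]
    {n v e k : ℕ} (hv : Fintype.card V = v) (he : Fintype.card G.edgeSet = e)
    (hvk : k + 3 ≤ v) (hek : k + 3 ≤ e)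
    (w : V) (z : ℕ → V) (hz : ∀ j, G.Adj w (z j))
    (hzi : ∀ i j, i < k + 2 → j < k + 2 → z i = z j → i = j)
    (F : Finset (Finset (Fin n)))
    (a b : ℕ → Finset (Fin n)) (r : ℕ) (hr : 1 ≤ r) (hrk : r ≤ k)
    (ha : ∀ i j, i < j → j < v → a i ≠ a j) (hb : ∀ i j, i < j → j < e → b i ≠ b j)
    (hab : ∀ i j, i < v → j < e → a i ≠ b j)
    (haF : ∀ i < v, a i ∈ F) (hbF : ∀ i < e, b i ∈ F)
    (h0 : ∀ m, a 0 ⊆ b m)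
    (h2 : a r ⊆ b (e - 1))
    (h3 : ∀ i m, i < v → m < e - 1 → ¬ (i = m ∧ 1 ≤ m ∧ m ≤ k) → a i ⊆ b m) :
    ContainsWeakCopy (IncElem G) F := by
  classical
  have hzw : ∀ j, z j ≠ w := fun j h => G.ne_of_adj (hz j) h.symm
  obtain ⟨N, hN, hNv, hNx⟩ := numbering_aux v hv (Finset.range (k + 1))
    (fun j => if j = 0 then w else z j)
    (fun j => j)
    (by
      intro i hi j hj hij
      simp only [Finset.coe_range, Set.mem_Iio] at hi hj
      try simp only at hij
      split_ifs at hij with c1 c2 c3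
      · omega
      · exact absurd hij.symm (hzw _)
      · exact absurd hij (hzw _)
      · exact hzi i j (by omega) (by omega) hij)
    (by
      intro i hi j hj hij
      exact hij)
    (by
      intro i hi
      simp only [Finset.mem_range] at hi
      omega)
  have hNz : ∀ j, 1 ≤ j → j ≤ k → N (z j) = j := by
    intro j hj1 hj
    have := hNx j (by simp; omega)
    simpa [show j ≠ 0 by omega] using this
  have hNw : N w = 0 := by
    have := hNx 0 (by simp)
    simpa using this
  let en : ℕ → G.edgeSet := fun j => ⟨s(w, z j), hz j⟩
  have heni : ∀ i j, i < k + 2 → j < k + 2 → en i = en j → i = j := by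
    intro i j hi hj h
    have h2 : s(w, z i) = s(w, z j) := congrArg Subtype.val h
    rw [Sym2.congr_right] at h2
    exact hzi i j hi hj h2
  obtain ⟨N', hN', hNe, hNx'⟩ := numbering_aux e he (Finset.range (k + 2))
    en
    (fun j => if j = r then e - 1 else if j = 0 then r - 1 else j - 1)
    (by
      intro i hi j hj hij
      simp only [Finset.coe_range, Set.mem_Iio] at hi hj
      exact heni i j hi hj hij)
    (by
      intro i hi j hj hij
      simp only [Finset.coe_range, Set.mem_Iio] at hi hj
      try simp only at hij
      split_ifs at hij <;> omega)
    (by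
      intro i hi
      simp only [Finset.mem_range] at hi
      try simp only
      split_ifs <;> omega)
  refine assemble G F a b ha hb hab haF hbF N N' hN hN' hNv hNe ?_
  intro f x hx
  have hEr : N' (en r) = e - 1 := by
    have := hNx' r (by simp; omega)
    simpa using this
  by_cases hfr : f = en r
  · subst hfr
    rw [hEr]
    have hx' : x ∈ s(w, z r) := hx
    rw [Sym2.mem_iff] at hx'
    rcases hx' with rfl | rfl
    · rw [hNw]; exact h0 _
    · rw [hNz r hr hrk]; exact h2
  have hfl : N' f < e - 1 := by
    have : N' f ≠ N' (en r) := fun h => hfr (hN' h)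
    have := hNe f
    omega
  refine h3 _ _ (hNv _) hfl ?_
  rintro ⟨hm, hm1, hmk⟩
  have hxz : x = z (N' f) := hN (hm.trans (hNz _ hm1 hmk).symm)
  obtain ⟨j, hj, hjm, hjf⟩ : ∃ j < k + 2, j ≠ N' f ∧ N' (en j) = N' f := by
    by_cases c : N' f = r - 1
    · refine ⟨0, by omega, by omega, ?_⟩
      have := hNx' 0 (by simp)
      rw [this, if_neg (by omega), if_pos rfl, c]
    · refine ⟨N' f + 1, by omega, by omega, ?_⟩
      have := hNx' (N' f + 1) (by simp; omega)
      rw [this, if_neg (by omega), if_neg (by omega)]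
      omega
  have hfj : en j = f := hN' hjf
  have hx' : x ∈ s(w, z j) := by rw [← hfj] at hx; exact hx
  rw [Sym2.mem_iff] at hx'
  rcases hx' with h | h
  · exact hzw _ (hxz.symm.trans h)
  · exact hjm (hzi _ _ hj (by omega) (h.symm.trans hxz))

/-- setup of a labelling of neighbours -/
lemma labelling {V : Type*} [Fintype V] [DecidableEq V] (G : SimpleGraph V) [DecidableRel G.Adj]
    (k : ℕ) (w : V) (hw : G.degree w = k + 2) (hmin : ∀ x, k + 2 ≤ G.degree x) :
    ∃ (q : V) (z : ℕ → V), (∀ j, G.Adj w (z j)) ∧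
    (∀ i j, i < k + 2 → j < k + 2 → z i = z j → i = j) ∧
    (∀ x, G.Adj w x → ∃ j < k + 2, z j = x) ∧
    G.Adj (z 0) q ∧ q ≠ w ∧ (∀ j ≤ k, z j ≠ q) := by
  classical
  have hcard : (G.neighborFinset w).card = k + 2 := by
    rw [SimpleGraph.card_neighborFinset_eq_degree, hw]
  obtain ⟨p, hp⟩ : (G.neighborFinset w).Nonempty := Finset.card_pos.1 (by omega)
  obtain ⟨q, hq, hqw⟩ : ∃ q ∈ G.neighborFinset p, q ≠ w := by
    apply Finset.exists_mem_ne
    rw [SimpleGraph.card_neighborFinset_eq_degree]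
    have := hmin p
    omega
  rw [SimpleGraph.mem_neighborFinset] at hq
  obtain ⟨q', hq', hqp, hqq⟩ : ∃ q' ∈ G.neighborFinset w, q' ≠ p ∧
      (q ∈ G.neighborFinset w → q' = q) := by
    by_cases h : q ∈ G.neighborFinset w
    · exact ⟨q, h, (G.ne_of_adj hq).symm, fun _ => rfl⟩
    · obtain ⟨q', h1, h2⟩ := Finset.exists_mem_ne (show 1 < (G.neighborFinset w).card by omega) p
      exact ⟨q', h1, h2, fun h' => absurd h' h⟩
  obtain ⟨g, hg⟩ := Finset.exists_equiv_extend_of_card_eq (α := Fin (k + 2)) (β := V)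
    (t := G.neighborFinset w) (by simpa using hcard.symm) (s := {0, Fin.last (k + 1)})
    (f := fun i => if i = 0 then p else q')
    (by
      intro b hb
      simp only [Finset.mem_image] at hb
      obtain ⟨i, _, rfl⟩ := hb
      split_ifs <;> assumption)
    (by
      intro i hi j hj hij
      simp only [Finset.coe_insert, Finset.coe_singleton, Set.mem_insert_iff,
        Set.mem_singleton_iff] at hi hj
      have hl : Fin.last (k + 1) ≠ 0 := by
        intro h; simpa using congrArg Fin.val h
      rcases hi with rfl | rfl <;> rcases hj with rfl | rfl
      · rfl
      · simp only [if_true, if_neg hl] at hij; exact absurd hij.symm hqp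
      · simp only [if_true, if_neg hl] at hij; exact absurd hij hqp
      · rfl)
  have hl : Fin.last (k + 1) ≠ 0 := by
    intro h; simpa using congrArg Fin.val h
  have hg0 : (g 0 : V) = p := by
    have := hg 0 (by simp)
    simpa using this
  have hgl : (g (Fin.last (k + 1)) : V) = q' := by
    have := hg (Fin.last (k + 1)) (by simp)
    simpa [hl] using this
  have hadj : ∀ i, G.Adj w (g i) := fun i => by
    have := (g i).2
    rwa [SimpleGraph.mem_neighborFinset] at this
  refine ⟨q, fun j => g (Fin.ofNat (k + 2) j), fun j => hadj _, ?_, ?_, ?_, hqw, ?_⟩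
  · intro i j hi hj h
    have h1 := g.injective (Subtype.ext h)
    have h2 := congrArg Fin.val h1
    simp only [Fin.val_ofNat] at h2
    rwa [Nat.mod_eq_of_lt hi, Nat.mod_eq_of_lt hj] at h2
  · intro x hx
    refine ⟨(g.symm ⟨x, by simpa using hx⟩).val, (g.symm ⟨x, by simpa using hx⟩).2, ?_⟩
    have : Fin.ofNat (k + 2) (g.symm ⟨x, by simpa using hx⟩).val = g.symm ⟨x, by simpa using hx⟩ := by
      apply Fin.ext
      simp only [Fin.val_ofNat]
      exact Nat.mod_eq_of_lt (Fin.is_lt _)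
    simp only [this, Equiv.apply_symm_apply]
  · have : Fin.ofNat (k + 2) 0 = 0 := rfl
    simp only [this, hg0]
    exact hq
  · intro j hj h
    simp only at h
    have h1 : q' = q := hqq (h ▸ (g _).2)
    rw [← h1, ← hgl] at h
    have h2 := congrArg Fin.val (g.injective (Subtype.ext h))
    simp only [Fin.val_ofNat, Fin.val_last] at h2
    rw [Nat.mod_eq_of_lt (by omega)] at h2
    omega

end helpers

section constructions

lemma exists_fam {n : ℕ} (p : ℕ → Fin n → Prop) :
    ∃ l : ℕ → Finset (Fin n), ∀ j i, i ∈ l j ↔ p j i := by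
  classical
  exact ⟨fun j => Finset.univ.filter (p j), fun j i => by
    rw [Finset.mem_filter]; simp only [Finset.mem_univ, true_and]⟩

lemma sat_two {V : Type*} [Fintype V] [DecidableEq V] (G : SimpleGraph V) [DecidableRel G.Adj]
    {n v e k : ℕ} (hv : Fintype.card V = v) (he : G.edgeFinset.card = e) (hn : e + v ≤ n)
    (w : V) (hw : G.degree w = k + 2) (hmin : ∀ x, k + 2 ≤ G.degree x) :
    ∃ F : Finset (Finset (Fin n)), WeakSaturating (IncElem G) F ∧ F.card ≤ e + v := by
  classical
  obtain ⟨q, z, hz, hzi, hzs, hq, hqw, hqz⟩ := labelling G k w hw hmin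
  have hzw : ∀ j, z j ≠ w := fun j h => G.ne_of_adj (hz j) h.symm
  have he' : Fintype.card G.edgeSet = e := by rw [← he, SimpleGraph.edgeFinset_card]
  have hvk : k + 3 ≤ v := by
    rw [← hv, ← Finset.card_univ, ← Finset.card_range (k + 3)]
    refine Finset.card_le_card_of_injOn (fun j => if j < k + 2 then z j else w)
      (fun _ _ => Finset.mem_univ _) ?_
    intro i hi j hj hij
    simp only [Finset.coe_range, Set.mem_Iio] at hi hj
    try simp only at hij
    split_ifs at hij with c1 c2 c3
    · exact hzi i j c1 c2 hij
    · exact absurd hij (hzw _)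
    · exact absurd hij.symm (hzw _)
    · omega
  have hek : k + 3 ≤ e := by
    rw [← he, ← Finset.card_range (k + 3)]
    refine Finset.card_le_card_of_injOn (fun j => if j < k + 2 then s(w, z j) else s(z 0, q))
      ?_ ?_
    · intro j _
      simp only [Finset.mem_coe]
      split_ifs
      · simpa using hz j
      · simpa using hq
    have hne : ∀ j, s(w, z j) ≠ s(z 0, q) := by
      intro j h2
      have h3 : w ∈ s(z 0, q) := by rw [← h2]; simp
      rw [Sym2.mem_iff] at h3
      rcases h3 with h3 | h3
      · exact hzw _ h3.symm
      · exact hqw h3.symm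
    intro i hi j hj hij
    simp only [Finset.coe_range, Set.mem_Iio] at hi hj
    try simp only at hij
    split_ifs at hij with c1 c2 c3
    · rw [Sym2.congr_right] at hij
      exact hzi i j c1 c2 hij
    · exact absurd hij (hne _)
    · exact absurd hij.symm (hne _)
    · omega
  obtain ⟨l, hl⟩ : ∃ l : ℕ → Finset (Fin n), ∀ j i, i ∈ l j ↔
      ((1 ≤ j ∧ j ≤ k ∧ i.val = j) ∨ (k < j ∧ k + 1 ≤ i.val ∧ i.val ≤ j)) :=
    exists_fam _
  obtain ⟨u, hu⟩ : ∃ u : ℕ → Finset (Fin n), ∀ j i, i ∈ u j ↔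
      ((j ≤ k ∧ i.val ≠ j) ∨ j = k + 1 ∨ (k + 1 < j ∧ 1 ≤ i.val ∧ i.val < v + j - k - 1)) :=
    exists_fam _
  let zero : Fin n := ⟨0, by omega⟩
  have hneq : ∀ {A C : Finset (Fin n)} (m : ℕ) (hm : m < n),
      ¬ ((⟨m, hm⟩ : Fin n) ∈ A ↔ (⟨m, hm⟩ : Fin n) ∈ C) → A ≠ C := by
    rintro A C m hm h rfl
    exact h Iff.rfl
  have hll : ∀ i j, i < j → j < v → l i ≠ l j := by
    intro i j hij hj
    apply hneq j (by omega)
    rw [hl, hl]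
    simp only [and_true]
    omega
  have huu : ∀ i j, i < j → j < e - 1 → u i ≠ u j := by
    intro i j hij hj
    by_cases c : j ≤ k + 1
    · apply hneq i (by omega)
      rw [hu, hu]
      simp only
      omega
    by_cases c' : i ≤ k + 1
    · apply hneq (n - 1) (by omega)
      rw [hu, hu]
      simp only
      omega
    · apply hneq (v + i - k - 1) (by omega)
      rw [hu, hu]
      simp only
      omega
  have hlu : ∀ i j, i < v → l i ≠ u j := by
    intro i j hi
    apply hneq v (by omega)
    rw [hl, hu]
    simp only
    omega
  have hlB : ∀ i, l i ≠ {zero} := by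
    intro i
    apply hneq 0 (by omega)
    rw [hl]
    simp only [Finset.mem_singleton, zero, iff_true]
    omega
  have huB : ∀ i, u i ≠ {zero} := by
    intro i
    apply hneq v (by omega)
    rw [hu]
    simp only [Finset.mem_singleton, zero, Fin.mk.injEq]
    omega
  have hsub : ∀ i m, i < v → m < e - 1 → ¬ (i = m ∧ 1 ≤ m ∧ m ≤ k) → l i ⊆ u m := by
    intro i m hi hm h x hx
    rw [hl] at hx
    rw [hu]
    omega
  have hl0 : l 0 = ∅ := by
    ext x
    rw [hl]
    simp
  obtain ⟨F, hF⟩ : ∃ F : Finset (Finset (Fin n)), F =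
    insert {zero} ((Finset.range v).image l ∪ (Finset.range (e - 1)).image u) := ⟨_, rfl⟩
  have hlF : ∀ i < v, l i ∈ F := fun i hi => by
    rw [hF]
    exact Finset.mem_insert_of_mem (Finset.mem_union_left _
      (Finset.mem_image_of_mem _ (Finset.mem_range.2 hi)))
  have huF : ∀ i < e - 1, u i ∈ F := fun i hi => by
    rw [hF]
    exact Finset.mem_insert_of_mem (Finset.mem_union_right _
      (Finset.mem_image_of_mem _ (Finset.mem_range.2 hi)))
  have hBF : {zero} ∈ F := by rw [hF]; exact Finset.mem_insert_self _ _
  have hFc : F.card ≤ e + v := by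
    rw [hF]
    have h1 := Finset.card_insert_le ({zero} : Finset (Fin n))
      ((Finset.range v).image l ∪ (Finset.range (e - 1)).image u)
    have h2 := Finset.card_union_le ((Finset.range v).image l) ((Finset.range (e - 1)).image u)
    have h3 := Finset.card_image_le (s := Finset.range v) (f := l)
    have h4 := Finset.card_image_le (s := Finset.range (e - 1)) (f := u)
    rw [Finset.card_range] at h3 h4
    omega
  refine ⟨F, ⟨?_, ?_⟩, hFc⟩
  · refine free_aux G F {zero} (by rw [he, hv]; exact hFc) hBF (by simp)
      ((Finset.Icc 1 (k + 1)).image u) ?_ ?_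
    · intro A hA hBA hne
      rw [hF, Finset.mem_insert, Finset.mem_union, Finset.mem_image, Finset.mem_image] at hA
      rw [Finset.singleton_subset_iff] at hBA
      rcases hA with hA | ⟨i, hi, rfl⟩ | ⟨i, hi, rfl⟩
      · exact absurd hA hne
      · rw [hl] at hBA
        simp only [zero] at hBA
        omega
      · rw [hu] at hBA
        simp only [zero] at hBA
        exact Finset.mem_image_of_mem _ (Finset.mem_Icc.2 (by omega))
    · intro x
      have h3 := Finset.card_image_le (s := Finset.Icc 1 (k + 1)) (f := u)
      rw [Nat.card_Icc] at h3
      have := hmin x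
      omega
  · intro A hA
    have hAl : ∀ i < v, l i ≠ A := fun i hi h => hA (h ▸ hlF i hi)
    have hAu : ∀ i < e - 1, u i ≠ A := fun i hi h => hA (h ▸ huF i hi)
    have hAB : {zero} ≠ A := fun h => hA (h ▸ hBF)
    have hlF' : ∀ i < v, l i ∈ insert A F := fun i hi => Finset.mem_insert_of_mem (hlF i hi)
    have huF' : ∀ i < e - 1, u i ∈ insert A F := fun i hi => Finset.mem_insert_of_mem (huF i hi)
    have hBF' : {zero} ∈ insert A F := Finset.mem_insert_of_mem hBF
    have hAF' : A ∈ insert A F := Finset.mem_insert_self _ _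
    by_cases c0 : zero ∈ A
    · refine copyAB G hv he' hvk hek w q z hz hzi hzs hq hqw hqz (insert A F)
        (fun i => if i = v - 1 then {zero} else l i)
        (fun m => if m = 0 then A else if m = e - 1 then u 0 else u m) ?_ ?_ ?_ ?_ ?_ ?_ ?_ ?_ ?_
      · intro i j hij hj
        split_ifs
        · omega
        · omega
        · exact hlB _
        · exact hll _ _ hij hj
      · intro i j hij hj
        split_ifs
        all_goals first
          | omega
          | exact (hAu _ (by omega)).symm
          | exact (huu _ _ (by omega) (by omega))
          | exact (huu _ _ (by omega) (by omega)).symm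
      · intro i j hi hj
        split_ifs
        all_goals first
          | exact hAB
          | exact (huB _).symm
          | exact hAl _ hi
          | exact hlu _ _ hi
      · intro i hi
        split_ifs
        · exact hBF'
        · exact hlF' _ hi
      · intro i hi
        split_ifs
        · exact hAF'
        · exact huF' _ (by omega)
        · exact huF' _ (by omega)
      · intro m
        rw [if_neg (by omega), hl0]
        exact Finset.empty_subset _
      · intro m hm
        rw [if_pos rfl, Finset.singleton_subset_iff]
        split_ifs
        · exact c0
        · omega
        · rw [hu]
          simp only [zero]
          omega
      · rw [if_neg (by omega), if_neg (by omega), if_pos rfl]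
        exact hsub _ _ (by omega) (by omega) (by omega)
      · intro i m hi hm hm' h
        rw [if_neg (by omega), if_neg (by omega), if_neg (by omega)]
        exact hsub _ _ (by omega) (by omega) (by omega)
    by_cases c1 : ∃ r : Fin n, r ∈ A ∧ 1 ≤ r.val ∧ r.val ≤ k
    · obtain ⟨r, hrA, hr, hrk⟩ := c1
      refine copyC G hv he' hvk hek w z hz hzi (insert A F)
        l (fun m => if m = e - 1 then A else u m) r.val hr hrk hll ?_ ?_ hlF' ?_ ?_ ?_ ?_
      · intro i j hij hj
        split_ifs
        all_goals first
          | omega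
          | exact hAu _ (by omega)
          | exact (huu _ _ (by omega) (by omega))
      · intro i j hi hj
        split_ifs
        · exact hAl _ hi
        · exact hlu _ _ hi
      · intro i hi
        split_ifs
        · exact hAF'
        · exact huF' _ (by omega)
      · intro m
        rw [hl0]
        exact Finset.empty_subset _
      · rw [if_pos rfl]
        intro x hx
        rw [hl] at hx
        have : x = r := Fin.ext (by omega)
        rw [this]
        exact hrA
      · intro i m hi hm h
        rw [if_neg (by omega)]
        exact hsub _ _ hi hm h
    · have hAk : ∀ x ∈ A, k < x.val := by
        intro x hx
        by_contra hc
        by_cases hx0 : x.val = 0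
        · have : x = zero := Fin.ext hx0
          exact c0 (this ▸ hx)
        · exact c1 ⟨x, hx, by omega, by omega⟩
      refine copyAB G hv he' hvk hek w q z hz hzi hzs hq hqw hqz (insert A F)
        (fun i => if i = v - 1 then A else l i)
        (fun m => if m = e - 1 then l (v - 1) else u m) ?_ ?_ ?_ ?_ ?_ ?_ ?_ ?_ ?_
      · intro i j hij hj
        split_ifs
        · omega
        · omega
        · exact hAl _ (by omega)
        · exact hll _ _ hij hj
      · intro i j hij hj
        split_ifs
        all_goals first
          | omega
          | exact (hlu _ _ (by omega)).symm
          | exact (huu _ _ (by omega) (by omega))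
      · intro i j hi hj
        split_ifs
        · exact (hAl _ (by omega)).symm
        · exact (hAu _ (by omega)).symm
        · exact hll _ _ (by omega) (by omega)
        · exact hlu _ _ hi
      · intro i hi
        split_ifs
        · exact hAF'
        · exact hlF' _ hi
      · intro i hi
        split_ifs
        · exact hlF' _ (by omega)
        · exact huF' _ (by omega)
      · intro m
        rw [if_neg (by omega), hl0]
        exact Finset.empty_subset _
      · intro m hm
        rw [if_pos rfl, if_neg (by omega)]
        intro x hx
        have := hAk x hx
        rw [hu]
        omega
      · rw [if_neg (by omega), if_pos rfl]
        intro x hx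
        rw [hl] at hx ⊢
        omega
      · intro i m hi hm hm' h
        rw [if_neg (by omega), if_neg (by omega)]
        exact hsub _ _ (by omega) (by omega) (by omega)

lemma copy_one {V : Type*} [Fintype V] [DecidableEq V] (G : SimpleGraph V) [DecidableRel G.Adj]
    {n v e : ℕ} (hv : Fintype.card V = v) (he : Fintype.card G.edgeSet = e)
    (hv2 : 2 ≤ v) (he1 : 1 ≤ e)
    (w z : V) (hz : G.Adj w z) (hzs : ∀ x, G.Adj w x → z = x)
    (F : Finset (Finset (Fin n)))
    (a b : ℕ → Finset (Fin n))
    (ha : ∀ i j, i < j → j < v → a i ≠ a j) (hb : ∀ i j, i < j → j < e → b i ≠ b j)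
    (hab : ∀ i j, i < v → j < e → a i ≠ b j)
    (haF : ∀ i < v, a i ∈ F) (hbF : ∀ i < e, b i ∈ F)
    (h0 : ∀ m, a 0 ⊆ b m) (h1 : a (v - 1) ⊆ b (e - 1))
    (h3 : ∀ i m, i < v - 1 → m < e - 1 → a i ⊆ b m) :
    ContainsWeakCopy (IncElem G) F := by
  classical
  have hzw : z ≠ w := (G.ne_of_adj hz).symm
  obtain ⟨N, hN, hNv, hNx⟩ := numbering_aux v hv (Finset.range 2)
    (fun j => if j = 0 then z else w) (fun j => if j = 0 then 0 else v - 1)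
    (by
      intro i hi j hj hij
      simp only [Finset.coe_range, Set.mem_Iio] at hi hj
      try simp only at hij
      split_ifs at hij with c1 c2 c3
      · omega
      · exact absurd hij hzw
      · exact absurd hij.symm hzw
      · omega)
    (by
      intro i hi j hj hij
      simp only [Finset.coe_range, Set.mem_Iio] at hi hj
      try simp only at hij
      split_ifs at hij <;> omega)
    (by
      intro i hi
      simp only [Finset.mem_range] at hi
      try simp only
      split_ifs <;> omega)
  have hNz : N z = 0 := by simpa using hNx 0 (by simp)
  have hNw : N w = v - 1 := by simpa using hNx 1 (by simp)
  obtain ⟨N', hN', hNe, hNx'⟩ := numbering_aux e he {0}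
    (fun _ => (⟨s(w, z), hz⟩ : G.edgeSet)) (fun _ => e - 1) (by simp) (by simp)
    (by simp; omega)
  have hE := hNx' 0 (by simp)
  refine assemble G F a b ha hb hab haF hbF N N' hN hN' hNv hNe ?_
  intro f x hx
  by_cases hf : f = ⟨s(w, z), hz⟩
  · subst hf
    rw [hE]
    have hx' : x ∈ s(w, z) := hx
    rw [Sym2.mem_iff] at hx'
    rcases hx' with rfl | rfl
    · rw [hNw]; exact h1
    · rw [hNz]; exact h0 _
  · have hxw : x ≠ w := by
      rintro rfl
      apply hf
      obtain ⟨f, hf'⟩ := f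
      obtain ⟨y, rfl⟩ := Sym2.mem_iff_exists.1 hx
      have := hzs y hf'
      subst this
      rfl
    apply h3
    · have hne : N x ≠ v - 1 := by
        rw [← hNw]
        exact fun h => hxw (hN h)
      have := hNv x
      omega
    · have hne : N' f ≠ e - 1 := by
        rw [← hE]
        exact fun h => hf (hN' h)
      have := hNe f
      omega

lemma sat_one {V : Type*} [Fintype V] [DecidableEq V] (G : SimpleGraph V) [DecidableRel G.Adj]
    {n v e : ℕ} (hv : Fintype.card V = v) (he : G.edgeFinset.card = e) (hn : e + v ≤ n)
    (w : V) (hw : G.degree w = 1) (hmin : ∀ x, 1 ≤ G.degree x) :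
    ∃ F : Finset (Finset (Fin n)), WeakSaturating (IncElem G) F ∧ F.card ≤ e + v := by
  classical
  have he' : Fintype.card G.edgeSet = e := by rw [← he, SimpleGraph.edgeFinset_card]
  rw [← SimpleGraph.card_neighborFinset_eq_degree, Finset.card_eq_one] at hw
  obtain ⟨z, hzz⟩ := hw
  have hz : G.Adj w z := by
    rw [← SimpleGraph.mem_neighborFinset, hzz]; simp
  have hzs : ∀ x, G.Adj w x → z = x := by
    intro x hx
    rw [← SimpleGraph.mem_neighborFinset, hzz] at hx
    exact (Finset.mem_singleton.1 hx).symm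
  have hv2 : 2 ≤ v := by
    rw [← hv]
    exact Fintype.one_lt_card_iff.2 ⟨w, z, G.ne_of_adj hz⟩
  have he1 : 1 ≤ e := by
    rw [← he]
    exact Finset.card_pos.2 ⟨s(w, z), by simpa using hz⟩
  obtain ⟨l, hl⟩ : ∃ l : ℕ → Finset (Fin n), ∀ j i, i ∈ l j ↔ (1 ≤ i.val ∧ i.val ≤ j) :=
    exists_fam _
  let zero : Fin n := ⟨0, by omega⟩
  have hneq : ∀ {A C : Finset (Fin n)} (m : ℕ) (hm : m < n),
      ¬ ((⟨m, hm⟩ : Fin n) ∈ A ↔ (⟨m, hm⟩ : Fin n) ∈ C) → A ≠ C := by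
    rintro A C m hm h rfl
    exact h Iff.rfl
  have hll : ∀ i j, i < j → j < n → l i ≠ l j := by
    intro i j hij hj
    apply hneq j (by omega)
    rw [hl, hl]
    simp only [and_true]
    omega
  have hlB : ∀ i, l i ≠ {zero} := by
    intro i
    apply hneq 0 (by omega)
    rw [hl]
    simp only [Finset.mem_singleton, zero, iff_true]
    omega
  have hsub : ∀ i m, i ≤ m → l i ⊆ l m := by
    intro i m hi x hx
    rw [hl] at hx ⊢
    omega
  obtain ⟨F, hF⟩ : ∃ F : Finset (Finset (Fin n)), F =
    insert {zero} (insert (l (n - 1)) ((Finset.range (v + e - 2)).image l)) := ⟨_, rfl⟩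
  have hlF : ∀ i < v + e - 2, l i ∈ F := fun i hi => by
    rw [hF]
    exact Finset.mem_insert_of_mem (Finset.mem_insert_of_mem
      (Finset.mem_image_of_mem _ (Finset.mem_range.2 hi)))
  have huF : l (n - 1) ∈ F := by
    rw [hF]
    exact Finset.mem_insert_of_mem (Finset.mem_insert_self _ _)
  have hBF : {zero} ∈ F := by rw [hF]; exact Finset.mem_insert_self _ _
  have hFc : F.card ≤ e + v := by
    rw [hF]
    have h1 := Finset.card_insert_le ({zero} : Finset (Fin n))
      (insert (l (n - 1)) ((Finset.range (v + e - 2)).image l))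
    have h2 := Finset.card_insert_le (l (n - 1)) ((Finset.range (v + e - 2)).image l)
    have h3 := Finset.card_image_le (s := Finset.range (v + e - 2)) (f := l)
    rw [Finset.card_range] at h3
    omega
  refine ⟨F, ⟨?_, ?_⟩, hFc⟩
  · refine free_aux G F {zero} (by rw [he, hv]; exact hFc) hBF (by simp) ∅ ?_ ?_
    · intro A hA hBA hne
      rw [hF, Finset.mem_insert, Finset.mem_insert, Finset.mem_image] at hA
      rw [Finset.singleton_subset_iff] at hBA
      exfalso
      rcases hA with hA | rfl | ⟨i, hi, rfl⟩
      · exact absurd hA hne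
      · rw [hl] at hBA
        simp only [zero] at hBA
        omega
      · rw [hl] at hBA
        simp only [zero] at hBA
        omega
    · intro x
      have := hmin x
      simp only [Finset.card_empty]
      omega
  · intro A hA
    have hAl : ∀ i < v + e - 2, l i ≠ A := fun i hi h => hA (h ▸ hlF i hi)
    have hAn : l (n - 1) ≠ A := fun h => hA (h ▸ huF)
    have hAB : {zero} ≠ A := fun h => hA (h ▸ hBF)
    have hlF' : ∀ i < v + e - 2, l i ∈ insert A F := fun i hi => Finset.mem_insert_of_mem (hlF i hi)
    have huF' : l (n - 1) ∈ insert A F := Finset.mem_insert_of_mem huF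
    have hBF' : {zero} ∈ insert A F := Finset.mem_insert_of_mem hBF
    have hAF' : A ∈ insert A F := Finset.mem_insert_self _ _
    have main : ∀ X Y : Finset (Fin n), X ∈ insert A F → Y ∈ insert A F → X ≠ Y → X ⊆ Y →
        (∀ i < v + e - 2, l i ≠ X) → (∀ i < v + e - 2, l i ≠ Y) →
        ContainsWeakCopy (IncElem G) (insert A F) := by
      intro X Y hX hY hXY hXsY hlX hlY
      have hl0 : l 0 = ∅ := by
        ext x
        rw [hl]
        simp
        omega
      refine copy_one G hv he' hv2 he1 w z hz hzs (insert A F)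
        (fun i => if i = v - 1 then X else l i)
        (fun m => if m = e - 1 then Y else l (v - 1 + m)) ?_ ?_ ?_ ?_ ?_ ?_ ?_ ?_
      · intro i j hij hj
        split_ifs
        · omega
        · omega
        · exact hlX _ (by omega)
        · exact hll _ _ hij (by omega)
      · intro i j hij hj
        split_ifs
        · omega
        · omega
        · exact hlY _ (by omega)
        · exact hll _ _ (by omega) (by omega)
      · intro i j hi hj
        split_ifs
        · exact hXY
        · exact (hlX _ (by omega)).symm
        · exact hlY _ (by omega)
        · exact hll _ _ (by omega) (by omega)
      · intro i hi
        split_ifs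
        · exact hX
        · exact hlF' _ (by omega)
      · intro i hi
        split_ifs
        · exact hY
        · exact hlF' _ (by omega)
      · intro m
        rw [if_neg (by omega), hl0]
        exact Finset.empty_subset _
      · rw [if_pos rfl, if_pos rfl]
        exact hXsY
      · intro i m hi hm
        rw [if_neg (by omega), if_neg (by omega)]
        exact hsub _ _ (by omega)
    by_cases c0 : zero ∈ A
    · exact main {zero} A hBF' hAF' hAB (Finset.singleton_subset_iff.2 c0)
        (fun i _ => hlB i) hAl
    · refine main A (l (n - 1)) hAF' huF' hAn.symm ?_ hAl
        (fun i hi => hll _ _ (by omega) (by omega))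
      intro x hx
      rw [hl]
      have : x.val ≠ 0 := fun h => c0 ((show x = zero from Fin.ext h) ▸ hx)
      omega

lemma sat_zero {V : Type*} [Fintype V] [DecidableEq V] (G : SimpleGraph V) [DecidableRel G.Adj]
    {n v e : ℕ} (hv : Fintype.card V = v) (he : G.edgeFinset.card = e) (hn : e + v ≤ n)
    (w : V) (hw : G.degree w = 0) :
    ∃ F : Finset (Finset (Fin n)), WeakSaturating (IncElem G) F ∧ F.card ≤ e + v := by
  classical
  have he' : Fintype.card G.edgeSet = e := by rw [← he, SimpleGraph.edgeFinset_card]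
  rw [← SimpleGraph.card_neighborFinset_eq_degree, Finset.card_eq_zero] at hw
  have hzs : ∀ x, ¬ G.Adj w x := by
    intro x hx
    rw [← SimpleGraph.mem_neighborFinset, hw] at hx
    simp at hx
  have hv1 : 1 ≤ v := by
    rw [← hv]
    exact Fintype.card_pos_iff.2 ⟨w⟩
  obtain ⟨l, hl⟩ : ∃ l : ℕ → Finset (Fin n), ∀ j i, i ∈ l j ↔ (1 ≤ i.val ∧ i.val ≤ j) :=
    exists_fam _
  have hneq : ∀ {A C : Finset (Fin n)} (m : ℕ) (hm : m < n),
      ¬ ((⟨m, hm⟩ : Fin n) ∈ A ↔ (⟨m, hm⟩ : Fin n) ∈ C) → A ≠ C := by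
    rintro A C m hm h rfl
    exact h Iff.rfl
  have hll : ∀ i j, i < j → j < n → l i ≠ l j := by
    intro i j hij hj
    apply hneq j (by omega)
    rw [hl, hl]
    simp only [and_true]
    omega
  have hsub : ∀ i m, i ≤ m → l i ⊆ l m := by
    intro i m hi x hx
    rw [hl] at hx ⊢
    omega
  have hFc : ((Finset.range (v + e - 1)).image l).card ≤ v + e - 1 := by
    have h3 := Finset.card_image_le (s := Finset.range (v + e - 1)) (f := l)
    rwa [Finset.card_range] at h3
  refine ⟨(Finset.range (v + e - 1)).image l, ⟨?_, ?_⟩, by omega⟩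
  · rintro ⟨f, hf, hfF, -⟩
    have := copy_card_s5 G _ f hf hfF
    omega
  · intro A hA
    have hlF : ∀ i < v + e - 1, l i ∈ (Finset.range (v + e - 1)).image l := fun i hi =>
      Finset.mem_image_of_mem _ (Finset.mem_range.2 hi)
    have hAl : ∀ i < v + e - 1, l i ≠ A := fun i hi h => hA (h ▸ hlF i hi)
    obtain ⟨N, hN, hNv, hNx⟩ := numbering_aux v hv {0}
      (fun _ => w) (fun _ => v - 1) (by simp) (by simp) (by simp; omega)
    have hNw := hNx 0 (by simp)
    obtain ⟨N', hN', hNe⟩ : ∃ N' : G.edgeSet → ℕ, Function.Injective N' ∧ ∀ x, N' x < e :=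
      ⟨fun x => Fintype.equivFinOfCardEq he' x, fun x y h =>
        (Fintype.equivFinOfCardEq he').injective (Fin.ext h), fun x => Fin.is_lt _⟩
    refine assemble G _ (fun i => if i = v - 1 then A else l i) (fun m => l (v - 1 + m))
      ?_ ?_ ?_ ?_ ?_ N N' hN hN' hNv hNe ?_
    · intro i j hij hj
      split_ifs
      · omega
      · omega
      · exact hAl _ (by omega)
      · exact hll _ _ hij (by omega)
    · intro i j hij hj
      exact hll _ _ (by omega) (by omega)
    · intro i j hi hj
      split_ifs
      · exact (hAl _ (by omega)).symm
      · exact hll _ _ (by omega) (by omega)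
    · intro i hi
      split_ifs
      · exact Finset.mem_insert_self _ _
      · exact Finset.mem_insert_of_mem (hlF _ (by omega))
    · intro i hi
      exact Finset.mem_insert_of_mem (hlF _ (by omega))
    · intro f x hx
      have hxw : x ≠ w := by
        rintro rfl
        obtain ⟨f, hf'⟩ := f
        obtain ⟨y, rfl⟩ := Sym2.mem_iff_exists.1 hx
        exact hzs y hf'
      have hne : N x ≠ v - 1 := by
        rw [← hNw]
        exact fun h => hxw (hN h)
      have := hNv x
      rw [if_neg hne]
      exact hsub _ _ (by omega)

end constructions

/-- For a finite simple graph `G` with `v` vertices and `e` edges and any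
`n ≥ e + v`: `e + v - 1 ≤ sat(n, P(G)) ≤ e + v`. -/
theorem sat_incidence_poset {V : Type*} [Fintype V] [DecidableEq V]
    (G : SimpleGraph V) [DecidableRel G.Adj] (v e n : ℕ)
    (hv : Fintype.card V = v) (he : G.edgeFinset.card = e)
    (hn : e + v ≤ n) :
    e + v - 1 ≤ satN n (IncElem G) ∧ satN n (IncElem G) ≤ e + v := by
  classical
  rcases isEmpty_or_nonempty V with hV | hV
  · have hI : IsEmpty (IncElem G) := by
      refine ⟨?_⟩
      rintro (x | ⟨f, hf⟩)
      · exact hV.elim x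
      · induction f using Sym2.ind with
        | _ x y => exact hV.elim x
    have hS : satN n (IncElem G) = 0 := by
      unfold satN
      rw [Nat.sInf_eq_zero]
      right
      rw [Set.eq_empty_iff_forall_notMem]
      rintro m ⟨F, ⟨h, -⟩, -⟩
      exact h ⟨fun p => hI.elim p, fun p => hI.elim p, fun p => hI.elim p, fun p => hI.elim p⟩
    have hv0 : v = 0 := by rw [← hv]; exact Fintype.card_eq_zero
    have he0 : e = 0 := by
      rw [← he, SimpleGraph.edgeFinset_card, Fintype.card_eq_zero_iff]
      exact ⟨fun f => hI.elim (Sum.inr f)⟩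
    omega
  · have hex : ∃ F : Finset (Finset (Fin n)), WeakSaturating (IncElem G) F ∧ F.card ≤ e + v := by
      obtain ⟨w, hw⟩ := G.exists_minimal_degree_vertex
      have hmin : ∀ x, G.degree w ≤ G.degree x := fun x => hw ▸ G.minDegree_le_degree x
      rcases hd : G.degree w with _ | _ | k
      · exact sat_zero G hv he hn w hd
      · exact sat_one G hv he hn w hd (fun x => by have := hmin x; omega)
      · exact sat_two G hv he hn w hd (fun x => by have := hmin x; omega)
    obtain ⟨F, hF, hFc⟩ := hex
    constructor
    · have hne : {m | ∃ F : Finset (Finset (Fin n)),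
          WeakSaturating (IncElem G) F ∧ F.card = m}.Nonempty := ⟨_, F, hF, rfl⟩
      obtain ⟨F', hF', hc⟩ := Nat.sInf_mem hne
      unfold satN
      rw [← hc]
      by_contra hlt
      have hS : ∃ S, S ∉ F' := by
        by_contra hall
        push Not at hall
        have h1 : F' = Finset.univ := Finset.eq_univ_iff_forall.2 hall
        have h2 : F'.card = 2 ^ n := by rw [h1]; simp
        have := Nat.lt_two_pow_self (n := n)
        omega
      obtain ⟨S, hS⟩ := hS
      obtain ⟨f, hf, hfF, -⟩ := hF'.2 S hS
      have h1 := copy_card_s5 G _ f hf hfF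
      have h2 := Finset.card_insert_le S F'
      omega
    · exact le_trans (Nat.sInf_le ⟨F, hF, rfl⟩) hFc
end

section
/- Let P be a finite poset and suppose there exist an integer m ≥ 2, an induced P-saturating family ℱ ⊆ 2^[m], and two distinct elements x, y ∈ [m] that are not separated by ℱ (i.e., every F ∈ ℱ satisfies x ∈ F ⟺ y ∈ F). Then for every n ≥ m, sat*(n,P) ≤ |ℱ|; in particular sat*(n,P) = O(1). -/
theorem ContainsIndCopy.of_emb {P : Type*} [PartialOrder P] {n : ℕ}
    {F : Finset (Finset (Fin n))} (f : P → Finset (Fin n)) (hf : ∀ p, f p ∈ F)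
    (h : ∀ p q : P, p ≤ q ↔ f p ⊆ f q) : ContainsIndCopy P F :=
  ⟨f, fun p q e => le_antisymm ((h p q).2 e.subset) ((h q p).2 e.symm.subset), hf, h⟩

/-- If there is an induced `P`-saturating family `F ⊆ 2^[m]` that fails to
separate two distinct elements `x, y` of the ground set, then
`sat*(n,P) ≤ |F|` for every `n ≥ m`; in particular `sat*(n,P) = O(1)`. -/
theorem satStar_le_of_nonseparating (P : Type*) [PartialOrder P] (m : ℕ)
    (hm : 2 ≤ m) (F : Finset (Finset (Fin m))) (hF : IndSaturating P F)
    (x y : Fin m) (hxy : x ≠ y) (hsep : ∀ A ∈ F, x ∈ A ↔ y ∈ A) :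
    ∀ n : ℕ, m ≤ n → satStar n P ≤ F.card := by
  classical
  intro n hn
  let φ : Fin n → Fin m := fun w => if h : w.1 < m then ⟨w.1, h⟩ else x
  let ι : Fin m → Fin n := Fin.castLE hn
  have hφι : ∀ z, φ (ι z) = z := by
    intro z
    simp [φ, ι]
  have hιφ : ∀ w, φ w ≠ x → w = ι (φ w) := by
    intro w hw
    by_cases h : w.1 < m
    · ext; simp [φ, ι, h]
    · simp [φ, h] at hw
  let Φ : Finset (Fin m) → Finset (Fin n) := fun B => Finset.univ.filter (fun w => φ w ∈ B)
  have hΦ : ∀ B w, w ∈ Φ B ↔ φ w ∈ B := by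
    intro B w; simp [Φ]
  have hsub : ∀ B C, B ⊆ C ↔ Φ B ⊆ Φ C := by
    intro B C
    constructor
    · intro h w hw
      rw [hΦ] at *
      exact h hw
    · intro h z hz
      have := @h (ι z) (by rw [hΦ, hφι]; exact hz)
      rwa [hΦ, hφι] at this
  have key : IndSaturating P (F.image Φ) := by
    constructor
    · rintro ⟨f, -, hf, hle⟩
      apply hF.1
      have : ∀ p, ∃ B ∈ F, Φ B = f p := fun p => Finset.mem_image.1 (hf p)
      choose g hg hgf using this
      refine ContainsIndCopy.of_emb g hg fun p q => ?_
      rw [hle, hsub, hgf, hgf]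
    · intro G hG
      let A : Finset (Fin m) := Finset.univ.filter (fun z =>
        if z = x then ∃ w, (φ w = x ∨ φ w = y) ∧ w ∈ G
        else if z = y then ∀ w, (φ w = x ∨ φ w = y) → w ∈ G
        else ι z ∈ G)
      have hAx : x ∈ A ↔ ∃ w, (φ w = x ∨ φ w = y) ∧ w ∈ G := by simp [A]
      have hAy : y ∈ A ↔ ∀ w, (φ w = x ∨ φ w = y) → w ∈ G := by simp [A, hxy.symm]
      have hAz : ∀ z, z ≠ x → z ≠ y → (z ∈ A ↔ ι z ∈ G) := by
        intro z h1 h2; simp [A, h1, h2]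
      have hAF : A ∉ F := by
        intro hA
        apply hG
        refine Finset.mem_image.2 ⟨A, hA, ?_⟩
        have hs := hsep A hA
        ext w
        rw [hΦ]
        by_cases h1 : φ w = x
        · rw [h1]
          exact ⟨fun h => hAy.1 (hs.1 h) w (Or.inl h1), fun h => hAx.2 ⟨w, Or.inl h1, h⟩⟩
        by_cases h2 : φ w = y
        · rw [h2]
          exact ⟨fun h => hAy.1 h w (Or.inr h2), fun h => hs.1 (hAx.2 ⟨w, Or.inr h2, h⟩)⟩
        rw [hAz _ h1 h2, ← hιφ w h1]
      have hyx : y ∈ A → x ∈ A := fun h => hAx.2 ⟨ι x, Or.inl (hφι x), hAy.1 h _ (Or.inl (hφι x))⟩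
      have hAB : ∀ B ∈ F, (A ⊆ B ↔ G ⊆ Φ B) := by
        intro B hB
        have hs := hsep B hB
        constructor
        · intro h w hw
          rw [hΦ]
          by_cases h1 : φ w = x
          · rw [h1]; exact h (hAx.2 ⟨w, Or.inl h1, hw⟩)
          by_cases h2 : φ w = y
          · rw [h2]; exact hs.1 (h (hAx.2 ⟨w, Or.inr h2, hw⟩))
          exact h ((hAz _ h1 h2).2 (by rwa [← hιφ w h1]))
        · intro h
          have hx : x ∈ A → x ∈ B := by
            intro hz
            obtain ⟨w, hw, hwG⟩ := hAx.1 hz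
            have := (hΦ _ _).1 (h hwG)
            rcases hw with hw | hw
            · rwa [hw] at this
            · rw [hw] at this; exact hs.2 this
          intro z hz
          by_cases h1 : z = x
          · subst h1; exact hx hz
          by_cases h2 : z = y
          · subst h2; exact hs.1 (hx (hyx hz))
          have := (hΦ _ _).1 (h ((hAz _ h1 h2).1 hz))
          rwa [hφι] at this
      have hBA : ∀ B ∈ F, (B ⊆ A ↔ Φ B ⊆ G) := by
        intro B hB
        have hs := hsep B hB
        constructor
        · intro h w hw
          rw [hΦ] at hw
          by_cases h1 : φ w = x
          · rw [h1] at hw; exact hAy.1 (h (hs.1 hw)) w (Or.inl h1)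
          by_cases h2 : φ w = y
          · rw [h2] at hw; exact hAy.1 (h hw) w (Or.inr h2)
          rw [hιφ w h1]
          exact (hAz _ h1 h2).1 (h hw)
        · intro h
          have hy : y ∈ B → y ∈ A := by
            intro hz
            refine hAy.2 fun w hw => h ((hΦ _ _).2 ?_)
            rcases hw with hw | hw
            · rw [hw]; exact hs.2 hz
            · rw [hw]; exact hz
          intro z hz
          by_cases h1 : z = x
          · subst h1; exact hyx (hy (hs.1 hz))
          by_cases h2 : z = y
          · subst h2; exact hy hz
          exact (hAz _ h1 h2).2 (h ((hΦ _ _).2 (by rwa [hφι])))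
      obtain ⟨f, -, hf, hle⟩ := hF.2 A hAF
      refine ContainsIndCopy.of_emb (fun p => if f p = A then G else Φ (f p)) ?_ ?_
      · intro p
        by_cases h : f p = A
        · simp [h]
        · simp only [h, if_false]
          exact Finset.mem_insert_of_mem
            (Finset.mem_image_of_mem _ (Finset.mem_of_mem_insert_of_ne (hf p) h))
      · intro p q
        rw [hle]
        by_cases h : f p = A <;> by_cases h' : f q = A
        · simp [h, h']
        · simp only [h, h', if_true, if_false]
          exact hAB _ (Finset.mem_of_mem_insert_of_ne (hf q) h')
        · simp only [h, h', if_true, if_false]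
          exact hBA _ (Finset.mem_of_mem_insert_of_ne (hf p) h)
        · simp only [h, h', if_false]
          exact hsub _ _
  have h0 : satStar n P ≤ (F.image Φ).card := Nat.sInf_le ⟨_, key, rfl⟩
  exact h0.trans Finset.card_image_le
end

section
/- Let P be a finite nonempty poset and let ℱ ⊆ 2^[n] be an induced P-saturating family. If P has no greatest element (no element of P is above all other elements), then [n] ∈ ℱ, and moreover ℱ is also induced Ṗ-saturating, where Ṗ is the poset obtained from P by adding one new element that is strictly greater than every element of P. Dually, if P has no least element, then ∅ ∈ ℱ. -/
/-- If `P` has no greatest element, then every induced `P`-saturating family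
contains the full set `[n]` and is moreover induced `Ṗ`-saturating, where `Ṗ`
(`WithTop P`) adds a new top element to `P`. Dually, if `P` has no least
element, then every induced `P`-saturating family contains `∅`. -/
theorem indSaturating_top_bottom (P : Type*) [PartialOrder P] [Fintype P]
    [Nonempty P] (n : ℕ) (F : Finset (Finset (Fin n)))
    (hF : IndSaturating P F) :
    ((¬ ∃ p : P, ∀ q : P, q ≤ p) →
      (Finset.univ : Finset (Fin n)) ∈ F ∧ IndSaturating (WithTop P) F) ∧
    ((¬ ∃ p : P, ∀ q : P, p ≤ q) → (∅ : Finset (Fin n)) ∈ F) := by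
  obtain ⟨hfree, hsat⟩ := hF
  refine ⟨fun hP => ?_, fun hP => ?_⟩
  · have huniv : (Finset.univ : Finset (Fin n)) ∈ F := by
      by_contra hU
      obtain ⟨f, hinj, hmem, hle⟩ := hsat _ hU
      refine hfree ⟨f, hinj, fun p => ?_, hle⟩
      rcases Finset.mem_insert.1 (hmem p) with h | h
      · exact absurd ⟨p, fun q => (hle q p).2 (h ▸ Finset.subset_univ _)⟩ hP
      · exact h
    refine ⟨huniv, ?_, ?_⟩
    · rintro ⟨f, hinj, hmem, hle⟩
      exact hfree ⟨fun p => f p, fun a b h => WithTop.coe_injective (hinj h), fun p => hmem p,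
        fun p q => by rw [← hle, WithTop.coe_le_coe]⟩
    · intro G hG
      obtain ⟨f, hinj, hmem, hle⟩ := hsat G hG
      have hne : ∀ p, f p ≠ Finset.univ := fun p h =>
        hP ⟨p, fun q => (hle q p).2 (h ▸ Finset.subset_univ _)⟩
      have hle' : ∀ p q : WithTop P, p ≤ q ↔
          WithTop.recTopCoe (C := fun _ => Finset (Fin n)) Finset.univ f p ⊆
          WithTop.recTopCoe (C := fun _ => Finset (Fin n)) Finset.univ f q := by
        intro p q
        induction q using WithTop.recTopCoe with
        | top => simp
        | coe q =>
          induction p using WithTop.recTopCoe with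
          | top => simp [Finset.univ_subset_iff, hne]
          | coe p => simp [hle]
      refine ⟨WithTop.recTopCoe (C := fun _ => Finset (Fin n)) Finset.univ f, ?_, ?_, hle'⟩
      · intro a b h
        exact le_antisymm ((hle' a b).2 h.le) ((hle' b a).2 h.ge)
      · intro p
        induction p using WithTop.recTopCoe with
        | top => exact Finset.mem_insert_of_mem huniv
        | coe p => exact hmem p
  · by_contra hU
    obtain ⟨f, hinj, hmem, hle⟩ := hsat _ hU
    refine hfree ⟨f, hinj, fun p => ?_, hle⟩
    rcases Finset.mem_insert.1 (hmem p) with h | h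
    · exact absurd ⟨p, fun q => (hle p q).2 (h ▸ Finset.empty_subset _)⟩ hP
    · exact h
end

section
/- Let P be a finite poset that is UCTP with top chain: P is the disjoint union of a subposet P₀ with |P₀| ≥ 2 that has the unique cover twin property, and a (possibly empty) chain C, where every element of P₀ is strictly smaller than every element of C. Then every induced P-saturating family ℱ ⊆ 2^[n] is separating (for every pair of distinct x, y ∈ [n] there is F ∈ ℱ containing exactly one of x, y); consequently sat*(n,P) ≥ log₂ n for all n ≥ 1. -/
def TZ {P : Type*} [PartialOrder P] {n : ℕ} (P₀ : Set P)
    (F : Finset (Finset (Fin n))) (S : Finset (Fin n)) : Prop :=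
  ∃ f : P → Finset (Fin n), ∃ p ∈ P₀, (∀ a b : P, a ≤ b ↔ f a ⊆ f b) ∧ f p = S ∧
    ∀ q, q ≠ p → f q ∈ F

theorem emb_inj {P : Type*} [PartialOrder P] {n : ℕ} {f : P → Finset (Fin n)}
    (h : ∀ a b : P, a ≤ b ↔ f a ⊆ f b) : Function.Injective f := by
  intro a b hab
  exact le_antisymm ((h a b).2 hab.subset) ((h b a).2 hab.symm.subset)

theorem emb_lt {P : Type*} [PartialOrder P] {n : ℕ} {f : P → Finset (Fin n)}
    (h : ∀ a b : P, a ≤ b ↔ f a ⊆ f b) (a b : P) : a < b ↔ f a ⊂ f b := by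
  rw [lt_iff_le_not_ge, h, h, Finset.ssubset_def]

theorem get_copy {P : Type*} [PartialOrder P] {n : ℕ} {F : Finset (Finset (Fin n))}
    (hF : IndSaturating P F) {S : Finset (Fin n)} (hS : S ∉ F) :
    ∃ f : P → Finset (Fin n), ∃ p : P, (∀ a b : P, a ≤ b ↔ f a ⊆ f b) ∧ f p = S ∧
      ∀ q, q ≠ p → f q ∈ F := by
  obtain ⟨f, hi, hm, ho⟩ := hF.2 S hS
  by_cases h : ∃ p, f p = S
  · obtain ⟨p, hp⟩ := h
    refine ⟨f, p, ho, hp, fun q hq => ?_⟩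
    rcases Finset.mem_insert.1 (hm q) with h | h
    · exact absurd (hi (h.trans hp.symm)) hq
    · exact h
  · push Not at h
    exact absurd ⟨f, hi, fun q => (Finset.mem_insert.1 (hm q)).resolve_left (h q), ho⟩ hF.1

theorem no_replace {P : Type*} [PartialOrder P] {n : ℕ} {F : Finset (Finset (Fin n))}
    (hF : IndSaturating P F) {f : P → Finset (Fin n)} {p : P}
    (ho : ∀ a b : P, a ≤ b ↔ f a ⊆ f b) (hm : ∀ q, q ≠ p → f q ∈ F)
    {A : Finset (Fin n)} (hA : A ∈ F) :
    ∃ q, q ≠ p ∧ (¬ (A ⊆ f q ↔ f p ⊆ f q) ∨ ¬ (f q ⊆ A ↔ f q ⊆ f p)) := by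
  classical
  by_contra hcon
  push Not at hcon
  have ho' : ∀ a b : P, a ≤ b ↔ Function.update f p A a ⊆ Function.update f p A b := by
    intro a b
    by_cases ha : a = p <;> by_cases hb : b = p
    · simp [ha, hb]
    · subst ha; simp [Function.update_of_ne hb, (hcon b hb).1, ho]
    · subst hb; simp [Function.update_of_ne ha, (hcon a ha).2, ho]
    · simp [Function.update_of_ne ha, Function.update_of_ne hb, ho]
  refine hF.1 ⟨Function.update f p A, emb_inj ho', fun q => ?_, ho'⟩
  by_cases hq : q = p
  · simp [hq, hA]
  · simp [Function.update_of_ne hq, hm q hq]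

theorem combine {P : Type*} [PartialOrder P] {n : ℕ} {F : Finset (Finset (Fin n))}
    (P₀ C : Set P)
    (hpart : ∀ p : P, (p ∈ P₀ ∧ p ∉ C) ∨ (p ∈ C ∧ p ∉ P₀))
    (hbelow : ∀ x ∈ P₀, ∀ y ∈ C, x < y)
    (f g : P → Finset (Fin n))
    (hf : ∀ a b : P, a ≤ b ↔ f a ⊆ f b) (hg : ∀ a b : P, a ≤ b ↔ g a ⊆ g b)
    (hfF : ∀ a ∈ P₀, f a ∈ F) (hgF : ∀ a ∈ C, g a ∈ F)
    (hfg : ∀ a ∈ P₀, ∀ b ∈ C, f a ⊂ g b) : ContainsIndCopy P F := by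
  classical
  have ho : ∀ a b : P, a ≤ b ↔
      (fun p => if p ∈ P₀ then f p else g p) a ⊆ (fun p => if p ∈ P₀ then f p else g p) b := by
    intro a b
    rcases hpart a with ⟨ha, ha'⟩ | ⟨ha, ha'⟩ <;> rcases hpart b with ⟨hb, hb'⟩ | ⟨hb, hb'⟩
    · simp [ha, hb, hf]
    · simp [ha, hb', (hbelow a ha b hb).le, (hfg a ha b hb).1]
    · simp [ha', hb, (hbelow b hb a ha).not_ge, (hfg b hb a ha).2]
    · simp [ha', hb', hg]
  refine ⟨_, emb_inj ho, fun p => ?_, ho⟩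
  rcases hpart p with ⟨ha, ha'⟩ | ⟨ha, ha'⟩
  · simp [ha, hfF]
  · simp [ha', hgF p ha]

theorem getT {P : Type*} [PartialOrder P] {n : ℕ} {F : Finset (Finset (Fin n))}
    (P₀ C : Set P)
    (hpart : ∀ p : P, (p ∈ P₀ ∧ p ∉ C) ∨ (p ∈ C ∧ p ∉ P₀))
    (hbelow : ∀ x ∈ P₀, ∀ y ∈ C, x < y) (hF : IndSaturating P F)
    (g : P → Finset (Fin n)) (hg : ∀ a b : P, a ≤ b ↔ g a ⊆ g b)
    {p : P} (hp : p ∈ P₀) (hgF : ∀ q, q ≠ p → g q ∈ F) {D : Finset (Fin n)} (hD : D ∉ F)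
    (hDg : ∀ a ∈ C, D ⊆ g a) : TZ P₀ F D := by
  obtain ⟨f, r, ho, hr, hm⟩ := get_copy hF hD
  rcases hpart r with ⟨h, h'⟩ | ⟨h, h'⟩
  · exact ⟨f, r, h, ho, hr, hm⟩
  · refine absurd (combine P₀ C hpart hbelow f g ho hg ?_ ?_ ?_) hF.1
    · intro a ha; exact hm a (by rintro rfl; exact h' ha)
    · intro a ha; exact hgF a (by rintro rfl; exact lt_irrefl _ (hbelow a hp a ha))
    · intro a ha b hb
      exact ((emb_lt ho a r).1 (hbelow a ha r h)).trans_subset (hr ▸ hDg b hb)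

theorem sep_main {P : Type*} [PartialOrder P] [Fintype P]
    (P₀ C : Set P)
    (hpart : ∀ p : P, (p ∈ P₀ ∧ p ∉ C) ∨ (p ∈ C ∧ p ∉ P₀))
    (hcard : 2 ≤ P₀.ncard)
    (hbelow : ∀ x ∈ P₀, ∀ y ∈ C, x < y)
    (huctp : ∀ x ∈ P₀, ∀ y ∈ P₀, x < y → (∀ z ∈ P₀, ¬ (x < z ∧ z < y)) →
      ∃ z ∈ P₀, ((z ≤ x ∨ x ≤ z) ∧ ¬ (z ≤ y ∨ y ≤ z)) ∨
        ((z ≤ y ∨ y ≤ z) ∧ ¬ (z ≤ x ∨ x ≤ z)))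
    {n : ℕ} (F : Finset (Finset (Fin n))) (hF : IndSaturating P F)
    (x y : Fin n) (hxy : x ≠ y) (hns : ∀ A ∈ F, (x ∈ A ↔ y ∈ A)) : False := by
  have K : ∀ (g : P → Finset (Fin n)) (_ : ∀ a b : P, a ≤ b ↔ g a ⊆ g b)
    (p : P) (_ : p ∈ P₀) (_ : ∀ q, q ≠ p → g q ∈ F) (D : Finset (Fin n)) (_ : D ∉ F)
    (_ : ∀ a ∈ C, D ⊆ g a), TZ P₀ F D := fun g hg p hp hgF D hD hDg =>
      getT P₀ C hpart hbelow hF g hg hp hgF hD hDg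
  have hins : ∀ A ∈ F, x ∉ A → insert x A ∉ F := by
    intro A hA hx h
    have h1 := hns _ hA
    have h2 := hns _ h
    simp [hxy.symm] at h2
    tauto
  have hera : ∀ A ∈ F, x ∈ A → A.erase x ∉ F := by
    intro A hA hx h
    have h1 := hns _ hA
    have h2 := hns _ h
    simp [hxy.symm] at h2
    tauto
  have hneC : ∀ {p q : P}, p ∈ P₀ → q ∈ C → q ≠ p := by
    rintro p q hp hq rfl; exact lt_irrefl _ (hbelow q hp q hq)
  have two : ∀ p : P, ∃ q ∈ P₀, q ≠ p := by
    intro p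
    obtain ⟨q, hq, hne⟩ := Set.exists_ne_of_one_lt_ncard (s := P₀) (by omega) p
    exact ⟨q, hq, hne⟩
  -- Case I
  have hI : ∀ A ∈ F, x ∉ A → ¬ TZ P₀ F (insert x A) := by
    by_contra hcon
    push Not at hcon
    have hne : Set.Nonempty {A | A ∈ F ∧ x ∉ A ∧ TZ P₀ F (insert x A)} := hcon
    obtain ⟨A, ⟨hA, hxA, f, p, hp, ho, hfp, hm⟩, hmax⟩ := (Set.toFinite _).exists_maximal hne
    have hyA : y ∉ A := fun h => hxA ((hns A hA).2 h)
    have hG := hins A hA hxA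
    have low : ∀ q, q ≠ p → f q ⊆ f p → f q ⊆ A := by
      intro q hq hs
      have hy : y ∉ f q := by
        intro h
        have := hs h
        rw [hfp] at this
        simp [hxy.symm, hyA] at this
      have hx : x ∉ f q := fun h => hy ((hns _ (hm q hq)).1 h)
      intro a ha
      have := hs ha
      rw [hfp] at this
      rcases Finset.mem_insert.1 this with rfl | h
      · exact absurd ha hx
      · exact h
    have key : ∀ z ∈ P₀, z ≠ p → A ⊂ f z → x ∉ f z → False := by
      intro z hz hzp hlt hx
      have hT : TZ P₀ F (insert x (f z)) := by
        refine K f ho p hp hm _ (hins _ (hm z hzp) hx) ?_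
        intro a ha
        refine Finset.insert_subset ?_ ((ho _ _).1 (hbelow z hz a ha).le)
        apply (ho _ _).1 (hbelow p hp a ha).le
        rw [hfp]; exact Finset.mem_insert_self _ _
      exact hlt.2 (hmax ⟨hm z hzp, hx, hT⟩ hlt.1)
    have up : ∀ q, A ⊆ f q → ¬ f p ⊆ f q → x ∉ f q := by
      intro q h1 h2 h3
      apply h2
      rw [hfp]; exact Finset.insert_subset h3 h1
    have hAp : A ⊆ f p := by rw [hfp]; exact Finset.subset_insert _ _
    by_cases hex : ∃ q, f q = A
    · obtain ⟨q, hq⟩ := hex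
      have hqp : q ≠ p := by
        rintro rfl
        exact hG (hfp ▸ hq ▸ hA)
      have hle : q ≤ p := (ho _ _).2 (hq ▸ hAp)
      have hqP : q ∈ P₀ := by
        rcases hpart q with h | h
        · exact h.1
        · exact absurd hle (hbelow p hp q h.1).not_ge
      have hlt : q < p := lt_of_le_of_ne hle hqp
      obtain ⟨z, hz, h⟩ := huctp q hqP p hp hlt (by
        rintro z hz ⟨h1, h2⟩
        have := low z h2.ne ((ho _ _).1 h2.le)
        rw [← hq] at this
        exact h1.not_ge ((ho _ _).2 this))
      have hzp : z ≠ p := by rintro rfl; simp [hle] at h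
      rcases h with ⟨h1 | h1, h2⟩ | ⟨h1 | h1, h2⟩
      · exact h2 (Or.inl (h1.trans hle))
      · have hne : q ≠ z := by rintro rfl; exact h2 (Or.inl hle)
        refine key z hz hzp (hq ▸ (emb_lt ho q z).1 (lt_of_le_of_ne h1 hne)) ?_
        exact up z (hq ▸ (ho _ _).1 h1) (fun h => h2 (Or.inr ((ho _ _).2 h)))
      · have := low z hzp ((ho _ _).1 h1)
        rw [← hq] at this
        exact h2 (Or.inl ((ho _ _).2 this))
      · exact h2 (Or.inr (hle.trans h1))
    · obtain ⟨q, hqp, h⟩ := no_replace hF ho hm hA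
      have hqA : f q ≠ A := fun h => hex ⟨q, h⟩
      rcases h with h | h
      · have h1 : A ⊆ f q ∧ ¬ f p ⊆ f q := by
          have : f p ⊆ f q → A ⊆ f q := hAp.trans
          tauto
        have hqP : q ∈ P₀ := by
          rcases hpart q with h | h
          · exact h.1
          · exact absurd ((ho _ _).1 (hbelow p hp q h.1).le) h1.2
        exact key q hqP hqp (Finset.ssubset_iff_subset_ne.2 ⟨h1.1, hqA.symm⟩) (up q h1.1 h1.2)
      · exact h ⟨fun h => h.trans hAp, low q hqp⟩
  have h2 : ∀ (f : P → Finset (Fin n)) (p : P), p ∈ P₀ → (∀ a b : P, a ≤ b ↔ f a ⊆ f b) →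
      (∀ q, q ≠ p → f q ∈ F) → (x ∈ f p ∨ y ∈ f p) → ∀ q ∈ P₀, q ≠ p → x ∈ f q := by
    intro f p hp ho hm hor q hq hqp
    by_contra hx
    refine hI _ (hm q hqp) hx (K f ho p hp hm _ (hins _ (hm q hqp) hx) ?_)
    intro a ha
    refine Finset.insert_subset ?_ ((ho _ _).1 (hbelow q hq a ha).le)
    have hs := (ho _ _).1 (hbelow p hp a ha).le
    rcases hor with h | h
    · exact hs h
    · exact (hns _ (hm a (hneC hp ha))).2 (hs h)
  have hne : Set.Nonempty {B | B ∈ F ∧ x ∈ B ∧ TZ P₀ F (B.erase x)} := by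
    have hxF : ({x} : Finset (Fin n)) ∉ F := by
      intro h
      have := hns _ h
      simp [hxy.symm] at this
    obtain ⟨f, p, ho, hfp, hm⟩ := get_copy hF hxF
    have hp : p ∈ P₀ := by
      rcases hpart p with h | h
      · exact h.1
      · exfalso
        obtain ⟨a, ha, -⟩ := two p
        obtain ⟨b, hb, hab⟩ := two a
        have h1 := (emb_lt ho _ _).1 (hbelow a ha p h.1)
        have h2 := (emb_lt ho _ _).1 (hbelow b hb p h.1)
        rw [hfp, Finset.ssubset_singleton_iff] at h1 h2
        exact hab (emb_inj ho (h2.trans h1.symm))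
    obtain ⟨q, hq, hqp⟩ := two p
    have hx := h2 f p hp ho hm (Or.inl (by simp [hfp])) q hq hqp
    refine ⟨f q, hm q hqp, hx, K f ho p hp hm _ (hera _ (hm q hqp) hx) ?_⟩
    intro a ha
    exact (Finset.erase_subset _ _).trans ((ho _ _).1 (hbelow q hq a ha).le)
  obtain ⟨B, ⟨hB, hxB, f, p, hp, ho, hfp, hm⟩, hmin⟩ := (Set.toFinite _).exists_minimal hne
  have hyB : y ∈ B := (hns B hB).1 hxB
  have hyp : y ∈ f p := by rw [hfp]; simp [hxy.symm, hyB]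
  have hG := hera B hB hxB
  have hpB : f p ⊆ B := by rw [hfp]; exact Finset.erase_subset _ _
  have key : ∀ z ∈ P₀, z ≠ p → f z ⊂ B → False := by
    intro z hz hzp hlt
    have hx := h2 f p hp ho hm (Or.inr hyp) z hz hzp
    refine hlt.2 (hmin ⟨hm z hzp, hx, K f ho p hp hm _ (hera _ (hm z hzp) hx) ?_⟩ hlt.1)
    intro a ha
    exact (Finset.erase_subset _ _).trans ((ho _ _).1 (hbelow z hz a ha).le)
  have up : ∀ q, q ≠ p → f p ⊆ f q → B ⊆ f q := by
    intro q hqp hs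
    have hx := (hns _ (hm q hqp)).2 (hs hyp)
    rw [hfp] at hs
    intro a ha
    by_cases hax : a = x
    · rw [hax]; exact hx
    · exact hs (Finset.mem_erase.2 ⟨hax, ha⟩)
  by_cases hex : ∃ q, f q = B
  · obtain ⟨q, hq⟩ := hex
    have hqp : q ≠ p := by
      rintro rfl
      exact hG (hfp ▸ hq ▸ hB)
    have hle : p ≤ q := (ho _ _).2 (hq ▸ hpB)
    rcases hpart q with ⟨hqP, -⟩ | ⟨hqC, -⟩
    · obtain ⟨z, hz, h⟩ := huctp p hp q hqP (lt_of_le_of_ne hle hqp.symm) (by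
        rintro z hz ⟨h1, h2⟩
        have := up z h1.ne' ((ho _ _).1 h1.le)
        rw [← hq] at this
        exact h2.not_ge ((ho _ _).2 this))
      have hzp : z ≠ p := by rintro rfl; simp [hle] at h
      have hzq : z ≠ q := by rintro rfl; simp [hle] at h
      rcases h with ⟨h1 | h1, h2⟩ | ⟨h1 | h1, h2⟩
      · exact h2 (Or.inl (h1.trans hle))
      · have := up z hzp ((ho _ _).1 h1)
        rw [← hq] at this
        exact h2 (Or.inr ((ho _ _).2 this))
      · exact key z hz hzp (hq ▸ (emb_lt ho _ _).1 (lt_of_le_of_ne h1 hzq))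
      · exact h2 (Or.inr (hle.trans h1))
    · obtain ⟨z, hz, hzp⟩ := two p
      exact key z hz hzp (hq ▸ (emb_lt ho _ _).1 (hbelow z hz q hqC))
  · obtain ⟨q, hqp, h⟩ := no_replace hF ho hm hB
    have hqB : f q ≠ B := fun h => hex ⟨q, h⟩
    rcases h with h | h
    · exact h ⟨fun h => hpB.trans h, up q hqp⟩
    · have h1 : f q ⊆ B := by
        have : f q ⊆ f p → f q ⊆ B := fun h => h.trans hpB
        tauto
      have hqP : q ∈ P₀ := by
        rcases hpart q with h | h
        · exact h.1
        · exact absurd (h1.antisymm (up q hqp ((ho _ _).1 (hbelow p hp q h.1).le))) hqB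
      exact key q hqP hqp (Finset.ssubset_iff_subset_ne.2 ⟨h1, hqB⟩)

theorem sat_exists {P : Type*} [PartialOrder P] [Nonempty P] (n : ℕ) :
    ∃ F : Finset (Finset (Fin n)), IndSaturating P F := by
  have hfin : Set.Finite {F : Finset (Finset (Fin n)) | ¬ ContainsIndCopy P F} := Set.toFinite _
  have hne : Set.Nonempty {F : Finset (Finset (Fin n)) | ¬ ContainsIndCopy P F} := by
    refine ⟨∅, ?_⟩
    rintro ⟨f, -, hm, -⟩
    exact absurd (hm (Classical.arbitrary P)) (Finset.notMem_empty _)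
  obtain ⟨F, hF⟩ := hfin.exists_maximal hne
  refine ⟨F, hF.1, fun G hG => ?_⟩
  by_contra h
  exact hG (hF.2 h (Finset.subset_insert G F) (Finset.mem_insert_self G F))

theorem card_bound {n : ℕ} (hn : 1 ≤ n) (F : Finset (Finset (Fin n)))
    (h : ∀ x y : Fin n, x ≠ y → ∃ A ∈ F, (x ∈ A ↔ y ∉ A)) :
    Real.logb 2 n ≤ (F.card : ℝ) := by
  have h1 : n ≤ 2 ^ F.card := by
    have := Finset.card_le_card_of_injOn (s := (Finset.univ : Finset (Fin n)))
      (t := F.powerset) (fun x => F.filter fun A => x ∈ A)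
      (fun x _ => Finset.mem_coe.2 (Finset.mem_powerset.2 (Finset.filter_subset _ _))) (by
        intro x _ y _ hxy
        by_contra hne
        obtain ⟨A, hA, hA'⟩ := h x y hne
        have := congrArg (A ∈ ·) hxy
        simp [hA] at this
        tauto)
    simpa using this
  have hn0 : (0 : ℝ) < n := by exact_mod_cast hn
  rw [Real.logb_le_iff_le_rpow (by norm_num) hn0, Real.rpow_natCast]
  exact_mod_cast h1

/-- If `P` is "UCTP with top chain" — `P` is partitioned into a part `P₀` with
at least two elements having the unique cover twin property and a (possibly
empty) chain `C` lying strictly above all of `P₀` — then every induced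
`P`-saturating family in `2^[n]` is separating, and hence
`sat*(n,P) ≥ log₂ n`. -/
theorem uctp_top_chain_separating (P : Type*) [PartialOrder P] [Fintype P]
    (P₀ C : Set P)
    (hpart : ∀ p : P, (p ∈ P₀ ∧ p ∉ C) ∨ (p ∈ C ∧ p ∉ P₀))
    (hcard : 2 ≤ P₀.ncard)
    (hchain : ∀ x ∈ C, ∀ y ∈ C, x ≤ y ∨ y ≤ x)
    (hbelow : ∀ x ∈ P₀, ∀ y ∈ C, x < y)
    (huctp : ∀ x ∈ P₀, ∀ y ∈ P₀, x < y → (∀ z ∈ P₀, ¬ (x < z ∧ z < y)) →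
      ∃ z ∈ P₀, ((z ≤ x ∨ x ≤ z) ∧ ¬ (z ≤ y ∨ y ≤ z)) ∨
        ((z ≤ y ∨ y ≤ z) ∧ ¬ (z ≤ x ∨ x ≤ z)))
    (n : ℕ) (hn : 1 ≤ n) :
    (∀ F : Finset (Finset (Fin n)), IndSaturating P F →
      ∀ x y : Fin n, x ≠ y → ∃ A ∈ F, (x ∈ A ↔ y ∉ A)) ∧
    Real.logb 2 n ≤ (satStar n P : ℝ) := by
  have hsep : ∀ F : Finset (Finset (Fin n)), IndSaturating P F →
      ∀ x y : Fin n, x ≠ y → ∃ A ∈ F, (x ∈ A ↔ y ∉ A) := by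
    intro F hF x y hxy
    by_contra hcon
    push Not at hcon
    refine sep_main P₀ C hpart hcard hbelow huctp F hF x y hxy fun A hA => ?_
    have := hcon A hA
    tauto
  refine ⟨hsep, ?_⟩
  have hP : Nonempty P := by
    obtain ⟨a, -⟩ := Set.nonempty_of_ncard_ne_zero (s := P₀) (by omega)
    exact ⟨a⟩
  obtain ⟨F₀, hF₀⟩ := sat_exists (P := P) n
  have hmem : satStar n P ∈ {m | ∃ F : Finset (Finset (Fin n)), IndSaturating P F ∧ F.card = m} :=
    Nat.sInf_mem ⟨_, F₀, hF₀, rfl⟩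
  obtain ⟨F, hF, hc⟩ := hmem
  rw [← hc]
  exact card_bound hn F (hsep F hF)
end

section
/- Let P be a finite poset and let k ≥ 2 be an integer with e*(P) ≤ k − 2, where e*(P) is the largest integer m such that for every ℓ and every union of m complete consecutive levels of the Boolean lattice 2^[ℓ], this union is induced P-free. Then there exists a constant K (depending only on P and k, and independent of n) such that sat*(n, C_k + P) ≤ K for all n ≥ 1, where C_k + P denotes the disjoint union of the k-element chain C_k and P, with every element of C_k incomparable with every element of P. -/
/-- The union of `m` complete consecutive levels of the Boolean lattice `2^[ℓ]`,
starting at level `a`: all subsets `F ⊆ [ℓ]` with `a ≤ |F| ≤ a + m - 1`. -/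
def consecutiveLevels (ℓ a m : ℕ) : Finset (Finset (Fin ℓ)) :=
  Finset.univ.filter (fun F => a ≤ F.card ∧ F.card < a + m)

/-- `e*(P)`: the largest `m` such that every union of `m` complete consecutive
levels of any Boolean lattice is induced `P`-free. -/
noncomputable def estar (P : Type*) [PartialOrder P] : ℕ :=
  sSup {m : ℕ | ∀ ℓ a : ℕ, ¬ ContainsIndCopy P (consecutiveLevels ℓ a m)}

open Finset in
lemma exists_flag {α : Type*} [DecidableEq α] (X : Finset α) :
    ∃ D : ℕ → Finset α, Monotone D ∧ (∀ i, D i ⊆ X) ∧ ∀ i, (D i).card = min i X.card := by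
  refine ⟨fun i => (X.toList.take i).toFinset, ?_, ?_, ?_⟩
  · intro i j hij x hx
    simp only [List.mem_toFinset] at hx ⊢
    exact (List.take_sublist_take_left hij).subset hx
  · intro i x hx
    simp only [List.mem_toFinset] at hx
    exact Finset.mem_toList.1 (List.mem_of_mem_take hx)
  · intro i
    rw [List.toFinset_card_of_nodup ((List.take_sublist _ _).nodup X.nodup_toList)]
    simp

lemma exists_flag_through {N : ℕ} (A B : Finset (Fin N)) (hAB : A ⊆ B)
    (hcard : B.card ≤ A.card + 1) :
    ∃ D : ℕ → Finset (Fin N), Monotone D ∧ (∀ i, i ≤ N → (D i).card = i) ∧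
      (∀ i, i ≤ A.card → D i ⊆ A) ∧ (∀ i, A.card < i → B ⊆ D i) := by
  obtain ⟨D1, m1, s1, c1⟩ := exists_flag A
  obtain ⟨D2, m2, s2, c2⟩ := exists_flag Bᶜ
  refine ⟨fun i => if i ≤ A.card then D1 i else B ∪ D2 (i - B.card), ?_, ?_, ?_, ?_⟩
  · intro i j hij
    by_cases hj : j ≤ A.card
    · have hi : i ≤ A.card := hij.trans hj
      simp only [hi, hj, if_true]
      exact m1 hij
    · by_cases hi : i ≤ A.card
      · simp only [hi, hj, if_true, if_false]
        exact ((s1 i).trans hAB).trans Finset.subset_union_left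
      · simp only [hi, hj, if_false]
        exact Finset.union_subset_union_right (m2 (by omega))
  · intro i hi
    by_cases h : i ≤ A.card
    · simp [h, c1]
    · simp only [h, if_false]
      rw [Finset.card_union_of_disjoint, c2, Finset.card_compl, Fintype.card_fin]
      · have : B.card ≤ N := by simpa using Finset.card_le_univ B
        omega
      · exact Finset.disjoint_of_subset_right (s2 _) disjoint_compl_right
  · intro i h
    simp only [h, if_true]
    exact s1 i
  · intro i h
    have : ¬ i ≤ A.card := by omega
    simp only [this, if_false]
    exact Finset.subset_union_left

/-- Preimage of a set under the collapsing map. -/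
def pre {n N : ℕ} (φ : Fin n → Fin N) (C : Finset (Fin N)) : Finset (Fin n) :=
  Finset.univ.filter (fun i => φ i ∈ C)

lemma mem_pre {n N : ℕ} (φ : Fin n → Fin N) (C : Finset (Fin N)) (i : Fin n) :
    i ∈ pre φ C ↔ φ i ∈ C := by simp [pre]

lemma pre_subset {n N : ℕ} {φ : Fin n → Fin N} (hφ : Function.Surjective φ)
    (C D : Finset (Fin N)) : pre φ C ⊆ pre φ D ↔ C ⊆ D := by
  constructor
  · intro h x hx
    obtain ⟨i, rfl⟩ := hφ x
    exact (mem_pre _ _ _).1 (h ((mem_pre _ _ _).2 hx))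
  · intro h i hi
    exact (mem_pre _ _ _).2 (h ((mem_pre _ _ _).1 hi))

/-- The base family. -/
def baseFam {n N : ℕ} (φ : Fin n → Fin N) (a m : ℕ) : Finset (Finset (Fin n)) :=
  (consecutiveLevels N a m).image (pre φ)

lemma mem_baseFam {n N : ℕ} (φ : Fin n → Fin N) (a m : ℕ) (G : Finset (Fin n)) :
    G ∈ baseFam φ a m ↔ ∃ C : Finset (Fin N), (a ≤ C.card ∧ C.card < a + m) ∧ pre φ C = G := by
  simp [baseFam, consecutiveLevels]

lemma baseFam_free {P : Type*} [PartialOrder P] {n N : ℕ} {φ : Fin n → Fin N}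
    (hφ : Function.Surjective φ) (a k : ℕ) (hk : 2 ≤ k) :
    ¬ ContainsIndCopy (Fin k ⊕ P) (baseFam φ a (k - 1)) := by
  rintro ⟨f, hinj, hmem, hle⟩
  have h1 : ∀ i : Fin k, ∃ C : Finset (Fin N), (a ≤ C.card ∧ C.card < a + (k - 1)) ∧
      pre φ C = f (Sum.inl i) := fun i => (mem_baseFam _ _ _ _).1 (hmem _)
  choose C hC hpre using h1
  have hmono : StrictMono (fun i => (C i).card) := by
    intro i j hij
    apply Finset.card_lt_card
    have h2 : C i ⊆ C j := by
      rw [← pre_subset hφ, hpre, hpre, ← hle]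
      exact Sum.inl_le_inl_iff.2 hij.le
    have h3 : ¬ C j ⊆ C i := by
      rw [← pre_subset hφ, hpre, hpre, ← hle, Sum.inl_le_inl_iff]
      exact not_le.2 hij
    exact ⟨h2, h3⟩
  have : (Finset.univ : Finset (Fin k)).card ≤ (Finset.Ico a (a + (k - 1))).card := by
    apply Finset.card_le_card_of_injOn (fun i => (C i).card)
    · intro i _
      simpa using hC i
    · exact hmono.injective.injOn
  simp at this
  omega

lemma copy_insert {P : Type*} [PartialOrder P] {n N ℓ a₀ k : ℕ} {φ : Fin n → Fin N}
    (hφ : Function.Surjective φ) (e : Fin N)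
    (he : ∀ i j, φ i = φ j → i ≠ j → φ i = e)
    (hk : 2 ≤ k) (hP : ContainsIndCopy P (consecutiveLevels ℓ a₀ (k - 1)))
    (hN : N = ℓ + 2 + k + a₀) (G : Finset (Fin n))
    (hG : G ∉ baseFam φ (a₀ + 1) (k - 1)) (hG0 : G ≠ ∅) (hG1 : G ≠ Finset.univ) :
    ContainsIndCopy (Fin k ⊕ P) (insert G (baseFam φ (a₀ + 1) (k - 1))) := by
  classical
  set a := a₀ + 1 with ha
  set B : Finset (Fin N) := G.image φ with hB
  set A : Finset (Fin N) := (Gᶜ.image φ)ᶜ with hA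
  have memA : ∀ i, φ i ∈ A → i ∈ G := by
    intro i hi
    by_contra hn
    simp only [hA, Finset.mem_compl, Finset.mem_image, not_exists, not_and] at hi
    exact hi i hn rfl
  have memB : ∀ i, i ∈ G → φ i ∈ B := fun i hi => Finset.mem_image_of_mem _ hi
  have hAB : A ⊆ B := by
    intro x hx
    obtain ⟨i, rfl⟩ := hφ x
    exact memB i (memA i hx)
  have hBA : B ⊆ insert e A := by
    intro x hx
    by_cases hxA : x ∈ A
    · exact Finset.mem_insert_of_mem hxA
    · simp only [hA, Finset.mem_compl, not_not, Finset.mem_image] at hxA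
      obtain ⟨j, hj, rfl⟩ := hxA
      obtain ⟨i, hi, hij⟩ := Finset.mem_image.1 hx
      rw [← hij, he i j hij (by rintro rfl; exact hj hi)]
      exact Finset.mem_insert_self _ _
  have hcard : B.card ≤ A.card + 1 :=
    (Finset.card_le_card hBA).trans (Finset.card_insert_le _ _)
  obtain ⟨D, mD, cD, lD, uD⟩ := exists_flag_through A B hAB hcard
  have lG : ∀ C, C ⊆ A → pre φ C ⊆ G := fun C h i hi => memA i (h ((mem_pre _ _ _).1 hi))
  have uG : ∀ C, B ⊆ C → G ⊆ pre φ C := fun C h i hi => (mem_pre _ _ _).2 (h (memB i hi))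
  have Dmem : ∀ i, i < k - 1 → pre φ (D (a + i)) ∈ baseFam φ a (k - 1) := by
    intro i hi
    rw [mem_baseFam]
    refine ⟨_, ?_, rfl⟩
    rw [cD _ (by omega)]
    omega
  have Dne : ∀ i, i < k - 1 → pre φ (D (a + i)) ≠ G := fun i hi h => hG (h ▸ Dmem i hi)
  have Dlt : ∀ i j, i < j → j < k - 1 → pre φ (D (a + i)) < pre φ (D (a + j)) := by
    intro i j hij hj
    refine ⟨(pre_subset hφ _ _).2 (mD (by omega)), fun h => ?_⟩
    have := Finset.card_le_card ((pre_subset hφ _ _).1 h)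
    rw [cD _ (by omega), cD _ (by omega)] at this
    omega
  -- the separating elements
  obtain ⟨x, hxD, hxB⟩ : ∃ x, x ∈ D a ∧ x ∈ B := by
    by_cases h : a ≤ A.card
    · have h1 : (D a).Nonempty := by
        rw [← Finset.card_pos, cD _ (by omega)]
        omega
      obtain ⟨x, hx⟩ := h1
      exact ⟨x, hx, hAB (lD a h hx)⟩
    · obtain ⟨i, hi⟩ := Finset.nonempty_iff_ne_empty.2 hG0
      exact ⟨φ i, uD a (by omega) (memB i hi), memB i hi⟩
  obtain ⟨t, htD, htA⟩ : ∃ t, t ∉ D (a + (k - 2)) ∧ t ∉ A := by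
    by_cases h : a + (k - 2) ≤ A.card
    · obtain ⟨i, hi⟩ : ∃ i, i ∉ G := by
        by_contra hc
        push Not at hc
        exact hG1 (Finset.eq_univ_iff_forall.2 hc)
      have : φ i ∉ A := fun h => hi (memA i h)
      exact ⟨φ i, fun h' => this (lD _ h h'), this⟩
    · obtain ⟨t, ht⟩ : ∃ t, t ∉ D (a + (k - 2)) := by
        by_contra hc
        push Not at hc
        have h2 := cD (a + (k - 2)) (by omega)
        rw [Finset.eq_univ_iff_forall.2 hc] at h2
        simp at h2
        omega
      exact ⟨t, ht, fun h' => ht (uD _ (by omega) (hAB h'))⟩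
  have xD : ∀ i, x ∈ D (a + i) := fun i => mD (by omega) hxD
  have tD : ∀ i, i < k - 1 → t ∉ D (a + i) := fun i hi h => htD (mD (by omega) h)
  have hxt : x ≠ t := by
    rintro rfl
    exact htD (xD _)
  -- embedding of the ground set of P
  obtain ⟨ι⟩ : Nonempty (Fin ℓ ↪ {y : Fin N // y ≠ x ∧ y ≠ t}) := by
    apply Function.Embedding.nonempty_of_card_le
    rw [Fintype.card_fin, Fintype.card_subtype]
    have h1 : (Finset.univ.filter (fun y : Fin N => y ≠ x ∧ y ≠ t)) = ({x, t} : Finset (Fin N))ᶜ := by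
      ext y; simp
    rw [h1, Finset.card_compl, Fintype.card_fin]
    have := Finset.card_le_two (a := x) (b := t)
    omega
  let ι' : Fin ℓ ↪ Fin N := ι.trans (Function.Embedding.subtype _)
  have ιx : ∀ y, ι' y ≠ x := fun y => (ι y).2.1
  have ιt : ∀ y, ι' y ≠ t := fun y => (ι y).2.2
  obtain ⟨f, finj, fmem, fle⟩ := hP
  let Q : P → Finset (Fin N) := fun p => insert t ((f p).map ι')
  have Qt : ∀ p, t ∈ Q p := fun p => Finset.mem_insert_self _ _
  have Qx : ∀ p, x ∉ Q p := by
    intro p h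
    simp only [Q, Finset.mem_insert, Finset.mem_map] at h
    rcases h with h | ⟨y, _, h⟩
    · exact hxt h
    · exact ιx y h
  have htm : ∀ p, t ∉ (f p).map ι' := by
    intro p h
    obtain ⟨y, _, h⟩ := Finset.mem_map.1 h
    exact ιt y h
  have Qmem : ∀ p, pre φ (Q p) ∈ baseFam φ a (k - 1) := by
    intro p
    rw [mem_baseFam]
    refine ⟨_, ?_, rfl⟩
    have h1 := fmem p
    simp only [consecutiveLevels, Finset.mem_filter, Finset.mem_univ, true_and] at h1
    have : (Q p).card = (f p).card + 1 := by
      simp only [Q]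
      rw [Finset.card_insert_of_notMem (htm p), Finset.card_map]
    omega
  have Qle : ∀ p q, p ≤ q ↔ pre φ (Q p) ⊆ pre φ (Q q) := by
    intro p q
    rw [pre_subset hφ, fle]
    constructor
    · intro h
      exact Finset.insert_subset_insert _ (Finset.map_subset_map.2 h)
    · intro h
      rw [← Finset.map_subset_map (f := ι')]
      intro y hy
      have h2 := h (Finset.mem_insert_of_mem hy)
      rcases Finset.mem_insert.1 h2 with h3 | h3
      · exact absurd (h3 ▸ hy) (htm p)
      · exact h3
  -- the chain
  set τ := min (A.card + 1 - a) (k - 1) with hτ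
  let g : Fin k → Finset (Fin n) := fun i =>
    if i.1 < τ then pre φ (D (a + i.1)) else if i.1 = τ then G else pre φ (D (a + (i.1 - 1)))
  have gcase : ∀ i, g i = G ∨ ∃ j, j < k - 1 ∧ g i = pre φ (D (a + j)) := by
    intro i
    have := i.2
    simp only [g]
    split_ifs with h1 h2
    · exact Or.inr ⟨i.1, by omega, rfl⟩
    · exact Or.inl rfl
    · exact Or.inr ⟨i.1 - 1, by omega, rfl⟩
  have gmono : StrictMono g := by
    intro i j hij
    have hi := i.2
    have hj := j.2
    have hij' : i.1 < j.1 := hij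
    simp only [g]
    split_ifs with h1 h2 h3 h4 h5 h6
    all_goals first
      | omega
      | exact Dlt _ _ (by omega) (by omega)
      | exact lt_of_le_of_ne (lG _ (lD _ (by omega))) (Dne _ (by omega))
      | exact lt_of_le_of_ne (uG _ (uD _ (by omega))) (Dne _ (by omega)).symm
  have gQ : ∀ i p, ¬ g i ⊆ pre φ (Q p) := by
    intro i p h
    rcases gcase i with h1 | ⟨j, hj, h1⟩ <;> rw [h1] at h
    · obtain ⟨y, hy, hyx⟩ := Finset.mem_image.1 hxB
      have := (mem_pre _ _ _).1 (h hy)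
      rw [hyx] at this
      exact Qx p this
    · exact Qx p ((pre_subset hφ _ _).1 h (xD j))
  have Qg : ∀ i p, ¬ pre φ (Q p) ⊆ g i := by
    intro i p h
    rcases gcase i with h1 | ⟨j, hj, h1⟩ <;> rw [h1] at h
    · simp only [hA, Finset.mem_compl, not_not, Finset.mem_image] at htA
      obtain ⟨y, hy, hyt⟩ := htA
      exact hy (h ((mem_pre _ _ _).2 (hyt ▸ Qt p)))
    · exact tD j hj ((pre_subset hφ _ _).1 h (Qt p))
  have key : ∀ p q : Fin k ⊕ P, p ≤ q ↔
      Sum.elim g (fun p => pre φ (Q p)) p ⊆ Sum.elim g (fun p => pre φ (Q p)) q := by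
    rintro (i | p) (j | q)
    · simp only [Sum.inl_le_inl_iff, Sum.elim_inl]
      exact gmono.le_iff_le.symm
    · simp only [Sum.elim_inl, Sum.elim_inr]
      exact iff_of_false Sum.not_inl_le_inr (gQ i q)
    · simp only [Sum.elim_inl, Sum.elim_inr]
      exact iff_of_false Sum.not_inr_le_inl (Qg j p)
    · simp only [Sum.inr_le_inr_iff, Sum.elim_inr]
      exact Qle p q
  refine ⟨Sum.elim g (fun p => pre φ (Q p)), ?_, ?_, key⟩
  · intro p q h
    exact le_antisymm ((key p q).2 h.subset) ((key q p).2 h.symm.subset)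
  · rintro (i | p)
    · rcases gcase i with h1 | ⟨j, hj, h1⟩ <;> simp only [Sum.elim_inl, h1]
      · exact Finset.mem_insert_self _ _
      · exact Finset.mem_insert_of_mem (Dmem j hj)
    · exact Finset.mem_insert_of_mem (Qmem p)

lemma ContainsIndCopy.mono {P : Type*} [PartialOrder P] {n : ℕ}
    {F F' : Finset (Finset (Fin n))} (h : F ⊆ F') (hF : ContainsIndCopy P F) :
    ContainsIndCopy P F' := by
  obtain ⟨f, h1, h2, h3⟩ := hF
  exact ⟨f, h1, fun p => h (h2 p), h3⟩

lemma exists_saturating {P : Type*} [PartialOrder P] {n : ℕ}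
    (F₀ : Finset (Finset (Fin n))) (h : ¬ ContainsIndCopy P F₀) :
    ∃ F, F₀ ⊆ F ∧ IndSaturating P F := by
  classical
  obtain ⟨F, hF, hmax⟩ := Set.Finite.exists_le_maximal
    (s := {F : Finset (Finset (Fin n)) | ¬ ContainsIndCopy P F}) (Set.toFinite _) h
  refine ⟨F, hF, hmax.1, fun G hG => ?_⟩
  by_contra hc
  exact hG (hmax.2 hc (Finset.subset_insert _ _) (Finset.mem_insert_self _ _))

lemma exists_levels_copy (P : Type*) [PartialOrder P] [Fintype P] (m : ℕ) (hm : estar P < m) :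
    ∃ ℓ a, ContainsIndCopy P (consecutiveLevels ℓ a m) := by
  classical
  by_contra hc
  push Not at hc
  refine absurd (le_csSup ?_ (show m ∈ {m : ℕ | ∀ ℓ a : ℕ,
    ¬ ContainsIndCopy P (consecutiveLevels ℓ a m)} from hc)) (not_le.2 hm)
  refine ⟨Fintype.card P, fun b hb => ?_⟩
  by_contra hlt
  push Not at hlt
  let eq := Fintype.equivFin P
  have key : ∀ p q : P, p ≤ q ↔ (Finset.univ.filter (fun i => eq.symm i ≤ p)) ⊆
      (Finset.univ.filter (fun i => eq.symm i ≤ q)) := by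
    intro p q
    constructor
    · intro h i hi
      simp only [Finset.mem_filter, Finset.mem_univ, true_and] at hi ⊢
      exact hi.trans h
    · intro h
      have := @h (eq p) (by simp)
      simpa using this
  refine hb (Fintype.card P) 0 ⟨fun p => Finset.univ.filter (fun i => eq.symm i ≤ p), ?_, ?_, key⟩
  · intro p q h
    exact le_antisymm ((key p q).2 h.subset) ((key q p).2 h.symm.subset)
  · intro p
    simp only [consecutiveLevels, Finset.mem_filter, Finset.mem_univ, true_and]
    have := Finset.card_le_univ (Finset.univ.filter (fun i => eq.symm i ≤ p))
    simp only [Fintype.card_fin] at this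
    omega

/-- If `e*(P) ≤ k - 2` (with `k ≥ 2`), then the induced saturation number of the
disjoint union `C_k + P` of the `k`-element chain and `P` is bounded by a
constant independent of `n`. -/
theorem satStar_chain_plus_shallow (P : Type*) [PartialOrder P] [Fintype P]
    (k : ℕ) (hk : 2 ≤ k) (hestar : estar P ≤ k - 2) :
    ∃ K : ℕ, ∀ n : ℕ, 1 ≤ n → satStar n (Fin k ⊕ P) ≤ K := by
  classical
  obtain ⟨ℓ, a₀, hP⟩ := exists_levels_copy P (k - 1) (by omega)
  obtain ⟨N, hN⟩ : ∃ N, N = ℓ + 2 + k + a₀ := ⟨_, rfl⟩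
  refine ⟨2 ^ N + 2, fun n hn => ?_⟩
  rcases lt_or_ge n N with h | h
  · unfold satStar
    rcases Set.eq_empty_or_nonempty {m | ∃ F : Finset (Finset (Fin n)),
      IndSaturating (Fin k ⊕ P) F ∧ F.card = m} with h0 | h0
    · rw [h0]; simp
    · obtain ⟨F, _, hF⟩ := Nat.sInf_mem h0
      rw [← hF]
      have h1 := Finset.card_le_univ F
      simp only [Fintype.card_finset, Fintype.card_fin] at h1
      have h2 : 2 ^ n ≤ 2 ^ N := Nat.pow_le_pow_right (by norm_num) h.le
      omega
  · let φ : Fin n → Fin N := fun i => ⟨min i.1 (N - 1), by omega⟩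
    have hφ : Function.Surjective φ := by
      intro y
      refine ⟨⟨y.1, by omega⟩, ?_⟩
      ext
      simp only [φ]
      omega
    have he : ∀ i j, φ i = φ j → i ≠ j → φ i = ⟨N - 1, by omega⟩ := by
      intro i j hij hne
      have hne' : i.1 ≠ j.1 := fun h => hne (Fin.ext h)
      simp only [φ, Fin.mk.injEq] at hij ⊢
      omega
    obtain ⟨F, hF, hsat⟩ := exists_saturating _ (baseFam_free (P := P) hφ (a₀ + 1) k hk)
    have hsub : F ⊆ baseFam φ (a₀ + 1) (k - 1) ∪ {∅, Finset.univ} := by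
      intro G hG
      by_contra hc
      simp only [Finset.mem_union, Finset.mem_insert, Finset.mem_singleton, not_or] at hc
      exact hsat.1 ((copy_insert hφ _ he hk hP hN G hc.1 hc.2.1 hc.2.2).mono
        (Finset.insert_subset hG hF))
    have h1 : satStar n (Fin k ⊕ P) ≤ F.card := Nat.sInf_le ⟨F, hsat, rfl⟩
    have h2 := Finset.card_le_card hsub
    have h3 := Finset.card_union_le (baseFam φ (a₀ + 1) (k - 1)) {∅, Finset.univ}
    have h4 : (baseFam φ (a₀ + 1) (k - 1)).card ≤ 2 ^ N := by
      refine Finset.card_image_le.trans ((Finset.card_le_univ _).trans ?_)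
      simp
    have h5 := Finset.card_le_two (a := (∅ : Finset (Fin n))) (b := Finset.univ)
    omega
end

section
/- For every integer n ≥ 3, sat*(n, 2C₂) ≤ 2n, where 2C₂ is the poset that is the disjoint union of two 2-element chains (elements a₁ < b₁ and a₂ < b₂, with no relation between {a₁,b₁} and {a₂,b₂}). Moreover, the family consisting of the full chain ∅ ⊂ {1} ⊂ {1,2} ⊂ ⋯ ⊂ [n] together with all singletons {2},…,{n} is an induced 2C₂-saturating family of size 2n in 2^[n]. -/
/-- The full chain `∅ ⊂ {1} ⊂ {1,2} ⊂ ⋯ ⊂ [n]` of initial segments in `2^[n]`. -/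
def fullChain (n : ℕ) : Finset (Finset (Fin n)) :=
  (Finset.range (n + 1)).image (fun j => Finset.univ.filter (fun i : Fin n => (i : ℕ) < j))

/-- The family consisting of the full chain `∅ ⊂ {1} ⊂ ⋯ ⊂ [n]` together with
all singletons other than `{1}` (i.e. `{2},…,{n}`). -/
def chainWithSingletons (n : ℕ) : Finset (Finset (Fin n)) :=
  fullChain n ∪ (Finset.univ.filter (fun i : Fin n => (i : ℕ) ≠ 0)).image (fun i => ({i} : Finset (Fin n)))

/-- `2C₂`, the disjoint union of two incomparable `2`-element chains. -/
abbrev TwoC2 : Type := Fin 2 ⊕ Fin 2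

theorem mem_cws {n : ℕ} (A : Finset (Fin n)) : A ∈ chainWithSingletons n ↔
    (∃ j ≤ n, A = Finset.univ.filter (fun i : Fin n => (i : ℕ) < j)) ∨
    (∃ i : Fin n, (i : ℕ) ≠ 0 ∧ A = {i}) := by
  simp only [chainWithSingletons, fullChain, Finset.mem_union, Finset.mem_image, Finset.mem_range,
    Finset.mem_filter, Finset.mem_univ, true_and, Nat.lt_succ_iff, eq_comm]

theorem single_mem {n : ℕ} (i : Fin n) : {i} ∈ chainWithSingletons n := by
  rw [mem_cws]
  by_cases h : (i : ℕ) = 0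
  · left
    refine ⟨1, by have := i.2; omega, ?_⟩
    ext x
    simp [Fin.ext_iff, h]
  · exact Or.inr ⟨i, h, rfl⟩

theorem seg_mem {n : ℕ} (j : ℕ) (hj : j ≤ n) :
    Finset.univ.filter (fun i : Fin n => (i : ℕ) < j) ∈ chainWithSingletons n := by
  rw [mem_cws]
  exact Or.inl ⟨j, hj, rfl⟩

theorem top_seg {n : ℕ} {a b c : Finset (Fin n)} (hb : b ∈ chainWithSingletons n)
    (hab : a ⊆ b) (hba : ¬ b ⊆ a) (hac : ¬ a ⊆ c) :
    ∃ j ≤ n, b = Finset.univ.filter (fun i : Fin n => (i : ℕ) < j) := by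
  rcases (mem_cws b).1 hb with h | ⟨i, hi, rfl⟩
  · exact h
  · exfalso
    rcases Finset.subset_singleton_iff.1 hab with h | h
    · subst h; simp at hac
    · subst h; simp at hba

theorem free_cws (n : ℕ) : ¬ ContainsIndCopy TwoC2 (chainWithSingletons n) := by
  rintro ⟨f, -, hm, h⟩
  have e1 := (h (Sum.inl 0) (Sum.inl 1)).1 (by simp)
  have e2 := (h (Sum.inr 0) (Sum.inr 1)).1 (by simp)
  have e3 : ¬ f (Sum.inl 1) ⊆ f (Sum.inl 0) := fun k => by simpa using (h _ _).2 k
  have e4 : ¬ f (Sum.inr 1) ⊆ f (Sum.inr 0) := fun k => by simpa using (h _ _).2 k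
  have e5 : ¬ f (Sum.inl 0) ⊆ f (Sum.inr 0) := fun k => by simpa using (h _ _).2 k
  have e6 : ¬ f (Sum.inr 0) ⊆ f (Sum.inl 0) := fun k => by simpa using (h _ _).2 k
  have e7 : ¬ f (Sum.inl 1) ⊆ f (Sum.inr 1) := fun k => by simpa using (h _ _).2 k
  have e8 : ¬ f (Sum.inr 1) ⊆ f (Sum.inl 1) := fun k => by simpa using (h _ _).2 k
  obtain ⟨j, -, hj⟩ := top_seg (hm _) e1 e3 e5
  obtain ⟨k, -, hk⟩ := top_seg (hm _) e2 e4 e6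
  rw [hj, hk] at e7 e8
  rcases le_total j k with hjk | hjk
  · apply e7
    intro x
    simp only [Finset.mem_filter, Finset.mem_univ, true_and]
    omega
  · apply e8
    intro x
    simp only [Finset.mem_filter, Finset.mem_univ, true_and]
    omega

theorem copy_of {n : ℕ} {F : Finset (Finset (Fin n))} {a b c d : Finset (Fin n)}
    (ha : a ∈ F) (hb : b ∈ F) (hc : c ∈ F) (hd : d ∈ F)
    (hab : a ⊆ b) (hba : ¬ b ⊆ a) (hcd : c ⊆ d) (hdc : ¬ d ⊆ c)
    (had : ¬ a ⊆ d) (hcb : ¬ c ⊆ b) : ContainsIndCopy TwoC2 F := by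
  have hac : ¬ a ⊆ c := fun h => had (h.trans hcd)
  have hbc : ¬ b ⊆ c := fun h => hac (hab.trans h)
  have hbd : ¬ b ⊆ d := fun h => had (hab.trans h)
  have hca : ¬ c ⊆ a := fun h => hcb (h.trans hab)
  have hda : ¬ d ⊆ a := fun h => hca (hcd.trans h)
  have hdb : ¬ d ⊆ b := fun h => hcb (hcd.trans h)
  have key : ∀ p q : TwoC2, p ≤ q ↔
      (Sum.elim ![a, b] ![c, d] : TwoC2 → Finset (Fin n)) p ⊆
        (Sum.elim ![a, b] ![c, d] : TwoC2 → Finset (Fin n)) q := by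
    rintro (p | p) (q | q) <;> fin_cases p <;> fin_cases q <;> simp [*]
  refine ⟨Sum.elim ![a, b] ![c, d], ?_, ?_, key⟩
  · intro p q h
    exact le_antisymm ((key p q).2 (by rw [h])) ((key q p).2 (by rw [h]))
  · rintro (p | p) <;> fin_cases p <;> simp [*]

theorem sat_cws (n : ℕ) (G : Finset (Fin n)) (hG : G ∉ chainWithSingletons n) :
    ContainsIndCopy TwoC2 (insert G (chainWithSingletons n)) := by
  have hne : G.Nonempty := by
    rw [Finset.nonempty_iff_ne_empty]
    rintro rfl
    apply hG
    have := seg_mem (n := n) 0 (Nat.zero_le _)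
    simpa using this
  obtain ⟨m, hmG, hmax⟩ : ∃ m ∈ G, ∀ x ∈ G, x ≤ m :=
    ⟨G.max' hne, G.max'_mem hne, fun x hx => G.le_max' x hx⟩
  obtain ⟨j, hjm, hjG⟩ : ∃ j < m, j ∉ G := by
    by_contra! hcon
    apply hG
    have := seg_mem (n := n) (m + 1) m.2
    convert this using 1
    ext x
    simp only [Finset.mem_filter, Finset.mem_univ, true_and]
    constructor
    · intro hx
      have := hmax x hx
      rw [Fin.le_def] at this
      omega
    · intro hx
      rcases lt_or_eq_of_le (Fin.le_def.2 (Nat.lt_succ_iff.1 hx)) with h | h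
      · exact hcon x h
      · rwa [h]
  obtain ⟨k, hkG, hkm⟩ : ∃ k ∈ G, k ≠ m := by
    by_contra! hcon
    apply hG
    have : G = {m} := by
      ext x
      simp only [Finset.mem_singleton]
      exact ⟨hcon x, fun h => h ▸ hmG⟩
    rw [this]
    exact single_mem m
  have hkm' : k < m := lt_of_le_of_ne (hmax k hkG) hkm
  have hkj : k ≠ j := fun h => hjG (h ▸ hkG)
  refine copy_of (a := {j}) (b := Finset.univ.filter (fun i : Fin n => (i : ℕ) < m)) (c := {m})
    (d := G) (Finset.mem_insert_of_mem (single_mem j))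
    (Finset.mem_insert_of_mem (seg_mem _ m.2.le)) (Finset.mem_insert_of_mem (single_mem m))
    (Finset.mem_insert_self _ _) ?_ ?_ ?_ ?_ ?_ ?_
  · simpa using hjm
  · intro h
    have := Finset.mem_of_subset (a := k) h (by simpa using hkm')
    simp at this
    exact hkj this
  · simpa using hmG
  · intro h
    have := h hkG
    simp at this
    exact hkm this
  · simpa using hjG
  · simp

theorem card_cws (n : ℕ) (hn : 3 ≤ n) : (chainWithSingletons n).card = 2 * n := by
  unfold chainWithSingletons fullChain
  rw [Finset.card_union_of_disjoint, Finset.card_image_of_injOn, Finset.card_image_of_injective,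
    Finset.card_range]
  · have : (Finset.univ.filter (fun i : Fin n => (i : ℕ) ≠ 0)) = Finset.univ.erase ⟨0, by omega⟩ := by
      ext x
      simp [Fin.ext_iff]
    rw [this, Finset.card_erase_of_mem (Finset.mem_univ _)]
    simp
    omega
  · exact Finset.singleton_injective
  · intro a ha b hb hab
    simp only [Finset.coe_range, Set.mem_Iio] at ha hb
    simp only [Finset.ext_iff, Finset.mem_filter, Finset.mem_univ, true_and] at hab
    by_contra hne
    rcases lt_or_gt_of_ne hne with h | h
    · have := hab ⟨a, by omega⟩
      simp at this
      omega
    · have := hab ⟨b, by omega⟩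
      simp at this
      omega
  · rw [Finset.disjoint_left]
    intro A hA hB
    simp only [Finset.mem_image, Finset.mem_range, Finset.mem_filter, Finset.mem_univ,
      true_and] at hA hB
    obtain ⟨j, hj, rfl⟩ := hA
    obtain ⟨i, hi, h⟩ := hB
    simp only [Finset.ext_iff, Finset.mem_filter, Finset.mem_univ, true_and,
      Finset.mem_singleton] at h
    have h1 := (h i).1 rfl
    have h2 := (h ⟨0, by omega⟩).2 (by simp; omega)
    apply hi
    rw [← h2]

/-- For `n ≥ 3` the family of all initial segments together with all singletons
`{2},…,{n}` is induced `2C₂`-saturating and has `2n` members; in particular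
`sat*(n, 2C₂) ≤ 2n`. -/
theorem satStar_twoC2_le (n : ℕ) (hn : 3 ≤ n) :
    IndSaturating TwoC2 (chainWithSingletons n) ∧
    (chainWithSingletons n).card = 2 * n ∧
    satStar n TwoC2 ≤ 2 * n := by
  have h : IndSaturating TwoC2 (chainWithSingletons n) := ⟨free_cws n, sat_cws n⟩
  exact ⟨h, card_cws n hn, Nat.sInf_le ⟨_, h, card_cws n hn⟩⟩
end

section
/- Let ℱ ⊆ 2^[n] be an induced 2C₂-free family, where 2C₂ is the disjoint union of two incomparable 2-element chains. For F ∈ ℱ write 𝒟_ℱ(F) = {G ∈ ℱ : G ⊊ F}. Then for any F, F′ ∈ ℱ, either 𝒟_ℱ(F) ⊆ 𝒟_ℱ(F′) or 𝒟_ℱ(F′) ⊆ 𝒟_ℱ(F) (equivalently, exactly one of 𝒟_ℱ(F) ⊊ 𝒟_ℱ(F′), 𝒟_ℱ(F′) ⊊ 𝒟_ℱ(F), or 𝒟_ℱ(F) = 𝒟_ℱ(F′) holds). -/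
/-- In an induced `2C₂`-free family `F`, writing `𝒟_F(A) = {G ∈ F : G ⊊ A}`,
the sets `𝒟_F(A)` for `A ∈ F` are totally ordered by inclusion. -/
theorem downsets_totally_ordered {n : ℕ} (F : Finset (Finset (Fin n)))
    (hfree : ¬ ContainsIndCopy TwoC2 F) :
    ∀ A ∈ F, ∀ B ∈ F,
      F.filter (fun G => G ⊂ A) ⊆ F.filter (fun G => G ⊂ B) ∨
      F.filter (fun G => G ⊂ B) ⊆ F.filter (fun G => G ⊂ A) := by
  intro A hA B hB
  by_contra hcon
  rw [not_or, Finset.not_subset, Finset.not_subset] at hcon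
  obtain ⟨⟨X, hX, hXB⟩, ⟨Y, hY, hYA⟩⟩ := hcon
  simp only [Finset.mem_filter, not_and] at hX hXB hY hYA
  obtain ⟨hXF, hXA⟩ := hX
  obtain ⟨hYF, hYB⟩ := hY
  replace hXB := hXB hXF
  replace hYA := hYA hYF
  have n1 : ¬ X ⊆ B := fun h => by
    rcases h.eq_or_ssubset with e | e
    · exact hYA (hYB.trans (e ▸ hXA))
    · exact hXB e
  have n2 : ¬ Y ⊆ A := fun h => by
    rcases h.eq_or_ssubset with e | e
    · exact hXB (hXA.trans (e ▸ hYB))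
    · exact hYA e
  have n3 : ¬ X ⊆ Y := fun h => n1 (h.trans hYB.subset)
  have n4 : ¬ Y ⊆ X := fun h => n2 (h.trans hXA.subset)
  have n5 : ¬ A ⊆ B := fun h => n1 (hXA.subset.trans h)
  have n6 : ¬ B ⊆ A := fun h => n2 (hYB.subset.trans h)
  have n7 : ¬ A ⊆ Y := fun h => n3 (hXA.subset.trans h)
  have n8 : ¬ B ⊆ X := fun h => n4 (hYB.subset.trans h)
  have n9 : ¬ A ⊆ X := hXA.not_subset
  have n10 : ¬ B ⊆ Y := hYB.not_subset
  have key : ∀ p q : TwoC2, p ≤ q ↔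
      (Sum.elim ![X, A] ![Y, B] : TwoC2 → Finset (Fin n)) p ⊆ Sum.elim ![X, A] ![Y, B] q := by
    rintro (p | p) (q | q) <;> fin_cases p <;> fin_cases q <;>
      simp [n1, n2, n3, n4, n5, n6, n7, n8, n9, n10, hXA.subset, hYB.subset]
  refine hfree ⟨Sum.elim ![X, A] ![Y, B], ?_, ?_, key⟩
  · intro p q h
    exact le_antisymm ((key p q).2 h.subset) ((key q p).2 h.symm.subset)
  · rintro (p | p) <;> fin_cases p <;> simp [hXF, hYF, hA, hB]
end

section
/- Let n ≥ 3 and let ℱ ⊆ 2^[n] be an induced 2C₂-saturating family, where 2C₂ is the disjoint union of two incomparable 2-element chains. Then ℱ contains a maximal chain of 2^[n], i.e., there exist sets S₀ ⊊ S₁ ⊊ ⋯ ⊊ Sₙ in ℱ with |Sᵢ| = i for all 0 ≤ i ≤ n (so S₀ = ∅ and Sₙ = [n]). Consequently, sat*(n, 2C₂) ≥ n + 2. -/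
def TGood {n : ℕ} (F : Finset (Finset (Fin n))) (G : Finset (Fin n)) : Prop :=
  ∀ X ∈ F, ∀ Z ∈ F, X ⊂ Z → X ⊆ G ∨ G ⊆ Z

lemma TGood.mem {n : ℕ} {F : Finset (Finset (Fin n))} (hF : IndSaturating TwoC2 F)
    {G : Finset (Fin n)} (hG : TGood F G) : G ∈ F := by
  by_contra hGF
  obtain ⟨f, hinj, hmem, hle⟩ := hF.2 G hGF
  have key : ∀ p, f p ≠ G → f p ∈ F := fun p hp => by
    have := hmem p
    simp only [Finset.mem_insert] at this
    tauto
  have hss : ∀ p q, p < q → f p ⊂ f q := fun p q h => by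
    refine lt_of_le_of_ne ((hle p q).1 h.le) (fun h' => h.ne (hinj h'))
  by_cases hex : ∃ p, f p = G
  · obtain ⟨p, hp⟩ := hex
    have hne : ∀ q, q ≠ p → f q ≠ G := fun q hq h => hq (hinj (h.trans hp.symm))
    rcases p with p | p
    · have h := hG (f (Sum.inr 0)) (key _ (hne _ (by simp))) (f (Sum.inr 1))
        (key _ (hne _ (by simp))) (hss _ _ (by simp))
      rw [← hp, ← hle, ← hle] at h
      simp at h
    · have h := hG (f (Sum.inl 0)) (key _ (hne _ (by simp))) (f (Sum.inl 1))
        (key _ (hne _ (by simp))) (hss _ _ (by simp))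
      rw [← hp, ← hle, ← hle] at h
      simp at h
  · push Not at hex
    exact hF.1 ⟨f, hinj, fun p => key p (hex p), hle⟩

lemma twoC2_of {n : ℕ} {F : Finset (Finset (Fin n))} {a b c d : Finset (Fin n)}
    (ha : a ∈ F) (hb : b ∈ F) (hc : c ∈ F) (hd : d ∈ F) (hab : a ⊂ b) (hcd : c ⊂ d)
    (h1 : ¬ a ⊆ d) (h2 : ¬ c ⊆ b) : ContainsIndCopy TwoC2 F := by
  have hle : ∀ p q : TwoC2, p ≤ q ↔
      (Sum.elim ![a, b] ![c, d] p : Finset (Fin n)) ⊆ Sum.elim ![a, b] ![c, d] q := by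
    have e1 : a ⊆ b := hab.subset
    have e2 : c ⊆ d := hcd.subset
    have e3 : ¬ b ⊆ a := hab.not_subset
    have e4 : ¬ d ⊆ c := hcd.not_subset
    have e5 : ¬ a ⊆ c := fun h => h1 (h.trans e2)
    have e6 : ¬ b ⊆ c := fun h => e5 (e1.trans h)
    have e7 : ¬ b ⊆ d := fun h => h1 (e1.trans h)
    have e8 : ¬ c ⊆ a := fun h => h2 (h.trans e1)
    have e9 : ¬ d ⊆ a := fun h => e8 (e2.trans h)
    have e10 : ¬ d ⊆ b := fun h => h2 (e2.trans h)
    rintro (p | p) (q | q) <;> fin_cases p <;> fin_cases q <;> simp [*]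
  refine ⟨Sum.elim ![a, b] ![c, d], ?_, ?_, hle⟩
  · intro p q h
    exact le_antisymm ((hle p q).2 h.le) ((hle q p).2 h.ge)
  · rintro (p | p) <;> fin_cases p <;> simp [*]

lemma TGood.step {n : ℕ} {F : Finset (Finset (Fin n))} (hF : IndSaturating TwoC2 F)
    {G : Finset (Fin n)} (hG : TGood F G) (hn : G.card < n) :
    ∃ a, a ∉ G ∧ TGood F (insert a G) := by
  classical
  let T := F.filter (fun Z => G ⊆ Z ∧ ∃ X ∈ F, X ⊂ Z ∧ ¬ X ⊆ G)
  by_cases hT : T.Nonempty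
  · obtain ⟨Z, hZ, hmin⟩ := T.exists_min_image (fun Z => (F.filter (· ⊂ Z)).card) hT
    simp only [T, Finset.mem_filter] at hZ hmin
    obtain ⟨hZF, hGZ, X, hX, hXZ, hXG⟩ := hZ
    obtain ⟨a, haX, haG⟩ := Finset.not_subset.1 hXG
    refine ⟨a, haG, fun X' hX' Z' hZ' hlt => ?_⟩
    by_cases h1 : X' ⊆ G
    · exact Or.inl (h1.trans (Finset.subset_insert _ _))
    have hGZ' : G ⊆ Z' := (hG X' hX' Z' hZ' hlt).resolve_left h1
    have hm := hmin Z' ⟨hZ', hGZ', X', hX', hlt, h1⟩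
    right
    have hXZ' : X ⊆ Z' := by
      by_contra hcon
      have hsub : F.filter (· ⊂ Z') ⊆ F.filter (· ⊂ Z) := by
        intro q hq
        simp only [Finset.mem_filter] at hq ⊢
        refine ⟨hq.1, ?_⟩
        by_contra hqZ
        have : ¬ q ⊆ Z := by
          intro h
          rcases eq_or_ne q Z with h' | h'
          · exact hcon ((hXZ.subset.trans h'.ge).trans hq.2.subset)
          · exact hqZ (lt_of_le_of_ne h h')
        exact hF.1 (twoC2_of hX hZF hq.1 hZ' hXZ hq.2 hcon this)
      have heq := Finset.eq_of_subset_of_card_le hsub hm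
      have : X ∈ F.filter (· ⊂ Z') := by rw [heq]; simp [hX, hXZ]
      exact hcon (Finset.mem_filter.1 this).2.subset
    exact Finset.insert_subset (hXZ' haX) hGZ'
  · have : ∃ a, a ∉ G := by
      by_contra h
      push Not at h
      have : G = Finset.univ := Finset.eq_univ_iff_forall.2 h
      simp [this] at hn
    obtain ⟨a, ha⟩ := this
    refine ⟨a, ha, fun X hX Z hZ hlt => ?_⟩
    left
    refine Finset.Subset.trans ?_ (Finset.subset_insert _ _)
    by_contra h1
    have hGZ := (hG X hX Z hZ hlt).resolve_left h1
    exact hT ⟨Z, Finset.mem_filter.2 ⟨hZ, hGZ, X, hX, hlt, h1⟩⟩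

lemma twoC2_chain {n : ℕ} {F : Finset (Finset (Fin n))} (hF : IndSaturating TwoC2 F) :
    ∃ S : ℕ → Finset (Fin n),
      (∀ i, i ≤ n → S i ∈ F) ∧ (∀ i, i ≤ n → (S i).card = i) ∧
      (∀ i, i < n → S i ⊆ S (i + 1)) := by
  have hstep : ∀ G : {G // TGood F G}, ∃ G' : {G // TGood F G},
      G.1 ⊆ G'.1 ∧ (G.1.card < n → G'.1.card = G.1.card + 1) := by
    rintro ⟨G, hG⟩
    by_cases h : G.card < n
    · obtain ⟨a, ha, hg⟩ := hG.step hF h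
      exact ⟨⟨_, hg⟩, Finset.subset_insert _ _, fun _ => Finset.card_insert_of_notMem ha⟩
    · exact ⟨⟨G, hG⟩, subset_rfl, fun h' => absurd h' h⟩
  choose g hg1 hg2 using hstep
  have h0 : TGood F ∅ := fun _ _ _ _ _ => Or.inr (Finset.empty_subset _)
  refine ⟨fun i => (g^[i] ⟨∅, h0⟩).1, fun i _ => (g^[i] ⟨∅, h0⟩).2.mem hF, ?_, ?_⟩
  · intro i
    induction i with
    | zero => simp
    | succ i ih =>
      intro hi
      have := ih (by omega)
      simp only [Function.iterate_succ_apply'] at this ⊢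
      rw [hg2 _ (by omega), this]
  · intro i _
    simp only [Function.iterate_succ_apply']
    exact hg1 _

lemma twoC2_card {n : ℕ} (hn : 3 ≤ n) {F : Finset (Finset (Fin n))}
    (hF : IndSaturating TwoC2 F) : n + 2 ≤ F.card := by
  classical
  obtain ⟨S, hS, hc, hsub⟩ := twoC2_chain hF
  have hmono : ∀ i j, i ≤ j → j ≤ n → S i ⊆ S j := by
    intro i j hij
    induction j, hij using Nat.le_induction with
    | base => intro _; exact subset_rfl
    | succ j _ ih => intro h; exact (ih (by omega)).trans (hsub j (by omega))
  have himg : ((Finset.range (n + 1)).image S) ⊆ F := by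
    intro x hx
    simp only [Finset.mem_image, Finset.mem_range] at hx
    obtain ⟨i, hi, rfl⟩ := hx
    exact hS i (by omega)
  have hcard : ((Finset.range (n + 1)).image S).card = n + 1 := by
    rw [Finset.card_image_of_injOn, Finset.card_range]
    intro i hi j hj h
    simp only [Finset.coe_range, Set.mem_Iio] at hi hj
    rw [← hc i (by omega), ← hc j (by omega), h]
  by_contra hlt
  have heq := Finset.eq_of_subset_of_card_le himg (by omega)
  have htot : ∀ x ∈ F, ∀ y ∈ F, x ⊆ y ∨ y ⊆ x := by
    rw [← heq]
    intro x hx y hy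
    simp only [Finset.mem_image, Finset.mem_range] at hx hy
    obtain ⟨i, hi, rfl⟩ := hx
    obtain ⟨j, hj, rfl⟩ := hy
    rcases le_total i j with h | h
    · exact Or.inl (hmono i j h (by omega))
    · exact Or.inr (hmono j i h (by omega))
  have hpow : n + 1 < 2 ^ n := by
    clear * - hn
    induction n, hn using Nat.le_induction with
    | base => norm_num
    | succ k _ ih => rw [pow_succ]; omega
  have hG : ∃ G, G ∉ F := by
    by_contra h
    push Not at h
    have : F = Finset.univ := Finset.eq_univ_iff_forall.2 h
    have h2 : F.card = 2 ^ n := by rw [this]; simp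
    omega
  obtain ⟨G, hG⟩ := hG
  obtain ⟨f, hinj, hmem, hle⟩ := hF.2 G hG
  have key : ∀ p q, p ≠ q → f p ∈ F ∨ f q ∈ F := fun p q hpq => by
    have h1 := hmem p
    have h2 := hmem q
    simp only [Finset.mem_insert] at h1 h2
    have : f p ≠ f q := fun h => hpq (hinj h)
    rcases h1 with h1 | h1
    · rcases h2 with h2 | h2
      · exact absurd (h1.trans h2.symm) this
      · exact Or.inr h2
    · exact Or.inl h1
  have hl : ∃ p : Fin 2, f (Sum.inl p) ∈ F := by
    rcases key (Sum.inl 0) (Sum.inl 1) (by simp) with h | h <;> exact ⟨_, h⟩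
  have hr : ∃ p : Fin 2, f (Sum.inr p) ∈ F := by
    rcases key (Sum.inr 0) (Sum.inr 1) (by simp) with h | h <;> exact ⟨_, h⟩
  obtain ⟨p, hp⟩ := hl
  obtain ⟨q, hq⟩ := hr
  have h := htot _ hp _ hq
  rw [← hle, ← hle] at h
  simp at h

/-- Every induced `2C₂`-saturating family `F ⊆ 2^[n]` (with `n ≥ 3`) contains a
maximal chain `S₀ ⊊ S₁ ⊊ ⋯ ⊊ Sₙ` with `|Sᵢ| = i`; consequently
`sat*(n, 2C₂) ≥ n + 2`. -/
theorem twoC2_saturating_contains_maximal_chain (n : ℕ) (hn : 3 ≤ n)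
    (F : Finset (Finset (Fin n))) (hF : IndSaturating TwoC2 F) :
    (∃ S : ℕ → Finset (Fin n),
      (∀ i, i ≤ n → S i ∈ F) ∧ (∀ i, i ≤ n → (S i).card = i) ∧
      (∀ i, i < n → S i ⊆ S (i + 1))) ∧
    n + 2 ≤ satStar n TwoC2 := by
  refine ⟨twoC2_chain hF, ?_⟩
  refine le_csInf ⟨_, F, hF, rfl⟩ ?_
  rintro m ⟨F', hF', rfl⟩
  exact twoC2_card hn hF'
end
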